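/- Let K be an algebraically closed field of characteristic zero and fix a positive integer s. Write ND(n,d) for the condition: there exist d-tuples f_1,…,f_s of linear forms in K[x_0,…,x_n] with dim_K Σ_{i=1}^s Σ_{j=1}^d π_j(f_i)·R_1 = min{s(dn+1), C(n+d,d)}. Suppose ND(n,d) holds in the following cases: (i) d = 3 and min{n : s < s_2(n)} ≤ n ≤ min{n : s(3n+1) ≤ C(n+3,3)}; (ii) 4 ≤ d ≤ max{d : s ≥ s_2(d)} and 4 ≤ n ≤ min{n : s(dn+1) ≤ C(n+d,d)}; (iii) min{d : s < s_2(d)} ≤ d ≤ max{d : s > s_1(d)} and 3 ≤ n ≤ min{n : s(dn+1) ≤ C(n+d,d)}. Then ND(n,d) holds for all positive integers n, d, except possibly when d = 2 and n ≥ 2s. -/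

import Mathlib

set_option maxHeartbeats 1000000

open MvPolynomial

/-- The function `s_1` from Theorem 1.2 of the paper. -/
def s1 (d : ℕ) : ℚ :=
  if d % 6 = 0 then (d : ℚ) ^ 2 / 18 + (d : ℚ) / 6 + 1
  else if d % 6 = 1 then (d : ℚ) ^ 2 / 18 + 2 * (d : ℚ) / 9 - 5 / 18
  else if d % 6 = 2 ∨ d % 6 = 5 then (d : ℚ) ^ 2 / 18 + 5 * (d : ℚ) / 18 + 2 / 9
  else if d % 6 = 3 then (d : ℚ) ^ 2 / 18 + (d : ℚ) / 6
  else (d : ℚ) ^ 2 / 18 + 2 * (d : ℚ) / 9 + 2 / 9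

/-- The function `s_2` from Theorem 1.2 of the paper. -/
def s2 (d : ℕ) : ℚ :=
  if d % 6 = 0 then (d : ℚ) ^ 2 / 18 + (d : ℚ) / 3 + 1
  else if d % 6 = 1 then (d : ℚ) ^ 2 / 18 + 7 * (d : ℚ) / 18 + 14 / 9
  else if d % 6 = 2 then (d : ℚ) ^ 2 / 18 + 4 * (d : ℚ) / 9 + 8 / 9
  else if d % 6 = 3 then (d : ℚ) ^ 2 / 18 + (d : ℚ) / 3 + 1 / 2
  else if d % 6 = 4 then (d : ℚ) ^ 2 / 18 + 7 * (d : ℚ) / 18 + 5 / 9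
  else (d : ℚ) ^ 2 / 18 + 4 * (d : ℚ) / 9 + 7 / 18

/-- `ND K s n d`: there exist `d`-tuples `f_1,…,f_s` of linear forms in `K[x_0,…,x_n]` with
`dim Σ_i Σ_j π_j(f_i)·R_1 = min{s(dn+1), C(n+d,d)}`; by Terracini's lemma this is equivalent
to the nondefectivity of `σ_s(Split_d(ℙⁿ))`. -/
def ND (K : Type*) [Field K] (s n d : ℕ) : Prop :=
  ∃ f : Fin s → Fin d → MvPolynomial (Fin (n + 1)) K,
    (∀ i j, (f i j).IsHomogeneous 1) ∧
    Module.finrank K ↥(⨆ i : Fin s, ⨆ j : Fin d,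
        Submodule.map (LinearMap.mulLeft K (∏ m ∈ Finset.univ.erase j, f i m))
          (homogeneousSubmodule (Fin (n + 1)) K 1))
      = min (s * (d * n + 1)) ((n + d).choose d)

namespace Chow

/-! ### Kernel-friendly evaluation -/

/-- Evaluate `n` to a numeral before passing it on. -/
noncomputable def force {α : Type} (n : ℕ) (k : ℕ → α) : α :=
  Nat.rec (k 0) (fun m _ => k (Nat.succ m)) n

noncomputable def forceList {α : Type} (l : List ℕ) : (List ℕ → α) → α :=
  List.rec (fun k => k []) (fun x _ ih k => force x fun y => ih fun ys => k (y :: ys)) l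

noncomputable def forceLists {α : Type} (l : List (List ℕ)) : (List (List ℕ) → α) → α :=
  List.rec (fun k => k []) (fun x _ ih k => forceList x fun y => ih fun ys => k (y :: ys)) l

noncomputable def forceListss {α : Type} (l : List (List (List ℕ))) :
    (List (List (List ℕ)) → α) → α :=
  List.rec (fun k => k []) (fun x _ ih k => forceLists x fun y => ih fun ys => k (y :: ys)) l

noncomputable def mapRec {α β : Type} (f : α → β) (l : List α) : List β :=
  List.rec [] (fun x _ r => f x :: r) l

noncomputable def appendRec {α : Type} (l l' : List α) : List α :=
  List.rec l' (fun x _ r => x :: r) l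

noncomputable def prodRec (l : List ℕ) : ℕ :=
  List.rec 1 (fun x _ r => Nat.mul x r) l

/-- The number with the digits `l` in base `b`. -/
noncomputable def pack (b : ℕ) (l : List ℕ) : ℕ :=
  List.rec 0 (fun x _ r => Nat.add x (Nat.mul b r)) l

noncomputable def packOnto {α : Type} (b : ℕ) (f : α → ℕ) (r : ℕ) (l : List α) : ℕ :=
  List.rec r (fun x _ s => Nat.add (f x) (Nat.mul b s)) l

/-! ### Rank bounds for packed vectors modulo `32003` -/

noncomputable def scaleDigits (c : ℕ) (m : ℕ) : ℕ → ℕ :=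
  Nat.rec (fun _ => 0) (fun _ ih p =>
    Nat.add (Nat.mod (Nat.mul (Nat.mod p 18446744073709551616) c) 32003)
      (Nat.mul 18446744073709551616 (ih (Nat.div p 18446744073709551616)))) m

noncomputable def residue (r : ℕ) : ℕ := Nat.mod (Nat.mod r 18446744073709551616) 32003

noncomputable def withPivot (rows : List ℕ) :
    List ℕ → (ℕ → List ℕ → Bool) → Bool → Bool :=
  List.rec (fun _ _ b => b)
    (fun r rs ih acc k b =>
      Nat.rec (ih (r :: acc) k b) (fun _ _ => k r (appendRec acc rs)) (residue r)) rows

noncomputable def reduceRows (p : ℕ) (rows : List ℕ) : (List ℕ → Bool) → Bool :=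
  List.rec (fun k => k []) (fun r _ ih k =>
    force (Nat.div (Nat.add r (Nat.mul (Nat.sub 32003 (residue r)) p)) 18446744073709551616)
      fun r' => ih fun rs => k (r' :: rs)) rows

/-- Gaussian elimination on packed vectors with `m` digits; succeeds if at most `e` digits have
no pivot. -/
noncomputable def elim (m : ℕ) : ℕ → List ℕ → Bool :=
  Nat.rec (fun _ _ => true) (fun m ih e rows =>
    withPivot rows [] (fun r rs =>
      force (Nat.mod (Nat.pow (residue r) 32001) 32003) fun c =>
      force (scaleDigits c (Nat.succ m) r) fun p =>
      cond (Nat.beq (Nat.mod p 18446744073709551616) 1) (reduceRows p rs (ih e)) false)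
      (Nat.rec false (fun e' _ => reduceRows 0 rows (ih e')) e)) m

/-! ### Local universes and columns -/

/-- Pseudo-random residues modulo `32003`. -/
noncomputable def hash (a b c d : ℕ) : ℕ :=
  (fun x => (fun y => Nat.mod (Nat.mul (Nat.mul y y) y) 32003) (Nat.mod (Nat.mul x x) 30011))
    (Nat.add (Nat.mul (Nat.add (Nat.mul (Nat.add (Nat.mul (Nat.add 288 a) 41) b) 41) c) 41) d)

/-- The codes of the elements of the `j`-th block, of size `z`. -/
noncomputable def codes (j z : ℕ) : List ℕ :=
  mapRec (fun x => Nat.add (Nat.mul 16 j) (Nat.succ x)) (List.range z)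

noncomputable def universeCodes (o : ℕ) (bs : List (ℕ × ℕ)) : List ℕ :=
  codes 0 o ++ (bs.zipIdx 1).flatMap fun p => codes p.2 p.1.1

noncomputable def meetsAll (bs : List (ℕ × ℕ)) (l : List ℕ) : Bool :=
  (bs.zipIdx 1).all fun p => l.any fun u => Nat.beq (Nat.div u 16) p.2

noncomputable def localCols (n o : ℕ) (bs : List (ℕ × ℕ)) : List (List ℕ) :=
  ((universeCodes o bs).sublistsLen n).filter (meetsAll bs)

def localSize (o : ℕ) (bs : List (ℕ × ℕ)) : ℕ := o + (bs.map Prod.fst).sum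

/-- The products of all entries but one. -/
noncomputable def omits (l : List ℕ) : List ℕ :=
  List.rec [] (fun x xs r => prodRec xs :: mapRec (Nat.mul x) r) l

noncomputable def reduceList (l : List ℕ) : List ℕ := mapRec (fun x => Nat.mod x 32003) l

/-- Differences `u - a` modulo `32003`. -/
noncomputable def diffs (A : List ℕ) (u : ℕ) : List ℕ :=
  mapRec (fun a => Nat.add u (Nat.mul 32002 a)) A

/-! ### Evaluation at points -/

noncomputable def mulLinear (u : ℕ) (cs : List ℕ) : ℕ → List ℕ :=
  List.rec (fun prev => [prev]) (fun c _ ih prev => Nat.add prev (Nat.mul u c) :: ih c) cs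

/-- The coefficients of `∏ (X + u)`. -/
noncomputable def coords (l : List ℕ) : List ℕ :=
  List.rec [1] (fun u _ cs => mulLinear u cs 0) l

noncomputable def dot (l : List ℕ) : List ℕ → ℕ :=
  List.rec (fun _ => 0) (fun x _ ih l' =>
    List.rec 0 (fun y ys _ => Nat.add (Nat.mul x y) (ih ys)) l') l

structure PointSide where
  A : List ℕ
  deg : ℕ
  tiles : List (List ℕ)

noncomputable def forceSides {α : Type} (l : List PointSide) : (List PointSide → α) → α :=
  List.rec (fun k => k []) (fun s _ ih k =>
    forceList s.A fun A => force s.deg fun deg => forceLists s.tiles fun tiles =>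
      ih fun ss => k (⟨A, deg, tiles⟩ :: ss)) l

noncomputable def pointCore (b X : ℕ) (xs : List ℕ) (tile : List (List ℕ)) : ℕ :=
  forceList (mapRec (fun h => Nat.mod (dot xs h) 32003) tile) fun hs =>
    Nat.add (Nat.mod (prodRec hs) 32003)
      (Nat.mul 18446744073709551616 (Nat.mul X (pack b (reduceList (omits hs)))))

noncomputable def pointSide (l xs : List ℕ) (b X : ℕ) (s : PointSide) (acc : ℕ) : ℕ :=
  forceList (mapRec (fun a => Nat.mod (prodRec (mapRec (fun u => Nat.add u (Nat.mul 32002 a)) l))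
      32003) s.A) fun ps =>
    force (Nat.mul X (pack b (reduceList (omits ps)))) fun P =>
      packOnto (Nat.pow b s.A.length)
        (fun h => Nat.mul (Nat.mod (Nat.pow (dot xs h) s.deg) 32003) P) acc s.tiles

noncomputable def pointCol (b deg : ℕ) (core : List (List (List ℕ))) (sides : List PointSide)
    (l : List ℕ) : ℕ :=
  forceList (reduceList (coords l)) fun xs =>
    force (pack 18446744073709551616 xs.tail) fun X =>
      packOnto (Nat.mul 18446744073709551616 (Nat.pow b deg)) (pointCore b X xs)
        (List.rec 0 (fun s _ r => pointSide l xs b X s r) sides) core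

noncomputable def coreTiles (n deg t : ℕ) : List (List (List ℕ)) :=
  mapRec (fun t => mapRec (fun k => mapRec (fun c => hash 0 t k c) (List.range (n + 1)))
    (List.range deg)) (List.range t)

noncomputable def pointSideOf (n N j z t : ℕ) : PointSide :=
  ⟨codes j z, N - z - n, mapRec (fun t => mapRec (fun c => hash j t 0 c) (List.range (n + 1)))
    (List.range t)⟩

noncomputable def pointRowCount (n o t : ℕ) (bs : List (ℕ × ℕ)) : ℕ :=
  t * (1 + (localSize o bs - n) * n) + (bs.map fun p => p.2 * (p.1 * n)).sum

noncomputable def pointCols (n o t : ℕ) (bs : List (ℕ × ℕ)) (k : List ℕ → Bool) : Bool :=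
  forceListss (coreTiles n (localSize o bs - n) t) fun core =>
  forceSides (mapRec (fun p => pointSideOf n (localSize o bs) p.2 p.1.1 p.1.2) (bs.zipIdx 1))
    fun sides =>
  forceLists (localCols n o bs) fun cols =>
  force (localSize o bs - n) fun deg =>
  force (Nat.pow 18446744073709551616 n) fun b =>
  forceList (mapRec (pointCol b deg core sides) cols) k

/-- Rows of the local matrix are independent. -/
noncomputable def pointSubCheck (n o t : ℕ) (bs : List (ℕ × ℕ)) : Bool :=
  (t == 0 || n.ble (localSize o bs)) &&
  force (pointRowCount n o t bs) fun R => Nat.ble R 1000000 && pointCols n o t bs (elim R 0)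

/-- Columns of the local matrix are independent. -/
noncomputable def pointFillCheck (n o t : ℕ) (bs : List (ℕ × ℕ)) : Bool :=
  (t == 0 || n.ble (localSize o bs)) &&
  force (pointRowCount n o t bs) fun R => force (localCols n o bs).length fun m =>
    Nat.ble R 1000000 && Nat.ble m R && pointCols n o t bs (elim R (R - m))

/-! ### Polarized evaluation of cubics -/

structure CubicGroup where
  A : List ℕ
  deg : ℕ
  len : ℕ
  tiles : List (List ℕ)

noncomputable def forceGroups {α : Type} (l : List CubicGroup) : (List CubicGroup → α) → α :=
  List.rec (fun k => k []) (fun s _ ih k =>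
    forceList s.A fun A => force s.deg fun deg => force s.len fun len =>
      forceLists s.tiles fun tiles => ih fun ss => k (⟨A, deg, len, tiles⟩ :: ss)) l

noncomputable def pairing (wx wy wz ax ay az bx bY bz : ℕ) : ℕ :=
  Nat.add (Nat.mul wx (Nat.add (Nat.mul ay bz) (Nat.mul az bY)))
    (Nat.add (Nat.mul wy (Nat.add (Nat.mul ax bz) (Nat.mul az bx)))
      (Nat.mul wz (Nat.add (Nat.mul ax bY) (Nat.mul ay bx))))

noncomputable def uncons {α : Type} (l : List ℕ) (d : α) (k : ℕ → ℕ → ℕ → α) : α :=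
  List.rec d (fun x l _ => List.rec d (fun y l _ => List.rec d (fun z _ _ => k x y z) l) l) l

/-- The value at `u` of a form with a root of high multiplicity. -/
noncomputable def formValue (p deg u r : ℕ) : ℕ :=
  Nat.mod (Nat.mul p (Nat.pow (Nat.add u (Nat.mul 32002 r)) deg)) 32003

noncomputable def cubicTile (x y z wx wy wz px py pz b deg : ℕ) (tile : List ℕ) : ℕ :=
  uncons tile 0 fun r s t =>
  force (formValue px deg x r) fun ax => force (formValue py deg y r) fun ay =>
  force (formValue pz deg z r) fun az => force (formValue px deg x s) fun bx =>
  force (formValue py deg y s) fun bY => force (formValue pz deg z s) fun bz =>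
  force (formValue px deg x t) fun cx => force (formValue py deg y t) fun cy =>
  force (formValue pz deg z t) fun cz =>
    Nat.add (pairing wx wy wz ax ay az bx bY bz)
      (Nat.mul b (Nat.add (pairing wx wy wz bx bY bz cx cy cz)
        (Nat.mul b (pairing wx wy wz cx cy cz ax ay az))))

noncomputable def cubicGroup (W : List ℕ → ℕ → ℕ → ℕ) (x y z : ℕ) (g : CubicGroup) (acc : ℕ) : ℕ :=
  force (W g.A g.len x) fun wx => force (W g.A g.len y) fun wy => force (W g.A g.len z) fun wz =>
  force (Nat.mod (prodRec (diffs g.A x)) 32003) fun px =>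
  force (Nat.mod (prodRec (diffs g.A y)) 32003) fun py =>
  force (Nat.mod (prodRec (diffs g.A z)) 32003) fun pz =>
  force (Nat.pow 18446744073709551616 g.len) fun b =>
    packOnto (Nat.mul b (Nat.mul b b)) (cubicTile x y z wx wy wz px py pz b g.deg) acc g.tiles

noncomputable def packPowers (_ : List ℕ) (len u : ℕ) : ℕ :=
  pack 18446744073709551616 (mapRec (fun k => Nat.mod (Nat.pow u k) 32003) (List.range len))

noncomputable def packOmits (A : List ℕ) (_ u : ℕ) : ℕ :=
  pack 18446744073709551616 (reduceList (omits (diffs A u)))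

noncomputable def cubicCol (core : CubicGroup) (sides : List CubicGroup) (l : List ℕ) : ℕ :=
  uncons l 0 fun x y z => cubicGroup packPowers x y z core
    (List.rec 0 (fun g _ r => cubicGroup packOmits x y z g r) sides)

noncomputable def cubicTiles (j t : ℕ) : List (List ℕ) :=
  mapRec (fun t => mapRec (fun l => hash j t l 0) (List.range 3)) (List.range t)

noncomputable def cubicRowCount (o t : ℕ) (bs : List (ℕ × ℕ)) : ℕ :=
  t * (3 * (localSize o bs - 2)) + (bs.map fun p => p.2 * (3 * p.1)).sum

noncomputable def cubicFillCheck (o t : ℕ) (bs : List (ℕ × ℕ)) : Bool :=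
  (t == 0 || Nat.ble 3 (localSize o bs)) &&
  force (cubicRowCount o t bs) fun R => force (localCols 3 o bs).length fun m =>
  Nat.ble R 1000000 && Nat.ble m R &&
  force (localSize o bs) fun N =>
  forceLists (cubicTiles 0 t) fun ctiles =>
  forceGroups (mapRec (fun p => ⟨codes p.2 p.1.1, N - p.1.1 - 3, p.1.1, cubicTiles p.2 p.1.2⟩)
    (bs.zipIdx 1)) fun sides =>
  forceLists (localCols 3 o bs) fun cols =>
  forceList (mapRec (cubicCol ⟨[], N - 3, N - 2, ctiles⟩ sides) cols) (elim R (R - m))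

@[simp] theorem force_eq {α : Type} (n : ℕ) (k : ℕ → α) : force n k = k n := by
  cases n <;> rfl

@[simp] theorem forceList_eq {α : Type} (l : List ℕ) (k : List ℕ → α) :
    forceList l k = k l := by
  induction l generalizing k with
  | nil => rfl
  | cons x l ih =>
    change force x (fun y => forceList l fun ys => k (y :: ys)) = _
    rw [force_eq, ih]

@[simp] theorem forceLists_eq {α : Type} (l : List (List ℕ)) (k : List (List ℕ) → α) :
    forceLists l k = k l := by
  induction l generalizing k with
  | nil => rfl
  | cons x l ih =>
    change forceList x (fun y => forceLists l fun ys => k (y :: ys)) = _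
    rw [forceList_eq, ih]

@[simp] theorem forceListss_eq {α : Type} (l : List (List (List ℕ)))
    (k : List (List (List ℕ)) → α) : forceListss l k = k l := by
  induction l generalizing k with
  | nil => rfl
  | cons x l ih =>
    change forceLists x (fun y => forceListss l fun ys => k (y :: ys)) = _
    rw [forceLists_eq, ih]

@[simp] theorem mapRec_eq {α β : Type} (f : α → β) (l : List α) : mapRec f l = l.map f := by
  induction l with
  | nil => rfl
  | cons x l ih => exact congrArg (f x :: ·) ih

@[simp] theorem appendRec_eq {α : Type} (l l' : List α) : appendRec l l' = l ++ l' := by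
  induction l with
  | nil => rfl
  | cons x l ih => exact congrArg (x :: ·) ih

@[simp] theorem prodRec_eq (l : List ℕ) : prodRec l = l.prod := by
  induction l with
  | nil => rfl
  | cons x l ih => rw [List.prod_cons, ← ih]; rfl

@[simp] theorem pack_eq (b : ℕ) (l : List ℕ) : pack b l = Nat.ofDigits b l := by
  induction l with
  | nil => rfl
  | cons x l ih => rw [Nat.ofDigits_cons, ← ih]; rfl

instance : Fact (Nat.Prime 32003) := ⟨by norm_num⟩

/-- The vector with the given digits. -/
def vec (L : List ℕ) : ℕ → ZMod 32003 := fun j => (L.getD j 0 : ℕ)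

def shift : (ℕ → ZMod 32003) →ₗ[ZMod 32003] (ℕ → ZMod 32003) :=
  LinearMap.funLeft _ _ Nat.succ

theorem shift_vec_cons (x : ℕ) (L : List ℕ) : shift (vec (x :: L)) = vec L := by
  ext j; simp [shift, vec, LinearMap.funLeft_apply]

theorem scaleDigits_ofDigits (c : ℕ) (L : List ℕ) (hL : ∀ x ∈ L, x < 18446744073709551616) :
    scaleDigits c L.length (Nat.ofDigits 18446744073709551616 L) =
      Nat.ofDigits 18446744073709551616 (L.map fun x => x * c % 32003) := by
  induction L with
  | nil => rfl
  | cons x L ih =>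
    have hx := hL x List.mem_cons_self
    have h := ih fun y hy => hL y (List.mem_cons_of_mem _ hy)
    have h1 : Nat.ofDigits 18446744073709551616 (x :: L) % 18446744073709551616 = x := by
      rw [Nat.ofDigits_cons]; omega
    have h2 : Nat.ofDigits 18446744073709551616 (x :: L) / 18446744073709551616 =
        Nat.ofDigits 18446744073709551616 L := by
      rw [Nat.ofDigits_cons]; omega
    change (Nat.ofDigits 18446744073709551616 (x :: L) % 18446744073709551616) * c % 32003 +
      18446744073709551616 * scaleDigits c L.length
        (Nat.ofDigits 18446744073709551616 (x :: L) / 18446744073709551616) = _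
    rw [h1, h2, h, List.map_cons, Nat.ofDigits_cons]

theorem residue_cons (x : ℕ) (L : List ℕ) (hx : x < 18446744073709551616) :
    residue (Nat.ofDigits 18446744073709551616 (x :: L)) = x % 32003 := by
  change Nat.ofDigits 18446744073709551616 (x :: L) % 18446744073709551616 % 32003 = _
  rw [Nat.ofDigits_cons]; omega

theorem exists_of_withPivot (rows acc : List ℕ) (k : ℕ → List ℕ → Bool) (b : Bool)
    (h : withPivot rows acc k b = true) :
    b = true ∨ ∃ r rs, k r rs = true ∧ (r :: rs).Perm (acc ++ rows) := by
  induction rows generalizing acc with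
  | nil => exact Or.inl h
  | cons r rs ih =>
    have key : ∀ m : ℕ, Nat.rec (motive := fun _ => Bool) (withPivot rs (r :: acc) k b)
        (fun _ _ => k r (appendRec acc rs)) m = true →
        b = true ∨ ∃ r' rs', k r' rs' = true ∧ (r' :: rs').Perm (acc ++ r :: rs) := by
      intro m hm
      cases m with
      | zero =>
        rcases ih _ hm with h | ⟨r', rs', h1, h2⟩
        · exact Or.inl h
        · exact Or.inr ⟨r', rs', h1, h2.trans List.perm_middle.symm⟩
      | succ m =>
        exact Or.inr ⟨r, _, hm, by rw [appendRec_eq]; exact List.perm_middle.symm⟩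
    exact key _ h

theorem reduceRows_eq (p : ℕ) (rows : List ℕ) (k : List ℕ → Bool) :
    reduceRows p rows k =
      k (rows.map fun r => (r + (32003 - residue r) * p) / 18446744073709551616) := by
  induction rows generalizing k with
  | nil => rfl
  | cons r rs ih =>
    change force _ (fun r' => reduceRows p rs fun rs => k (r' :: rs)) = _
    rw [force_eq, ih]; rfl

theorem ofDigits_add_mul (k : ℕ) (L P : List ℕ) (h : L.length = P.length) :
    Nat.ofDigits 18446744073709551616 L + k * Nat.ofDigits 18446744073709551616 P =
      Nat.ofDigits 18446744073709551616 (List.zipWith (fun x y => x + k * y) L P) := by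
  induction L generalizing P with
  | nil => cases P with
    | nil => simp [Nat.ofDigits]
    | cons y P => simp at h
  | cons x L ih => cases P with
    | nil => simp at h
    | cons y P =>
      rw [List.zipWith_cons_cons, Nat.ofDigits_cons, Nat.ofDigits_cons, Nat.ofDigits_cons,
        ← ih P (by simpa using h)]
      ring

theorem vec_zipWith (k : ℕ) (L P : List ℕ) (h : L.length = P.length) :
    vec (List.zipWith (fun x y => x + k * y) L P) = vec L + (k : ZMod 32003) • vec P := by
  induction L generalizing P with
  | nil => cases P with
    | nil => ext j; simp [vec]
    | cons y P => simp at h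
  | cons x L ih => cases P with
    | nil => simp at h
    | cons y P =>
      ext j
      cases j with
      | zero => simp [vec]
      | succ j => simpa [vec] using congrFun (ih P (by simpa using h)) j

theorem vec_map_mul_mod (c : ℕ) (L : List ℕ) :
    vec (L.map fun x => x * c % 32003) = (c : ZMod 32003) • vec L := by
  ext j
  by_cases hj : j < L.length
  · simp [vec, hj, mul_comm]
  · simp [vec, hj]

/-- The span of a list of digit vectors. -/
def digitSpan (Ls : List (List ℕ)) : Submodule (ZMod 32003) (ℕ → ZMod 32003) :=
  Submodule.span _ {v | ∃ L ∈ Ls, v = vec L}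

instance (Ls : List (List ℕ)) : FiniteDimensional (ZMod 32003) (digitSpan Ls) :=
  FiniteDimensional.span_of_finite _ <|
    ((List.finite_toSet Ls).image vec).subset fun _ ⟨L, hL, hv⟩ => ⟨L, hL, hv.symm⟩

theorem vec_mem_digitSpan {Ls : List (List ℕ)} {L : List ℕ} (hL : L ∈ Ls) :
    vec L ∈ digitSpan Ls := Submodule.subset_span ⟨L, hL, rfl⟩

theorem finrank_digitSpan_le_of_shift (Ls Ls' : List (List ℕ))
    (h : ∀ L' ∈ Ls', ∃ v ∈ digitSpan Ls, vec L' = shift v) :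
    Module.finrank (ZMod 32003) (digitSpan Ls') ≤ Module.finrank (ZMod 32003) (digitSpan Ls) := by
  refine (Submodule.finrank_mono ?_).trans (Submodule.finrank_map_le shift (digitSpan Ls))
  refine Submodule.span_le.2 ?_
  rintro _ ⟨L', hL', rfl⟩
  obtain ⟨v, hv, e⟩ := h L' hL'
  exact ⟨v, hv, e.symm⟩

theorem finrank_digitSpan_lt_of_shift (Ls Ls' : List (List ℕ)) (p : ℕ → ZMod 32003)
    (hp : p ∈ digitSpan Ls) (hp0 : p 0 = 1)
    (h : ∀ L' ∈ Ls', ∃ v ∈ digitSpan Ls, v 0 = 0 ∧ vec L' = shift v) :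
    Module.finrank (ZMod 32003) (digitSpan Ls') + 1 ≤
      Module.finrank (ZMod 32003) (digitSpan Ls) := by
  let W := digitSpan Ls ⊓ LinearMap.ker (LinearMap.proj (R := ZMod 32003)
    (φ := fun _ : ℕ => ZMod 32003) 0)
  have : FiniteDimensional (ZMod 32003) W := Submodule.finiteDimensional_inf_left _ _
  have h1 : Module.finrank (ZMod 32003) (digitSpan Ls') ≤ Module.finrank (ZMod 32003) W := by
    refine (Submodule.finrank_mono ?_).trans (Submodule.finrank_map_le shift W)
    refine Submodule.span_le.2 ?_
    rintro _ ⟨L', hL', rfl⟩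
    obtain ⟨v, hv, h0, e⟩ := h L' hL'
    exact ⟨v, ⟨hv, h0⟩, e.symm⟩
  have h2 : W < digitSpan Ls := by
    refine lt_of_le_of_ne inf_le_left fun e => ?_
    have : p ∈ W := e ▸ hp
    have h0 : p 0 = 0 := this.2
    exact one_ne_zero (hp0.symm.trans h0)
  have := Submodule.finrank_lt_finrank_of_lt h2
  omega

theorem le_finrank_of_elim (m e b : ℕ) (Ls : List (List ℕ))
    (hL : ∀ L ∈ Ls, L.length = m ∧ ∀ x ∈ L, x ≤ b)
    (hb : b + m * 32003 ^ 2 < 18446744073709551616)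
    (h : elim m e (Ls.map (Nat.ofDigits 18446744073709551616)) = true) :
    m ≤ Module.finrank (ZMod 32003) (digitSpan Ls) + e := by
  induction m generalizing e b Ls with
  | zero => exact Nat.zero_le _
  | succ m ih =>
    have hlt : ∀ L ∈ Ls, ∀ x ∈ L, x < 18446744073709551616 := fun L hL' x hx => by
      have := (hL L hL').2 x hx; nlinarith
    rcases exists_of_withPivot _ _ _ _ h with h | ⟨r, rs, h, hperm⟩
    · cases e with
      | zero => exact absurd h Bool.false_ne_true
      | succ e =>
        change reduceRows 0 _ (elim m e) = true at h
        rw [reduceRows_eq, List.map_map] at h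
        have key : (Ls.map ((fun r => (r + (32003 - residue r) * 0) / 18446744073709551616) ∘
            Nat.ofDigits 18446744073709551616)) =
            (Ls.map List.tail).map (Nat.ofDigits 18446744073709551616) := by
          rw [List.map_map]
          refine List.map_congr_left fun L hL' => ?_
          obtain ⟨h1, h2⟩ := hL L hL'
          cases L with
          | nil => simp at h1
          | cons x L =>
            have := hlt _ hL' x List.mem_cons_self
            simp only [Function.comp, Nat.ofDigits_cons, List.tail_cons]
            omega
        rw [key] at h
        have := ih e b _ ?_ (by nlinarith) h
        · have h3 : Module.finrank (ZMod 32003) (digitSpan (Ls.map List.tail)) ≤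
              Module.finrank (ZMod 32003) (digitSpan Ls) := by
            refine finrank_digitSpan_le_of_shift _ _ fun L' hL' => ?_
            obtain ⟨L, hL1, rfl⟩ := List.mem_map.1 hL'
            refine ⟨vec L, vec_mem_digitSpan hL1, ?_⟩
            cases L with
            | nil => exact absurd (hL _ hL1).1 (by simp)
            | cons x L => rw [shift_vec_cons]; rfl
          omega
        · intro L' hL'
          obtain ⟨L, hL1, rfl⟩ := List.mem_map.1 hL'
          refine ⟨by simp [(hL L hL1).1], fun x hx => (hL L hL1).2 x (List.mem_of_mem_tail hx)⟩
    · rw [force_eq, force_eq] at h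
      generalize Nat.mod (Nat.pow (residue r) 32001) 32003 = c at h
      rw [List.nil_append] at hperm
      obtain ⟨Ls', hmap, hLs'⟩ : ∃ Ls' : List (List ℕ),
          r :: rs = Ls'.map (Nat.ofDigits 18446744073709551616) ∧ Ls'.Perm Ls := by
        have h2 := List.eq_map_comp_perm (Nat.ofDigits (18446744073709551616 : ℕ))
        exact (congrFun (congrFun h2 (r :: rs)) Ls).mpr hperm
      cases Ls' with
      | nil => simp at hmap
      | cons P Lr =>
        rw [List.map_cons, List.cons.injEq] at hmap
        obtain ⟨rfl, rfl⟩ := hmap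
        have hP := hLs'.subset List.mem_cons_self
        have hr : ∀ L ∈ Lr, L ∈ Ls := fun L h => hLs'.subset (List.mem_cons_of_mem _ h)
        rw [show Nat.succ m = P.length from (hL P hP).1.symm,
          scaleDigits_ofDigits c P (hlt P hP)] at h
        cases P with
        | nil => exact absurd (hL _ hP).1 (by simp)
        | cons y P =>
          have hP1 : P.length = m := by simpa using (hL _ hP).1
          rw [List.map_cons] at h
          set P' := P.map fun x => x * c % 32003 with hP'
          have hy : y * c % 32003 = 1 ∧ reduceRows (Nat.ofDigits 18446744073709551616
              (y * c % 32003 :: P')) (Lr.map (Nat.ofDigits 18446744073709551616)) (elim m e) =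
              true := by
            revert h
            cases h : Nat.beq (Nat.mod (Nat.ofDigits 18446744073709551616
              (y * c % 32003 :: P')) 18446744073709551616) 1 with
            | false => exact fun h => absurd h Bool.false_ne_true
            | true =>
              refine fun h' => ⟨?_, h'⟩
              have := Nat.eq_of_beq_eq_true h
              change Nat.ofDigits 18446744073709551616
                (y * c % 32003 :: P') % 18446744073709551616 = 1 at this
              rw [Nat.ofDigits_cons] at this
              omega
          obtain ⟨hy1, h⟩ := hy
          rw [reduceRows_eq, List.map_map, hy1] at h
          let red : List ℕ → List ℕ := fun L =>
            List.zipWith (fun x y => x + (32003 - L.headD 0 % 32003) * y) L.tail P'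
          have key : (Lr.map ((fun r => (r + (32003 - residue r) * Nat.ofDigits
              18446744073709551616 (1 :: P')) / 18446744073709551616) ∘
              Nat.ofDigits 18446744073709551616)) =
              (Lr.map red).map (Nat.ofDigits 18446744073709551616) := by
            rw [List.map_map]
            refine List.map_congr_left fun L hL' => ?_
            obtain ⟨h1, h2⟩ := hL L (hr L hL')
            cases L with
            | nil => simp at h1
            | cons x L =>
              have hx := hlt _ (hr _ hL') x List.mem_cons_self
              have hxb := h2 x List.mem_cons_self
              simp only [Function.comp, residue_cons x L hx, red, List.tail_cons, List.headD_cons]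
              rw [← ofDigits_add_mul _ L P' (by simp [hP', hP1]; simpa using h1),
                Nat.ofDigits_cons, Nat.ofDigits_cons]
              generalize Nat.ofDigits 18446744073709551616 L = U
              generalize Nat.ofDigits 18446744073709551616 P' = V
              generalize hk : 32003 - x % 32003 = k
              have : x + k < 18446744073709551616 := by nlinarith [Nat.sub_le 32003 (x % 32003)]
              rw [show x + 18446744073709551616 * U + k * (1 + 18446744073709551616 * V) =
                (x + k) + 18446744073709551616 * (U + k * V) by ring,
                Nat.add_mul_div_left _ _ (by norm_num), Nat.div_eq_of_lt this, zero_add]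
          rw [key] at h
          have := ih e (b + 32003 ^ 2) _ ?_ (by nlinarith) h
          · have h3 := finrank_digitSpan_lt_of_shift Ls (Lr.map red)
              ((c : ZMod 32003) • vec (y :: P))
              (Submodule.smul_mem _ _ (vec_mem_digitSpan hP)) ?_ ?_
            · omega
            · have : ((y * c % 32003 : ℕ) : ZMod 32003) = 1 := by rw [hy1]; simp
              rw [ZMod.natCast_mod] at this
              push_cast at this
              simpa [vec, mul_comm] using this
            · intro L' hL'
              obtain ⟨L, hL1, rfl⟩ := List.mem_map.1 hL'
              obtain ⟨h1, h2⟩ := hL L (hr L hL1)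
              cases L with
              | nil => simp at h1
              | cons x L =>
                refine ⟨vec (x :: L) + ((32003 - x % 32003 : ℕ) : ZMod 32003) •
                  (c : ZMod 32003) • vec (y :: P), ?_, ?_, ?_⟩
                · exact Submodule.add_mem _ (vec_mem_digitSpan (hr _ hL1))
                    (Submodule.smul_mem _ _ (Submodule.smul_mem _ _ (vec_mem_digitSpan hP)))
                · have h4 : ((y * c % 32003 : ℕ) : ZMod 32003) = 1 := by rw [hy1]; simp
                  rw [ZMod.natCast_mod] at h4
                  push_cast at h4
                  have h5 : ((32003 - x % 32003 : ℕ) : ZMod 32003) = - (x : ZMod 32003) := by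
                    rw [Nat.cast_sub (Nat.mod_lt _ (by norm_num)).le, ZMod.natCast_mod,
                      ZMod.natCast_self, zero_sub]
                  rw [h5]
                  simp only [vec, Pi.add_apply, Pi.smul_apply, List.getD_cons_zero, smul_eq_mul]
                  linear_combination (-(x : ZMod 32003)) * h4
                · rw [map_add, map_smul, map_smul, shift_vec_cons, shift_vec_cons]
                  simp only [red, List.tail_cons, List.headD_cons]
                  rw [vec_zipWith _ _ _ (by simp [hP', hP1]; simpa using h1), hP',
                    vec_map_mul_mod]
          · intro L' hL'
            obtain ⟨L, hL1, rfl⟩ := List.mem_map.1 hL'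
            obtain ⟨h1, h2⟩ := hL L (hr L hL1)
            refine ⟨by simp [red, h1, hP', hP1], fun x hx => ?_⟩
            obtain ⟨i, hi, rfl⟩ := List.mem_iff_getElem.1 hx
            simp only [red, List.getElem_zipWith]
            simp only [red, List.length_zipWith, lt_min_iff] at hi
            have hu := h2 _ (List.mem_of_mem_tail (List.getElem_mem hi.1))
            have hv : P'[i] < 32003 := by
              obtain ⟨w, -, hw⟩ := List.mem_map.1 (List.getElem_mem hi.2)
              exact hw ▸ Nat.mod_lt _ (by norm_num)
            have : (32003 - L.headD 0 % 32003) * P'[i] ≤ 32003 * 32003 :=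
              Nat.mul_le_mul (Nat.sub_le _ _) hv.le
            omega

/-- `x` has a base `2 ^ 64` expansion with digits at most `b` representing the residues `vs`. -/
def Packs (b x : ℕ) (vs : List (ZMod 32003)) : Prop :=
  ∃ D : List ℕ, Nat.ofDigits 18446744073709551616 D = x ∧ D.map Nat.cast = vs ∧ ∀ y ∈ D, y ≤ b

theorem Packs.nil (b : ℕ) : Packs b 0 [] := ⟨[], rfl, rfl, by simp⟩

theorem Packs.mono {b b' x : ℕ} {vs : List (ZMod 32003)} (h : Packs b x vs) (hb : b ≤ b') :
    Packs b' x vs := by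
  obtain ⟨D, h1, h2, h3⟩ := h
  exact ⟨D, h1, h2, fun y hy => (h3 y hy).trans hb⟩

theorem Packs.cons {b x y : ℕ} {vs : List (ZMod 32003)} (h : Packs b x vs) (hy : y ≤ b) :
    Packs b (y + 18446744073709551616 * x) (y :: vs) := by
  obtain ⟨D, rfl, rfl, h3⟩ := h
  exact ⟨y :: D, Nat.ofDigits_cons, by simp, by simpa using ⟨hy, h3⟩⟩

theorem Packs.append {b x y : ℕ} {vs ws : List (ZMod 32003)} (h : Packs b x vs)
    (h' : Packs b y ws) : Packs b (x + 18446744073709551616 ^ vs.length * y) (vs ++ ws) := by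
  obtain ⟨D, rfl, rfl, h3⟩ := h
  obtain ⟨D', rfl, rfl, h3'⟩ := h'
  refine ⟨D ++ D', by simp [Nat.ofDigits_append], by simp, fun y hy => ?_⟩
  rcases List.mem_append.1 hy with h | h
  · exact h3 y h
  · exact h3' y h

theorem Packs.mul {b x : ℕ} {vs : List (ZMod 32003)} (h : Packs b x vs) (k : ℕ) :
    Packs (k * b) (k * x) (vs.map ((k : ZMod 32003) * ·)) := by
  obtain ⟨D, rfl, rfl, h3⟩ := h
  refine ⟨D.map (k * ·), ?_, by simp [Function.comp_def], ?_⟩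
  · clear h3
    induction D with
    | nil => rfl
    | cons y D ih => rw [List.map_cons, Nat.ofDigits_cons, Nat.ofDigits_cons, ih]; ring
  · intro y hy
    obtain ⟨z, hz, rfl⟩ := List.mem_map.1 hy
    exact Nat.mul_le_mul_left k (h3 z hz)

theorem Packs.packOnto_map {α β : Type} {b B r : ℕ} {ws : List (ZMod 32003)} (h : Packs b r ws)
    (f : β → ℕ) (V : α → List (ZMod 32003)) (k : ℕ) (hB : B = 18446744073709551616 ^ k)
    (l : List α) (g : α → β) (hl : ∀ x ∈ l, (V x).length = k ∧ Packs b (f (g x)) (V x)) :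
    Packs b (Chow.packOnto B f r (l.map g)) (l.flatMap V ++ ws) := by
  induction l with
  | nil => exact h
  | cons x l ih =>
    have h1 := ih fun y hy => hl y (List.mem_cons_of_mem _ hy)
    have hx := hl x List.mem_cons_self
    rw [List.flatMap_cons, List.append_assoc]
    have := hx.2.append h1
    rwa [hx.1, ← hB] at this

theorem Packs.mul_ofDigits {b x : ℕ} {vs : List (ZMod 32003)} (h : Packs b x vs) {n c : ℕ}
    (hn : vs.length = n) (ys : List ℕ) (hy : ∀ y ∈ ys, y ≤ c) :
    Packs (c * b) (x * Nat.ofDigits (18446744073709551616 ^ n) ys)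
      (ys.flatMap fun y : ℕ => vs.map ((y : ZMod 32003) * ·)) := by
  induction ys with
  | nil => exact Packs.nil _
  | cons y ys ih =>
    have h1 := ih fun z hz => hy z (List.mem_cons_of_mem _ hz)
    have h2 := ((h.mul y).mono (Nat.mul_le_mul_right b (hy y List.mem_cons_self))).append h1
    rw [List.length_map, hn] at h2
    rw [List.flatMap_cons, Nat.ofDigits_cons]
    convert h2 using 1
    ring

theorem Packs.ofDigits {b : ℕ} (D : List ℕ) (h : ∀ y ∈ D, y ≤ b) :
    Packs b (Nat.ofDigits 18446744073709551616 D) (D.map Nat.cast) := ⟨D, rfl, rfl, h⟩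

theorem length_le_rank_of_elim {γ ρ : Type} (cols : List γ) (rows : List ρ)
    (E : ρ → γ → ZMod 32003) (col : γ → ℕ) (b e : ℕ)
    (hcol : ∀ l ∈ cols, Packs b (col l) (rows.map (E · l)))
    (hb : b + rows.length * 32003 ^ 2 < 18446744073709551616)
    (h : elim rows.length e (cols.map col) = true) :
    rows.length ≤ (Matrix.of fun (i : Fin cols.length) (j : Fin rows.length) =>
      E rows[j] cols[i]).rank + e := by
  classical
  choose! D hD1 hD2 hD3 using hcol
  have h1 : cols.map col = (cols.map D).map (Nat.ofDigits 18446744073709551616) := by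
    rw [List.map_map]
    exact List.map_congr_left fun l hl => (hD1 l hl).symm
  rw [h1] at h
  refine (le_finrank_of_elim _ _ b _ ?_ hb h).trans (Nat.add_le_add_right ?_ _)
  · intro L hL
    obtain ⟨l, hl, rfl⟩ := List.mem_map.1 hL
    refine ⟨?_, hD3 l hl⟩
    simpa using congrArg List.length (hD2 l hl)
  · rw [Matrix.rank_eq_finrank_span_row]
    let ext : (Fin rows.length → ZMod 32003) →ₗ[ZMod 32003] (ℕ → ZMod 32003) :=
      { toFun := fun v j => if hj : j < rows.length then v ⟨j, hj⟩ else 0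
        map_add' := fun v w => by ext j; by_cases hj : j < rows.length <;> simp [hj]
        map_smul' := fun c v => by ext j; by_cases hj : j < rows.length <;> simp [hj] }
    refine (Submodule.finrank_mono ?_).trans (Submodule.finrank_map_le ext _)
    refine Submodule.span_le.2 ?_
    rintro _ ⟨L, hL, rfl⟩
    obtain ⟨l, hl, rfl⟩ := List.mem_map.1 hL
    obtain ⟨i, hi, rfl⟩ := List.mem_iff_getElem.1 hl
    refine ⟨_, Submodule.subset_span ⟨⟨i, hi⟩, rfl⟩, ?_⟩
    ext j
    have hlen : (D cols[i]).length = rows.length := by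
      simpa using congrArg List.length (hD2 _ hl)
    by_cases hj : j < rows.length
    · have := congrArg (fun l => l[j]?) (hD2 _ hl)
      simp [hj, hlen] at this
      simp [ext, vec, hj, hlen, this]
    · simp [ext, vec, hj, hlen]

theorem linearIndependent_rows_of_elim {γ ρ : Type} (cols : List γ) (rows : List ρ)
    (E : ρ → γ → ZMod 32003) (col : γ → ℕ) (b : ℕ)
    (hcol : ∀ l ∈ cols, Packs b (col l) (rows.map (E · l)))
    (hb : b + rows.length * 32003 ^ 2 < 18446744073709551616)
    (h : elim rows.length 0 (cols.map col) = true) :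
    LinearIndependent (ZMod 32003) fun (j : Fin rows.length) (i : Fin cols.length) =>
      E rows[j] cols[i] := by
  have h1 := length_le_rank_of_elim cols rows E col b 0 hcol hb h
  rw [← Matrix.rank_transpose, Matrix.rank_eq_finrank_span_row] at h1
  refine linearIndependent_iff_card_le_finrank_span.2 ?_
  rw [Fintype.card_fin]
  exact h1

theorem linearIndependent_cols_of_elim {γ ρ : Type} (cols : List γ) (rows : List ρ)
    (E : ρ → γ → ZMod 32003) (col : γ → ℕ) (b : ℕ)
    (hcol : ∀ l ∈ cols, Packs b (col l) (rows.map (E · l)))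
    (hb : b + rows.length * 32003 ^ 2 < 18446744073709551616)
    (hle : cols.length ≤ rows.length)
    (h : elim rows.length (rows.length - cols.length) (cols.map col) = true) :
    LinearIndependent (ZMod 32003) fun (i : Fin cols.length) (j : Fin rows.length) =>
      E rows[j] cols[i] := by
  have h1 := length_le_rank_of_elim cols rows E col b _ hcol hb h
  rw [Matrix.rank_eq_finrank_span_row] at h1
  refine linearIndependent_iff_card_le_finrank_span.2 ?_
  rw [Fintype.card_fin]
  refine le_trans ?_ (le_refl (Module.finrank (ZMod 32003) (Submodule.span (ZMod 32003)
    (Set.range (Matrix.of fun (i : Fin cols.length) (j : Fin rows.length) =>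
      E rows[j] cols[i]).row))))
  omega

theorem omits_map {α : Type} [DecidableEq α] (f : α → ℕ) (A : List α) (hA : A.Nodup) :
    omits (A.map f) = A.map fun a => ((A.erase a).map f).prod := by
  induction A with
  | nil => rfl
  | cons x A ih =>
    obtain ⟨hx, hA⟩ := List.nodup_cons.1 hA
    change prodRec (A.map f) :: mapRec (Nat.mul (f x)) (omits (A.map f)) = _
    rw [prodRec_eq, mapRec_eq, ih hA, List.map_cons, List.erase_cons_head, List.map_map]
    congr 1
    refine List.map_congr_left fun a ha => ?_
    have : x ≠ a := fun h => hx (h ▸ ha)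
    rw [List.erase_cons_tail (by simpa using this), List.map_cons, List.prod_cons]
    rfl

@[simp] theorem reduceList_eq (l : List ℕ) : reduceList l = l.map (· % 32003) := mapRec_eq _ _

theorem diffs_eq (A : List ℕ) (u : ℕ) : diffs A u = A.map fun a => u + 32002 * a := mapRec_eq _ _

/-- The coefficients of `∏ (X + θ k)`: homogeneous coordinates of a point on the dual of the
rational normal curve. -/
noncomputable def symm {A : Type*} [CommRing A] (θ : ℕ → A) (σ : Finset ℕ) (c : ℕ) : A :=
  (∏ k ∈ σ, (Polynomial.X + Polynomial.C (θ k))).coeff c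

theorem mulLinear_cast (u : ℕ) (cs : List ℕ) (prev : ℕ) :
    (mulLinear u cs prev).map (Nat.cast : ℕ → ZMod 32003) =
      List.zipWith (fun x y => x + (u : ZMod 32003) * y) ((prev :: cs).map Nat.cast)
        (cs.map Nat.cast ++ [0]) := by
  induction cs generalizing prev with
  | nil => simp [mulLinear]
  | cons c cs ih =>
    change ((prev + u * c) :: mulLinear u cs c).map _ = _
    rw [List.map_cons, ih]
    simp

theorem coords_cast (l : List ℕ) :
    (coords l).map (Nat.cast : ℕ → ZMod 32003) =
      (List.range (l.length + 1)).map fun c =>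
        ((l.map fun u : ℕ => (Polynomial.X + Polynomial.C (u : ZMod 32003))).prod).coeff c := by
  induction l with
  | nil => simp [coords]
  | cons u l ih =>
    change (mulLinear u (coords l) 0).map _ = _
    rw [mulLinear_cast, List.map_cons, ih]
    generalize hp : (l.map fun u : ℕ => (Polynomial.X + Polynomial.C (u : ZMod 32003))).prod = p
    have hdeg : p.natDegree ≤ l.length := by
      rw [← hp]
      refine (Polynomial.natDegree_list_prod_le _).trans ?_
      rw [List.map_map]
      refine (List.sum_le_card_nsmul _ 1 ?_).trans (by simp)
      intro x hx
      obtain ⟨v, -, rfl⟩ := List.mem_map.1 hx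
      exact Polynomial.natDegree_add_le_of_degree_le Polynomial.natDegree_X_le (by simp)
    rw [List.map_cons, List.prod_cons, hp]
    refine List.ext_getElem (by simp) fun i h1 h2 => ?_
    simp only [List.getElem_zipWith, List.getElem_map, List.getElem_range, add_mul,
      Polynomial.coeff_add, Polynomial.coeff_C_mul]
    congr 1
    · cases i with
      | zero => simp
      | succ i => simp [Polynomial.coeff_X_mul]
    · rw [List.getElem_append]
      split_ifs with h
      · simp
      · simp at h h2
        rw [Polynomial.coeff_eq_zero_of_natDegree_lt (by omega), mul_zero]
        simp

theorem coords_cast_eq_symm (l : List ℕ) (hl : l.Nodup) :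
    (coords l).map (Nat.cast : ℕ → ZMod 32003) =
      (List.range (l.length + 1)).map (symm Nat.cast l.toFinset) := by
  rw [coords_cast]
  refine List.map_congr_left fun c _ => ?_
  rw [symm, List.prod_toFinset _ hl]

theorem dot_cast (l l' : List ℕ) : (dot l l' : ZMod 32003) =
    (List.zipWith (· * ·) (l.map (Nat.cast : ℕ → ZMod 32003)) (l'.map Nat.cast)).sum := by
  induction l generalizing l' with
  | nil => simp [dot]
  | cons x l ih => cases l' with
    | nil => simp [dot]
    | cons y l' =>
      change ((x * y + dot l l' : ℕ) : ZMod 32003) = _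
      push_cast
      rw [ih]
      simp

/-- The value at a point of the linear form with coefficients `h`. -/
noncomputable def hform {A : Type*} [CommRing A] (n : ℕ) (h : ℕ → A) (θ : ℕ → A)
    (σ : Finset ℕ) : A := ∑ c ∈ Finset.range (n + 1), h c * symm θ σ c

/-- The value at a point of the linear form vanishing at all `σ` that contain `a`. -/
def pform {A : Type*} [CommRing A] (θ : ℕ → A) (a : A) (σ : Finset ℕ) : A :=
  ∏ k ∈ σ, (θ k - a)

/-- A block of codes. -/
def blockCodes (j z : ℕ) : Finset ℕ := Finset.Icc (16 * j + 1) (16 * j + z)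

/-- The entries of the local matrix. -/
noncomputable def pointEntry (n N : ℕ) (z : ℕ → ℕ) (σ : Finset ℕ) :
    ℕ × (ℕ ⊕ ℕ) × ℕ → ZMod 32003
  | (t, Sum.inr k, c) => (∏ i ∈ (Finset.range (N - n)).erase k,
      hform n (fun c => (hash 0 t i c : ZMod 32003)) Nat.cast σ) * symm Nat.cast σ c
  | (t, Sum.inl a, c) => (∏ i ∈ (blockCodes (a / 16) (z (a / 16))).erase a,
      pform Nat.cast (i : ZMod 32003) σ) *
      hform n (fun c => (hash (a / 16) t 0 c : ZMod 32003)) Nat.cast σ ^ (N - z (a / 16) - n) *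
      symm Nat.cast σ c

/-- The size of the `j`-th block. -/
def blockSize (bs : List (ℕ × ℕ)) (j : ℕ) : ℕ := (bs.getD (j - 1) (0, 0)).1

def pointRows (n o t : ℕ) (bs : List (ℕ × ℕ)) : List (ℕ × (ℕ ⊕ ℕ) × ℕ) :=
  ((List.range t).flatMap fun t => (t, Sum.inr (localSize o bs - n), n) ::
    (List.range (localSize o bs - n)).flatMap fun k =>
      (List.range n).map fun c => (t, Sum.inr k, c + 1)) ++
  (bs.zipIdx 1).flatMap fun p => (List.range p.1.2).flatMap fun t =>
    ((List.range p.1.1).map fun x => 16 * p.2 + (x + 1)).flatMap fun a =>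
      (List.range n).map fun c => (t, Sum.inl a, c + 1)

theorem codes_eq (j z : ℕ) : codes j z = (List.range z).map fun x => 16 * j + (x + 1) :=
  mapRec_eq _ _

theorem nodup_codes (j z : ℕ) : (codes j z).Nodup := by
  rw [codes_eq]
  exact List.nodup_range.map fun x y h => by simp at h; exact h

theorem toFinset_codes (j z : ℕ) : (codes j z).toFinset = blockCodes j z := by
  ext a
  simp only [codes_eq, blockCodes, List.mem_toFinset, List.mem_map, List.mem_range,
    Finset.mem_Icc]
  constructor
  · rintro ⟨x, hx, rfl⟩; omega
  · intro h; exact ⟨a - 16 * j - 1, by omega, by omega⟩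

theorem blockSize_eq {bs : List (ℕ × ℕ)} {p : (ℕ × ℕ) × ℕ} (hp : p ∈ bs.zipIdx 1) :
    blockSize bs p.2 = p.1.1 := by
  obtain ⟨⟨z, t⟩, j⟩ := p
  obtain ⟨h1, h2, h3⟩ := List.mem_zipIdx hp
  simp only [blockSize]
  rw [List.getD_eq_getElem _ _ (by omega), ← h3]

theorem prod_erase_map {α M : Type*} [DecidableEq α] [CommMonoid M] (A : List α) (hA : A.Nodup)
    (f : α → M) (a : α) : ((A.erase a).map f).prod = ∏ i ∈ A.toFinset.erase a, f i := by
  rw [← List.prod_toFinset f (hA.erase a)]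
  congr 1
  ext x
  simp [hA.mem_erase_iff]

theorem dot_reduceList_coords {n : ℕ} (l : List ℕ) (hl : l.Nodup) (hn : l.length = n)
    (h : ℕ → ℕ) : (dot (reduceList (coords l)) ((List.range (n + 1)).map h) : ZMod 32003) =
      hform n (fun c => (h c : ZMod 32003)) Nat.cast l.toFinset := by
  have h1 : (reduceList (coords l)).map (Nat.cast : ℕ → ZMod 32003) =
      (List.range (n + 1)).map (symm Nat.cast l.toFinset) := by
    rw [← hn, ← coords_cast_eq_symm l hl, reduceList_eq, List.map_map]
    exact List.map_congr_left fun x _ => ZMod.natCast_mod _ _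
  rw [dot_cast, h1, List.map_map, hform, Finset.sum_range, ← List.sum_ofFn]
  congr 1
  refine List.ext_getElem (by simp) fun i _ _ => ?_
  simp only [List.getElem_zipWith, List.getElem_map, List.getElem_range, List.getElem_ofFn,
    Function.comp, mul_comm]

theorem flatMap_congr' {α β : Type*} {l : List α} {f g : α → List β}
    (h : ∀ x ∈ l, f x = g x) : l.flatMap f = l.flatMap g := by
  induction l with
  | nil => rfl
  | cons x l ih =>
    rw [List.flatMap_cons, List.flatMap_cons, h x List.mem_cons_self,
      ih fun y hy => h y (List.mem_cons_of_mem _ hy)]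

theorem length_flatMap_const {α β : Type*} (l : List α) (f : α → List β) (k : ℕ)
    (h : ∀ x ∈ l, (f x).length = k) : (l.flatMap f).length = l.length * k := by
  rw [List.length_flatMap, List.map_congr_left h]
  simp

theorem packs_coords_tail {n : ℕ} {l : List ℕ} (hl : l.Nodup) (hn : l.length = n) :
    Packs 32003 (Nat.ofDigits 18446744073709551616 (reduceList (coords l)).tail)
      ((List.range n).map fun c => symm (Nat.cast : ℕ → ZMod 32003) l.toFinset (c + 1)) := by
  have h1 : (reduceList (coords l)).map (Nat.cast : ℕ → ZMod 32003) =
      (List.range (n + 1)).map (symm Nat.cast l.toFinset) := by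
    rw [← hn, ← coords_cast_eq_symm l hl, reduceList_eq, List.map_map]
    exact List.map_congr_left fun x _ => ZMod.natCast_mod _ _
  refine ⟨_, rfl, ?_, fun y hy => ?_⟩
  · rw [List.map_tail, h1, List.range_succ_eq_map, List.map_cons, List.tail_cons, List.map_map]
    rfl
  · have := List.mem_of_mem_tail hy
    rw [reduceList_eq] at this
    obtain ⟨w, -, rfl⟩ := List.mem_map.1 this
    exact (Nat.mod_lt _ (by norm_num)).le

theorem symm_card {n : ℕ} {l : List ℕ} (hl : l.Nodup) (hn : l.length = n) :
    symm (Nat.cast : ℕ → ZMod 32003) l.toFinset n = 1 := by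
  have h : (∏ k ∈ l.toFinset, (Polynomial.X + Polynomial.C ((k : ℕ) : ZMod 32003))).Monic :=
    Polynomial.monic_prod_of_monic _ _ fun k _ => Polynomial.monic_X_add_C _
  have h2 : (∏ k ∈ l.toFinset, (Polynomial.X + Polynomial.C ((k : ℕ) : ZMod 32003))).natDegree =
      n := by
    rw [Polynomial.natDegree_prod_of_monic _ _ fun k _ => Polynomial.monic_X_add_C _]
    simp only [Polynomial.natDegree_X_add_C, Finset.sum_const, List.toFinset_card_of_nodup hl, hn,
      smul_eq_mul, mul_one]
  rw [symm, ← h2]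
  exact h.leadingCoeff

theorem natMod_eq (a b : ℕ) : Nat.mod a b = a % b := rfl

theorem packs_pointCore {n : ℕ} {l : List ℕ} (hl : l.Nodup) (hn : l.length = n)
    (N t : ℕ) (z : ℕ → ℕ) :
    Packs (32003 ^ 3) (pointCore (18446744073709551616 ^ n)
      (Nat.ofDigits 18446744073709551616 (reduceList (coords l)).tail) (reduceList (coords l))
      ((List.range (N - n)).map fun k => (List.range (n + 1)).map fun c => hash 0 t k c))
      (((t, Sum.inr (N - n), n) :: (List.range (N - n)).flatMap fun k =>
        (List.range n).map fun c => (t, Sum.inr k, c + 1)).map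
          (pointEntry n N z l.toFinset)) := by
  have hmod : ∀ x, x % 32003 ≤ 32003 := fun x => (Nat.mod_lt _ (by norm_num)).le
  have h2 := (packs_coords_tail hl hn).mul_ofDigits (n := n) (by simp)
    ((omits ((List.range (N - n)).map fun k => dot (reduceList (coords l))
      ((List.range (n + 1)).map fun c => hash 0 t k c) % 32003)).map (· % 32003)) (c := 32003) (by
        intro y hy
        obtain ⟨w, -, rfl⟩ := List.mem_map.1 hy
        exact hmod w)
  have h3 := (h2.mono (b' := 32003 ^ 3) (by norm_num)).cons (y := ((List.range (N - n)).map
    fun k => dot (reduceList (coords l))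
      ((List.range (n + 1)).map fun c => hash 0 t k c) % 32003).prod % 32003)
      ((hmod _).trans (by norm_num))
  simp only [pointCore, mapRec_eq, forceList_eq, List.map_map, prodRec_eq, pack_eq]
  convert h3 using 1
  · simp only [Function.comp_def, natMod_eq, Nat.add_eq, Nat.mul_eq, reduceList_eq]
  · rw [List.map_cons]
    congr 1
    · rw [pointEntry, symm_card hl hn, ZMod.natCast_mod, Finset.erase_eq_of_notMem (by simp),
        Finset.prod_range, ← List.prod_ofFn, mul_one, Nat.cast_list_prod, List.map_map]
      congr 1
      refine List.ext_getElem (by simp) fun i _ _ => ?_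
      simp [← dot_reduceList_coords l hl hn]
    · rw [omits_map _ _ List.nodup_range, List.map_map, List.flatMap_map, List.map_flatMap]
      refine flatMap_congr' fun k hk => ?_
      rw [List.map_map, List.map_map]
      refine List.map_congr_left fun c hc => ?_
      simp only [Function.comp, pointEntry, ZMod.natCast_mod, Nat.cast_list_prod, List.map_map]
      rw [prod_erase_map _ List.nodup_range]
      congr 1
      rw [List.toFinset_range]
      refine Finset.prod_congr rfl fun i _ => ?_
      simp [← dot_reduceList_coords l hl hn]

theorem packs_pointSide {n : ℕ} {l : List ℕ} (hl : l.Nodup) (hn : l.length = n)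
    (N j z' t r : ℕ) (ws : List (ZMod 32003)) (z : ℕ → ℕ) (hz : z j = z')
    (hz15 : z' ≤ 15) (hr : Packs (32003 ^ 3) r ws) :
    Packs (32003 ^ 3) (pointSide l (reduceList (coords l)) (18446744073709551616 ^ n)
      (Nat.ofDigits 18446744073709551616 (reduceList (coords l)).tail) (pointSideOf n N j z' t) r)
      ((((List.range t).flatMap fun t =>
        ((List.range z').map fun x => 16 * j + (x + 1)).flatMap fun a =>
          (List.range n).map fun c => (t, Sum.inl a, c + 1)).map
            (pointEntry n N z l.toFinset)) ++ ws) := by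
  have hmod : ∀ x, x % 32003 ≤ 32003 := fun x => (Nat.mod_lt _ (by norm_num)).le
  have h2 := (packs_coords_tail hl hn).mul_ofDigits (n := n) (by simp)
    ((omits ((codes j z').map fun a => (l.map fun u => u + 32002 * a).prod % 32003)).map
      (· % 32003)) (c := 32003) (by
        intro y hy
        obtain ⟨w, -, rfl⟩ := List.mem_map.1 hy
        exact hmod w)
  simp only [pointSide, pointSideOf, mapRec_eq, forceList_eq, force_eq, prodRec_eq, pack_eq,
    List.map_flatMap]
  refine hr.packOnto_map _ _ (z' * n) ?_ _ _ fun i hi => ⟨?_, ?_⟩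
  · rw [Nat.pow_eq, ← pow_mul, codes_eq]; simp [mul_comm]
  · rw [length_flatMap_const _ _ n (by simp)]; simp
  · have h3 := h2.mul (dot (reduceList (coords l))
      ((List.range (n + 1)).map fun c => hash j i 0 c) ^ (N - z' - n) % 32003)
    convert h3.mono (b' := 32003 ^ 3) ?_ using 1
    · simp only [natMod_eq, Nat.add_eq, Nat.mul_eq, Nat.pow_eq, reduceList_eq]
    · rw [omits_map _ _ (nodup_codes _ _), ← codes_eq, List.map_map, List.flatMap_map,
        List.map_flatMap]
      refine flatMap_congr' fun a ha => ?_
      rw [List.map_map, List.map_map, List.map_map]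
      refine List.map_congr_left fun c hc => ?_
      have haj : a / 16 = j := by
        rw [codes_eq] at ha
        obtain ⟨x, hx, rfl⟩ := List.mem_map.1 ha
        rw [List.mem_range] at hx
        omega
      simp only [Function.comp, pointEntry, ZMod.natCast_mod, Nat.cast_list_prod, List.map_map,
        haj, hz, Nat.cast_pow]
      rw [prod_erase_map _ (nodup_codes _ _), dot_reduceList_coords l hl hn, toFinset_codes,
        ← mul_assoc]
      congr 1
      rw [mul_comm]
      congr 1
      refine Finset.prod_congr rfl fun i _ => ?_
      simp only [Function.comp, ZMod.natCast_mod, Nat.cast_list_prod, List.map_map]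
      rw [pform, List.prod_toFinset _ hl]
      congr 1
      refine List.map_congr_left fun u _ => ?_
      have : (32002 : ZMod 32003) = -1 := by decide
      simp [this, sub_eq_add_neg]
    · have := hmod (dot (reduceList (coords l))
        ((List.range (n + 1)).map fun c => hash j i 0 c) ^ (N - z' - n))
      nlinarith

theorem packs_pointCol {n : ℕ} {l : List ℕ} (hl : l.Nodup) (hn : l.length = n)
    (o t : ℕ) (bs : List (ℕ × ℕ)) (hbs : ∀ p ∈ bs, p.1 ≤ 15) :
    Packs (32003 ^ 3) (pointCol (18446744073709551616 ^ n) (localSize o bs - n)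
      (coreTiles n (localSize o bs - n) t)
      ((bs.zipIdx 1).map fun p => pointSideOf n (localSize o bs) p.2 p.1.1 p.1.2) l)
      ((pointRows n o t bs).map (pointEntry n (localSize o bs) (blockSize bs) l.toFinset)) := by
  simp only [pointCol, forceList_eq, force_eq, coreTiles, mapRec_eq, pack_eq]
  rw [pointRows, List.map_append, List.map_flatMap]
  refine Packs.packOnto_map ?_ _ _ (1 + n * (localSize o bs - n)) ?_ _ _ fun i hi =>
    ⟨?_, packs_pointCore hl hn _ _ _⟩
  · have key : ∀ ps : List ((ℕ × ℕ) × ℕ), (∀ p ∈ ps, p ∈ bs.zipIdx 1) →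
        Packs (32003 ^ 3) (List.rec 0 (fun s _ r => pointSide l (reduceList (coords l))
          (18446744073709551616 ^ n)
          (Nat.ofDigits 18446744073709551616 (reduceList (coords l)).tail) s r)
          (ps.map fun p => pointSideOf n (localSize o bs) p.2 p.1.1 p.1.2))
        ((ps.flatMap fun p => (List.range p.1.2).flatMap fun t =>
          ((List.range p.1.1).map fun x => 16 * p.2 + (x + 1)).flatMap fun a =>
          (List.range n).map fun c => (t, Sum.inl a, c + 1)).map
            (pointEntry n (localSize o bs) (blockSize bs) l.toFinset)) := by
      intro ps hps
      induction ps with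
      | nil => exact Packs.nil _
      | cons p ps ih =>
        have hp := hps p List.mem_cons_self
        rw [List.flatMap_cons, List.map_append]
        refine packs_pointSide hl hn _ _ _ _ _ _ _ (blockSize_eq hp) ?_
          (ih fun q hq => hps q (List.mem_cons_of_mem _ hq))
        exact hbs _ (List.fst_mem_of_mem_zipIdx hp)
    exact key _ fun _ h => h
  · change 18446744073709551616 * (18446744073709551616 ^ n) ^ _ = _
    rw [← pow_mul, pow_add, pow_one]
  · rw [List.length_map, List.length_cons, length_flatMap_const _ _ n (by simp)]
    simp [mul_comm, add_comm]

theorem length_pointRows (n o t : ℕ) (bs : List (ℕ × ℕ)) :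
    (pointRows n o t bs).length = pointRowCount n o t bs := by
  rw [pointRows, pointRowCount, List.length_append, length_flatMap_const _ _
    (1 + (localSize o bs - n) * n)]
  · congr 1
    · simp
    · rw [List.length_flatMap]
      have h : ∀ k, ((bs.zipIdx k).map fun p => ((List.range p.1.2).flatMap fun t =>
          ((List.range p.1.1).map fun x => 16 * p.2 + (x + 1)).flatMap fun a =>
          (List.range n).map fun c => ((t, Sum.inl a, c + 1) : ℕ × (ℕ ⊕ ℕ) × ℕ)).length) =
          (bs.map fun p => p.2 * (p.1 * n)) := by
        induction bs with
        | nil => intro k; rfl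
        | cons p bs ih =>
          intro k
          rw [List.zipIdx_cons, List.map_cons, List.map_cons, ih]
          congr 1
          rw [length_flatMap_const _ _ (p.1 * n)]
          · simp
          · intro x _
            rw [length_flatMap_const _ _ n (by simp)]
            simp
      rw [h]
  · intro x _
    rw [List.length_cons, length_flatMap_const _ _ n (by simp)]
    simp [add_comm]

theorem forceSides_eq {α : Type} (l : List PointSide) (k : List PointSide → α) :
    forceSides l k = k l := by
  induction l generalizing k with
  | nil => rfl
  | cons x l ih =>
    change forceList x.A (fun A => force x.deg fun deg => forceLists x.tiles fun tiles =>
      forceSides l fun ss => k (⟨A, deg, tiles⟩ :: ss)) = _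
    rw [forceList_eq, force_eq, forceLists_eq, ih]

theorem pointCols_eq (n o t : ℕ) (bs : List (ℕ × ℕ)) (k : List ℕ → Bool) :
    pointCols n o t bs k = k ((localCols n o bs).map (pointCol (18446744073709551616 ^ n)
      (localSize o bs - n) (coreTiles n (localSize o bs - n) t)
      ((bs.zipIdx 1).map fun p => pointSideOf n (localSize o bs) p.2 p.1.1 p.1.2))) := by
  simp only [pointCols, forceListss_eq, forceSides_eq, forceLists_eq, force_eq, forceList_eq,
    mapRec_eq]
  rfl

theorem nodup_universeCodes (o : ℕ) (bs : List (ℕ × ℕ)) (ho : o ≤ 15) (hbs : ∀ p ∈ bs, p.1 ≤ 15) :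
    (universeCodes o bs).Nodup := by
  have hmem : ∀ j z a, z ≤ 15 → a ∈ codes j z → a / 16 = j := by
    intro j z a hz ha
    rw [codes_eq] at ha
    obtain ⟨x, hx, rfl⟩ := List.mem_map.1 ha
    rw [List.mem_range] at hx
    omega
  rw [universeCodes, List.nodup_append']
  refine ⟨nodup_codes _ _, ?_, ?_⟩
  · rw [List.nodup_flatMap]
    refine ⟨fun p _ => nodup_codes _ _, ?_⟩
    have : (bs.zipIdx 1).Pairwise fun p q => p.2 ≠ q.2 := by
      have h : ((bs.zipIdx 1).map Prod.snd).Nodup := by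
        rw [List.zipIdx_map_snd]; exact List.nodup_range'
      exact List.pairwise_map.1 h
    refine this.imp_of_mem fun {p q} hp hq hpq a ha hb => hpq ?_
    rw [← hmem _ _ a (hbs _ (List.fst_mem_of_mem_zipIdx hp)) ha,
      ← hmem _ _ a (hbs _ (List.fst_mem_of_mem_zipIdx hq)) hb]
  · intro a ha hb
    obtain ⟨p, hp, hb⟩ := List.mem_flatMap.1 hb
    have h1 := hmem _ _ a ho ha
    have h2 := hmem _ _ a (hbs _ (List.fst_mem_of_mem_zipIdx hp)) hb
    have h3 := (List.mem_zipIdx (x := p.1) (i := p.2) hp).1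
    omega

theorem mem_localCols {n o : ℕ} {bs : List (ℕ × ℕ)} {l : List ℕ} :
    l ∈ localCols n o bs ↔ (l.Sublist (universeCodes o bs) ∧ l.length = n) ∧
      ∀ p ∈ bs.zipIdx 1, ∃ u ∈ l, u / 16 = p.2 := by
  simp only [localCols, List.mem_filter, List.mem_sublistsLen, meetsAll, List.all_eq_true,
    List.any_eq_true, Nat.beq_eq]
  rfl

theorem linearIndependent_of_pointSubCheck (n o t : ℕ) (bs : List (ℕ × ℕ)) (ho : o ≤ 15)
    (hbs : ∀ p ∈ bs, p.1 ≤ 15) (h : pointSubCheck n o t bs = true) :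
    LinearIndependent (ZMod 32003) fun (j : Fin (pointRows n o t bs).length)
      (i : Fin (localCols n o bs).length) => pointEntry n (localSize o bs) (blockSize bs)
        (localCols n o bs)[i].toFinset (pointRows n o t bs)[j] := by
  simp only [pointSubCheck, force_eq, pointCols_eq, Bool.and_eq_true, Nat.ble_eq,
    ← length_pointRows] at h
  have hcol : ∀ l ∈ localCols n o bs, Packs (32003 ^ 3) _ _ := fun l hl =>
    packs_pointCol ((mem_localCols.1 hl).1.1.nodup (nodup_universeCodes o bs ho hbs))
      (mem_localCols.1 hl).1.2 o t bs hbs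
  generalize pointCol _ _ _ _ = col at h hcol
  refine linearIndependent_rows_of_elim (localCols n o bs) (pointRows n o t bs)
    (fun r l => pointEntry n (localSize o bs) (blockSize bs) l.toFinset r) col (32003 ^ 3)
    hcol ?_ h.2.2
  · have := h.2.1
    omega

theorem linearIndependent_of_pointFillCheck (n o t : ℕ) (bs : List (ℕ × ℕ)) (ho : o ≤ 15)
    (hbs : ∀ p ∈ bs, p.1 ≤ 15) (h : pointFillCheck n o t bs = true) :
    LinearIndependent (ZMod 32003) fun (i : Fin (localCols n o bs).length)
      (j : Fin (pointRows n o t bs).length) => pointEntry n (localSize o bs) (blockSize bs)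
        (localCols n o bs)[i].toFinset (pointRows n o t bs)[j] := by
  simp only [pointFillCheck, force_eq, pointCols_eq, Bool.and_eq_true, Nat.ble_eq,
    ← length_pointRows] at h
  have hcol : ∀ l ∈ localCols n o bs, Packs (32003 ^ 3) _ _ := fun l hl =>
    packs_pointCol ((mem_localCols.1 hl).1.1.nodup (nodup_universeCodes o bs ho hbs))
      (mem_localCols.1 hl).1.2 o t bs hbs
  generalize pointCol _ _ _ _ = col at h hcol
  refine linearIndependent_cols_of_elim (localCols n o bs) (pointRows n o t bs)
    (fun r l => pointEntry n (localSize o bs) (blockSize bs) l.toFinset r) col (32003 ^ 3) hcol ?_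
    h.2.1.2 h.2.2
  · have := h.2.1.1
    omega

/-- The polarization of the product of three linear forms, evaluated at three points. -/
def cubicPair {A : Type*} [CommRing A] (a b w : ℕ → A) (σ : Finset ℕ) : A :=
  ∑ x ∈ σ, ∑ y ∈ σ.erase x, ∑ z ∈ (σ.erase x).erase y, a x * b y * w z

def sixTerms {A : Type*} [CommRing A] (a b w : ℕ → A) (x y z : ℕ) : A :=
  w x * (a y * b z + a z * b y) + (w y * (a x * b z + a z * b x) + w z * (a x * b y + a y * b x))

theorem cubicPair_triple {A : Type*} [CommRing A] (a b w : ℕ → A) {x y z : ℕ}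
    (h : [x, y, z].Nodup) : cubicPair a b w [x, y, z].toFinset = sixTerms a b w x y z := by
  simp only [List.nodup_cons, List.mem_cons, List.not_mem_nil, or_false, not_or] at h
  obtain ⟨⟨hxy, hxz⟩, hyz, -⟩ := h
  have e1 : ({x, y, z} : Finset ℕ).erase x = {y, z} := by
    ext u; simp only [Finset.mem_erase, Finset.mem_insert, Finset.mem_singleton]; grind
  have e2 : ({x, y, z} : Finset ℕ).erase y = {x, z} := by
    ext u; simp only [Finset.mem_erase, Finset.mem_insert, Finset.mem_singleton]; grind
  have e3 : ({x, y, z} : Finset ℕ).erase z = {x, y} := by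
    ext u; simp only [Finset.mem_erase, Finset.mem_insert, Finset.mem_singleton]; grind
  have e4 : ∀ u v : ℕ, u ≠ v → ({u, v} : Finset ℕ).erase u = {v} := by
    intro u v h
    ext t; simp only [Finset.mem_erase, Finset.mem_insert, Finset.mem_singleton]; grind
  have e5 : ∀ u v : ℕ, u ≠ v → ({u, v} : Finset ℕ).erase v = {u} := by
    intro u v h
    ext t; simp only [Finset.mem_erase, Finset.mem_insert, Finset.mem_singleton]; grind
  simp only [cubicPair, List.toFinset_cons, List.toFinset_nil, insert_empty_eq]
  rw [Finset.sum_insert (by simp [hxy, hxz]), Finset.sum_pair hyz, e1, e2, e3,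
    Finset.sum_pair hyz, Finset.sum_pair hxz, Finset.sum_pair hxy, e4 _ _ hyz, e5 _ _ hyz,
    e4 _ _ hxz, e5 _ _ hxz, e4 _ _ hxy, e5 _ _ hxy]
  simp only [Finset.sum_singleton, sixTerms]
  ring

theorem Packs.add {ι : Type} {b c x y : ℕ} {I : List ι} {v w : ι → ZMod 32003}
    (hx : Packs b x (I.map v)) (hy : Packs c y (I.map w)) :
    Packs (b + c) (x + y) (I.map fun i => v i + w i) := by
  obtain ⟨D, rfl, h2, h3⟩ := hx
  obtain ⟨E, rfl, h5, h6⟩ := hy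
  have hD : D.length = I.length := by simpa using congrArg List.length h2
  have hE : E.length = I.length := by simpa using congrArg List.length h5
  refine ⟨_, (ofDigits_add_mul 1 D E (by omega)).symm.trans (by rw [one_mul]), ?_, ?_⟩
  · refine List.ext_getElem (by simp [hD, hE]) fun i h7 h8 => ?_
    have hi : i < I.length := by simpa using h8
    have h9 := congrArg (fun l => l[i]?) h2
    have h10 := congrArg (fun l => l[i]?) h5
    simp [hi, hD] at h9
    simp [hi, hE] at h10
    simp [h9, h10]
  · intro u hu
    obtain ⟨i, hi, rfl⟩ := List.mem_iff_getElem.1 hu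
    simp only [List.length_zipWith, lt_min_iff] at hi
    rw [List.getElem_zipWith, one_mul]
    exact Nat.add_le_add (h3 _ (List.getElem_mem hi.1)) (h6 _ (List.getElem_mem hi.2))

theorem Packs.mul_right {ι : Type} {b x : ℕ} {I : List ι} {v : ι → ZMod 32003}
    (hx : Packs b x (I.map v)) (k : ℕ) : Packs (b * k) (x * k) (I.map fun i => v i * k) := by
  have := hx.mul k
  rw [List.map_map] at this
  rw [mul_comm b, mul_comm x]
  convert this using 3
  exact mul_comm _ _

theorem packs_pairing {ι : Type} {I : List ι} {w : ι → ℕ → ZMod 32003}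
    {x y z wx wy wz ax ay az bx bY bz : ℕ} {a b : ℕ → ZMod 32003}
    (hx : Packs 32003 wx (I.map (w · x))) (hy : Packs 32003 wy (I.map (w · y)))
    (hz : Packs 32003 wz (I.map (w · z)))
    (ha : (ax : ZMod 32003) = a x ∧ (ay : ZMod 32003) = a y ∧ (az : ZMod 32003) = a z)
    (hb : (bx : ZMod 32003) = b x ∧ (bY : ZMod 32003) = b y ∧ (bz : ZMod 32003) = b z)
    (ha' : ax ≤ 32003 ∧ ay ≤ 32003 ∧ az ≤ 32003)
    (hb' : bx ≤ 32003 ∧ bY ≤ 32003 ∧ bz ≤ 32003) :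
    Packs (6 * 32003 ^ 3) (pairing wx wy wz ax ay az bx bY bz)
      (I.map fun i => sixTerms a b (w i) x y z) := by
  have h := (hx.mul_right (ay * bz + az * bY)).add
    ((hy.mul_right (ax * bz + az * bx)).add (hz.mul_right (ax * bY + ay * bx)))
  have hm : ∀ u v : ℕ, u ≤ 32003 → v ≤ 32003 → u * v ≤ 32003 * 32003 :=
    fun u v hu hv => Nat.mul_le_mul hu hv
  have := hm ay bz ha'.2.1 hb'.2.2
  have := hm az bY ha'.2.2 hb'.2.1
  have := hm ax bz ha'.1 hb'.2.2
  have := hm az bx ha'.2.2 hb'.1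
  have := hm ax bY ha'.1 hb'.2.1
  have := hm ay bx ha'.2.1 hb'.1
  convert h.mono (b' := 6 * 32003 ^ 3) (by omega) using 1
  · simp only [pairing, Nat.add_eq, Nat.mul_eq]
  refine List.map_congr_left fun i _ => ?_
  simp only [sixTerms, Nat.cast_add, Nat.cast_mul, ha.1, ha.2.1, ha.2.2, hb.1, hb.2.1, hb.2.2]

/-- A form with prescribed simple roots and one root of high multiplicity. -/
def cform {A : Type*} [CommRing A] (roots : Finset ℕ) (θ : ℕ → A) (η : A) (deg u : ℕ) : A :=
  (∏ a ∈ roots, (θ u - θ a)) * (θ u - η) ^ deg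

theorem neg_one_eq : (32002 : ZMod 32003) = -1 := by decide

theorem formValue_cast {p deg u r : ℕ} {A : Finset ℕ}
    (hp : (p : ZMod 32003) = ∏ a ∈ A, ((u : ZMod 32003) - a)) :
    (formValue p deg u r : ZMod 32003) = cform A Nat.cast (r : ZMod 32003) deg u := by
  simp only [formValue, natMod_eq, ZMod.natCast_mod, Nat.mul_eq, Nat.pow_eq, Nat.add_eq,
    Nat.cast_mul, Nat.cast_pow, Nat.cast_add, hp, cform, Nat.cast_ofNat, neg_one_eq]
  congr 2
  ring

theorem formValue_le (p deg u r : ℕ) : formValue p deg u r ≤ 32003 :=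
  (Nat.mod_lt _ (by norm_num)).le

theorem cast_prod_diffs (A : List ℕ) (hA : A.Nodup) (u : ℕ) :
    ((diffs A u).prod % 32003 : ℕ) = ∏ a ∈ A.toFinset, ((u : ZMod 32003) - a) := by
  rw [ZMod.natCast_mod, diffs_eq, Nat.cast_list_prod, List.prod_toFinset _ hA, List.map_map]
  congr 1
  refine List.map_congr_left fun a _ => ?_
  simp [neg_one_eq, sub_eq_add_neg]

theorem packs_cubicGroup {ι : Type} (W : List ℕ → ℕ → ℕ → ℕ) (x y z : ℕ) (A : List ℕ)
    (hA : A.Nodup) (j deg t r : ℕ) (ws : List (ZMod 32003)) (I : List ι)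
    (w : ι → ℕ → ZMod 32003)
    (hW : ∀ u, Packs 32003 (W A I.length u) (I.map (w · u)))
    (hr : Packs (6 * 32003 ^ 3) r ws) :
    Packs (6 * 32003 ^ 3) (cubicGroup W x y z ⟨A, deg, I.length, cubicTiles j t⟩ r)
      (((List.range t).flatMap fun t => (List.range 3).flatMap fun l => I.map fun i =>
        sixTerms (cform A.toFinset Nat.cast (hash j t l 0 : ZMod 32003) deg)
          (cform A.toFinset Nat.cast (hash j t ((l + 1) % 3) 0 : ZMod 32003) deg)
          (w i) x y z) ++ ws) := by
  simp only [cubicGroup, force_eq, cubicTiles, mapRec_eq, prodRec_eq]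
  refine hr.packOnto_map _ _ (3 * I.length) ?_ _ _ fun i hi => ⟨?_, ?_⟩
  · simp only [Nat.pow_eq, Nat.mul_eq]; ring
  · rw [length_flatMap_const _ _ I.length (by simp)]; simp
  · simp only [cubicTile, force_eq]
    rw [show (List.range 3) = [0, 1, 2] from rfl]
    simp only [List.map_cons, List.map_nil, List.flatMap_cons, List.flatMap_nil, List.append_nil]
    simp only [uncons, natMod_eq]
    have hf : ∀ u v, (formValue ((diffs A u).prod % 32003) deg u v : ZMod 32003) =
        cform A.toFinset Nat.cast (v : ZMod 32003) deg u :=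
      fun u v => formValue_cast (cast_prod_diffs A hA u)
    have key : ∀ v v' : ℕ, Packs (6 * 32003 ^ 3) _ _ := fun v v' => packs_pairing
      (a := cform A.toFinset Nat.cast (v : ZMod 32003) deg)
      (b := cform A.toFinset Nat.cast (v' : ZMod 32003) deg) (hW x) (hW y) (hW z)
      ⟨hf x v, hf y v, hf z v⟩ ⟨hf x v', hf y v', hf z v'⟩
      ⟨formValue_le _ _ _ _, formValue_le _ _ _ _, formValue_le _ _ _ _⟩
      ⟨formValue_le _ _ _ _, formValue_le _ _ _ _, formValue_le _ _ _ _⟩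
    have := (key (hash j i 0 0) (hash j i 1 0)).append
      ((key (hash j i 1 0) (hash j i 2 0)).append (key (hash j i 2 0) (hash j i 0 0)))
    simp only [List.length_map] at this
    exact this

/-- The entries of the local matrix for cubics. -/
noncomputable def cubicEntry (N : ℕ) (z : ℕ → ℕ) (σ : Finset ℕ) :
    ℕ × (ℕ ⊕ ℕ) × ℕ → ZMod 32003
  | (t, Sum.inr k, l) => cubicPair
      (cform ∅ Nat.cast (hash 0 t l 0 : ZMod 32003) (N - 3))
      (cform ∅ Nat.cast (hash 0 t ((l + 1) % 3) 0 : ZMod 32003) (N - 3))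
      (fun u => (u : ZMod 32003) ^ k) σ
  | (t, Sum.inl a, l) => cubicPair
      (cform (blockCodes (a / 16) (z (a / 16))) Nat.cast (hash (a / 16) t l 0 : ZMod 32003)
        (N - z (a / 16) - 3))
      (cform (blockCodes (a / 16) (z (a / 16))) Nat.cast
        (hash (a / 16) t ((l + 1) % 3) 0 : ZMod 32003) (N - z (a / 16) - 3))
      (fun u => ∏ i ∈ (blockCodes (a / 16) (z (a / 16))).erase a, ((u : ZMod 32003) - i)) σ

def cubicRows (o t : ℕ) (bs : List (ℕ × ℕ)) : List (ℕ × (ℕ ⊕ ℕ) × ℕ) :=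
  ((List.range t).flatMap fun t => (List.range 3).flatMap fun l =>
    (List.range (localSize o bs - 2)).map fun k => (t, Sum.inr k, l)) ++
  (bs.zipIdx 1).flatMap fun p => (List.range p.1.2).flatMap fun t =>
    (List.range 3).flatMap fun l =>
      ((List.range p.1.1).map fun x => 16 * p.2 + (x + 1)).map fun a => (t, Sum.inl a, l)

theorem packs_packPowers (A : List ℕ) (n u : ℕ) :
    Packs 32003 (packPowers A (List.range n).length u)
      ((List.range n).map fun k => (u : ZMod 32003) ^ k) := by
  rw [packPowers, pack_eq, mapRec_eq, List.length_range]
  convert Packs.ofDigits (b := 32003) _ ?_ using 1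
  · rw [List.map_map]
    refine List.map_congr_left fun k _ => ?_
    simp [natMod_eq]
  · intro y hy
    obtain ⟨w, -, rfl⟩ := List.mem_map.1 hy
    exact (Nat.mod_lt _ (by norm_num)).le

theorem packs_packOmits (A : List ℕ) (hA : A.Nodup) (u : ℕ) :
    Packs 32003 (packOmits A A.length u)
      (A.map fun a => ∏ i ∈ A.toFinset.erase a, ((u : ZMod 32003) - i)) := by
  rw [packOmits, pack_eq, diffs_eq, omits_map _ _ hA, reduceList_eq, List.map_map]
  convert Packs.ofDigits (b := 32003) _ ?_ using 1
  · rw [List.map_map]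
    refine List.map_congr_left fun a _ => ?_
    simp only [Function.comp, ZMod.natCast_mod, Nat.cast_list_prod, List.map_map]
    rw [prod_erase_map _ hA]
    refine Finset.prod_congr rfl fun i _ => ?_
    simp [neg_one_eq, sub_eq_add_neg]
  · intro y hy
    obtain ⟨w, -, rfl⟩ := List.mem_map.1 hy
    exact (Nat.mod_lt _ (by norm_num)).le

theorem packs_cubicCol {l : List ℕ} (hl : l.Nodup) (hn : l.length = 3)
    (o t : ℕ) (bs : List (ℕ × ℕ)) (hbs : ∀ p ∈ bs, p.1 ≤ 15) :
    Packs (6 * 32003 ^ 3) (cubicCol ⟨[], localSize o bs - 3, localSize o bs - 2, cubicTiles 0 t⟩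
      ((bs.zipIdx 1).map fun p => ⟨codes p.2 p.1.1, localSize o bs - p.1.1 - 3, p.1.1,
        cubicTiles p.2 p.1.2⟩) l)
      ((cubicRows o t bs).map (cubicEntry (localSize o bs) (blockSize bs) l.toFinset)) := by
  match l, hn with
  | [x, y, z], _ =>
  simp only [cubicCol, uncons]
  rw [cubicRows, List.map_append, List.map_flatMap]
  have key : ∀ ps : List ((ℕ × ℕ) × ℕ), (∀ p ∈ ps, p ∈ bs.zipIdx 1) →
      Packs (6 * 32003 ^ 3) (List.rec 0 (fun g _ r => cubicGroup packOmits x y z g r)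
        (ps.map fun p => (⟨codes p.2 p.1.1, localSize o bs - p.1.1 - 3, p.1.1,
          cubicTiles p.2 p.1.2⟩ : CubicGroup)))
      ((ps.flatMap fun p => (List.range p.1.2).flatMap fun t => (List.range 3).flatMap fun l =>
        ((List.range p.1.1).map fun x => 16 * p.2 + (x + 1)).map fun a => (t, Sum.inl a, l)).map
          (cubicEntry (localSize o bs) (blockSize bs) [x, y, z].toFinset)) := by
    intro ps hps
    induction ps with
    | nil => exact Packs.nil _
    | cons p ps ih =>
      have hp := hps p List.mem_cons_self
      have hp15 := hbs _ (List.fst_mem_of_mem_zipIdx hp)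
      rw [List.flatMap_cons, List.map_append]
      have h := packs_cubicGroup packOmits x y z (codes p.2 p.1.1) (nodup_codes _ _) p.2
        (localSize o bs - p.1.1 - 3) p.1.2 _ _ (codes p.2 p.1.1) _
        (packs_packOmits _ (nodup_codes _ _)) (ih fun q hq => hps q (List.mem_cons_of_mem _ hq))
      have hlen : (codes p.2 p.1.1).length = p.1.1 := by simp [codes_eq]
      rw [hlen] at h
      convert h using 2
      · rfl
      rw [List.map_flatMap]
      refine flatMap_congr' fun i _ => ?_
      rw [List.map_flatMap]
      refine flatMap_congr' fun l _ => ?_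
      rw [← codes_eq, List.map_map]
      refine List.map_congr_left fun a ha => ?_
      have haj : a / 16 = p.2 := by
        rw [codes_eq] at ha
        obtain ⟨x, hx, rfl⟩ := List.mem_map.1 ha
        rw [List.mem_range] at hx
        omega
      rw [← cubicPair_triple _ _ _ hl]
      simp only [Function.comp, cubicEntry, haj, blockSize_eq hp, toFinset_codes]
  have h := packs_cubicGroup packPowers x y z [] List.nodup_nil 0 (localSize o bs - 3) t _ _
    (List.range (localSize o bs - 2)) (fun k u => (u : ZMod 32003) ^ k)
    (packs_packPowers _ _) (key _ fun _ h => h)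
  rw [List.length_range] at h
  convert h using 2
  refine flatMap_congr' fun i _ => ?_
  rw [List.map_flatMap]
  refine flatMap_congr' fun l _ => ?_
  rw [List.map_map]
  refine List.map_congr_left fun a ha => ?_
  rw [← cubicPair_triple _ _ _ hl]
  rfl

theorem length_cubicRows (o t : ℕ) (bs : List (ℕ × ℕ)) :
    (cubicRows o t bs).length = cubicRowCount o t bs := by
  rw [cubicRows, cubicRowCount, List.length_append, length_flatMap_const _ _
    (3 * (localSize o bs - 2))]
  · congr 1
    · simp
    · rw [List.length_flatMap]
      have h : ∀ k, ((bs.zipIdx k).map fun p => ((List.range p.1.2).flatMap fun t =>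
          (List.range 3).flatMap fun l =>
          ((List.range p.1.1).map fun x => 16 * p.2 + (x + 1)).map fun a =>
            ((t, Sum.inl a, l) : ℕ × (ℕ ⊕ ℕ) × ℕ)).length) =
          (bs.map fun p => p.2 * (3 * p.1)) := by
        induction bs with
        | nil => intro k; rfl
        | cons p bs ih =>
          intro k
          rw [List.zipIdx_cons, List.map_cons, List.map_cons, ih]
          congr 1
          rw [length_flatMap_const _ _ (3 * p.1)]
          · simp
          · intro x _
            rw [length_flatMap_const _ _ p.1 (by simp)]
            simp
      rw [h]
  · intro x _
    rw [length_flatMap_const _ _ (localSize o bs - 2) (by simp)]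
    simp

theorem forceGroups_eq {α : Type} (l : List CubicGroup) (k : List CubicGroup → α) :
    forceGroups l k = k l := by
  induction l generalizing k with
  | nil => rfl
  | cons x l ih =>
    change forceList x.A (fun A => force x.deg fun deg => force x.len fun len =>
      forceLists x.tiles fun tiles => forceGroups l fun ss => k (⟨A, deg, len, tiles⟩ :: ss)) = _
    rw [forceList_eq, force_eq, force_eq, forceLists_eq, ih]

theorem linearIndependent_of_cubicFillCheck (o t : ℕ) (bs : List (ℕ × ℕ)) (ho : o ≤ 15)
    (hbs : ∀ p ∈ bs, p.1 ≤ 15) (h : cubicFillCheck o t bs = true) :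
    LinearIndependent (ZMod 32003) fun (i : Fin (localCols 3 o bs).length)
      (j : Fin (cubicRows o t bs).length) => cubicEntry (localSize o bs) (blockSize bs)
        (localCols 3 o bs)[i].toFinset (cubicRows o t bs)[j] := by
  simp only [cubicFillCheck, force_eq, forceLists_eq, forceList_eq, forceGroups_eq, mapRec_eq,
    Bool.and_eq_true, Nat.ble_eq, ← length_cubicRows] at h
  have hcol : ∀ l ∈ localCols 3 o bs, Packs (6 * 32003 ^ 3) _ _ := fun l hl =>
    packs_cubicCol ((mem_localCols.1 hl).1.1.nodup (nodup_universeCodes o bs ho hbs))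
      (mem_localCols.1 hl).1.2 o t bs hbs
  generalize cubicCol _ _ = col at h hcol
  refine linearIndependent_cols_of_elim (localCols 3 o bs) (cubicRows o t bs)
    (fun r l => cubicEntry (localSize o bs) (blockSize bs) l.toFinset r) col (6 * 32003 ^ 3)
    hcol ?_ h.2.1.2 h.2.2
  have := h.2.1.1
  omega

theorem exists_det_ne_zero {F α β : Type*} [Field F] [Fintype α] [DecidableEq α] [Fintype β]
    (v : α → β → F) (hv : LinearIndependent F v) :
    ∃ ι : α → β, (Matrix.of fun a a' => v a (ι a')).det ≠ 0 := by
  classical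
  obtain ⟨κ, c, hc, hspan, hli⟩ := exists_linearIndependent' F (Matrix.of v).col
  have : Finite κ := Finite.of_injective c hc
  have := Fintype.ofFinite κ
  have h1 : Fintype.card κ = Fintype.card α := by
    rw [← finrank_span_eq_card hli, hspan, ← Matrix.rank_eq_finrank_span_cols]
    exact LinearIndependent.rank_matrix hv
  let e := Fintype.equivOfCardEq h1.symm
  refine ⟨c ∘ e, ?_⟩
  have h2 : LinearIndependent F (Matrix.of fun a a' => v a ((c ∘ e) a')).col :=
    hli.comp e e.injective
  rw [← isUnit_iff_ne_zero, ← Matrix.isUnit_iff_isUnit_det]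
  exact Matrix.linearIndependent_cols_iff_isUnit.1 h2

theorem exists_linearIndependent_of_sectors {P α β Q K : Type*} [Fintype α] [Fintype β]
    [PartialOrder Q] [Field K] [CharZero K] (q : ℕ) [Fact q.Prime]
    (E : α → β → MvPolynomial P ℤ) (u : α → Q) (w : β → Q)
    (hE : ∀ a b, E a b ≠ 0 → u a ≤ w b)
    (hS : ∀ a₀, ∃ φ : P → ZMod q, LinearIndependent (ZMod q)
      fun (a : {a // u a = u a₀}) (b : {b // w b = u a₀}) => MvPolynomial.aeval φ (E a b)) :
    ∃ v : P → K, LinearIndependent K fun a b => MvPolynomial.aeval v (E a b) := by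
  classical
  have h1 : ∀ S, ∃ ι : {a // u a = S} → {b // w b = S},
      (Matrix.of fun (a a' : {a // u a = S}) => E a (ι a')).det ≠ 0 := by
    intro S
    by_cases hne : ∃ a₀, u a₀ = S
    · obtain ⟨a₀, rfl⟩ := hne
      obtain ⟨φ, hφ⟩ := hS a₀
      obtain ⟨ι, hι⟩ := exists_det_ne_zero _ hφ
      refine ⟨ι, fun h => hι ?_⟩
      have := congrArg (MvPolynomial.aeval φ) h
      rw [map_zero, ← AlgHom.coe_toRingHom, RingHom.map_det] at this
      exact this
    · have : IsEmpty {a // u a = S} := ⟨fun a => hne ⟨a, a.2⟩⟩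
      exact ⟨fun a => (this.false a).elim, by simp⟩
  choose ι hι using h1
  let M : Matrix α α (MvPolynomial P ℤ) := Matrix.of fun a a' => E a (ι (u a') ⟨a', rfl⟩)
  have hM : M.det ≠ 0 := by
    have hbt : M.BlockTriangular fun a => toLinearExtension (u a) := by
      intro i j hij
      by_contra hne
      have := hE _ _ hne
      rw [(ι (u j) ⟨j, rfl⟩).2] at this
      exact absurd (toLinearExtension.monotone this) (not_le.2 hij)
    rw [hbt.det, Finset.prod_ne_zero_iff]
    intro S _
    have key : ∀ S : Q, (Matrix.of fun (a a' : {a // u a = S}) => E a (ι S a')) =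
        Matrix.of fun (a a' : {a // u a = S}) => M a a' := by
      intro S
      ext a ⟨a', ha'⟩
      subst ha'
      rfl
    have := hι (show Q from S)
    rw [key] at this
    rw [← Matrix.det_submatrix_equiv_self
      (Equiv.subtypeEquivRight fun a => Iff.rfl :
        {a // toLinearExtension (u a) = S} ≃ {a // u a = show Q from S})] at this
    exact this
  have h2 : ∃ v : P → K, MvPolynomial.aeval v M.det ≠ 0 := by
    by_contra! h
    refine hM (MvPolynomial.map_injective (Int.castRingHom K) Int.cast_injective ?_)
    rw [map_zero]
    refine MvPolynomial.funext fun v => ?_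
    rw [map_zero, MvPolynomial.eval_map, ← h v]
    rfl
  obtain ⟨v, hv⟩ := h2
  refine ⟨v, ?_⟩
  rw [← AlgHom.coe_toRingHom, RingHom.map_det, ← isUnit_iff_ne_zero,
    ← Matrix.isUnit_iff_isUnit_det, ← Matrix.linearIndependent_rows_iff_isUnit] at hv
  refine LinearIndependent.of_comp (LinearMap.funLeft K K fun a' => (ι (u a') ⟨a', rfl⟩ : β)) ?_
  exact hv

/-! ### From global to local matrices -/

theorem mem_blockCodes {b z u : ℕ} (hz : z ≤ 15) :
    u ∈ blockCodes b z ↔ u / 16 = b ∧ 1 ≤ u % 16 ∧ u % 16 ≤ z := by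
  rw [blockCodes, Finset.mem_Icc]
  omega

/-- The union of the blocks indexed by `T` and of the block `0`. -/
def inner (z : ℕ → ℕ) (T : Finset ℕ) : Finset ℕ :=
  (insert 0 T).biUnion fun b => blockCodes b (z b)

/-- The union of the blocks `1, …, m` not indexed by `T`. -/
def outer (m : ℕ) (z : ℕ → ℕ) (T : Finset ℕ) : Finset ℕ :=
  (Finset.Icc 1 m \ T).biUnion fun b => blockCodes b (z b)

theorem mem_inner {z : ℕ → ℕ} (hz : ∀ b, z b ≤ 15) {T : Finset ℕ} {u : ℕ} :
    u ∈ inner z T ↔ u / 16 ∈ insert 0 T ∧ 1 ≤ u % 16 ∧ u % 16 ≤ z (u / 16) := by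
  simp only [inner, Finset.mem_biUnion, mem_blockCodes (hz _)]
  constructor
  · rintro ⟨b, hb, rfl, h⟩; exact ⟨hb, h⟩
  · rintro ⟨hb, h⟩; exact ⟨_, hb, rfl, h⟩

theorem mem_outer {m : ℕ} {z : ℕ → ℕ} (hz : ∀ b, z b ≤ 15) {T : Finset ℕ} {u : ℕ} :
    u ∈ outer m z T ↔
      (u / 16 ∈ Finset.Icc 1 m ∧ u / 16 ∉ T) ∧ 1 ≤ u % 16 ∧ u % 16 ≤ z (u / 16) := by
  simp only [outer, Finset.mem_biUnion, mem_blockCodes (hz _), Finset.mem_sdiff]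
  constructor
  · rintro ⟨b, hb, rfl, h⟩; exact ⟨hb, h⟩
  · rintro ⟨hb, h⟩; exact ⟨_, hb, rfl, h⟩

theorem card_inner {z : ℕ → ℕ} (hz : ∀ b, z b ≤ 15) {T : Finset ℕ} (hT : 0 ∉ T) :
    (inner z T).card = z 0 + ∑ b ∈ T, z b := by
  rw [inner, Finset.card_biUnion, Finset.sum_insert hT]
  · simp [blockCodes]
  · intro b _ b' _ hbb
    refine Finset.disjoint_left.2 fun u hu hu' => ?_
    rw [mem_blockCodes (hz _)] at hu hu'
    exact hbb (hu.1.symm.trans hu'.1)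

/-- The nonzero blocks met by a set. -/
def support (σ : Finset ℕ) : Finset ℕ := (σ.image (· / 16)).erase 0

theorem mem_support {σ : Finset ℕ} {b : ℕ} : b ∈ support σ ↔ b ≠ 0 ∧ ∃ u ∈ σ, u / 16 = b := by
  simp [support]

/-- Relabelling of the blocks according to their position in a list. -/
def relabel (β : List ℕ) (u : ℕ) : ℕ := 16 * (0 :: β).idxOf (u / 16) + u % 16

theorem relabel_div (β : List ℕ) (u : ℕ) : relabel β u / 16 = (0 :: β).idxOf (u / 16) := by
  rw [relabel]; omega

theorem relabel_mod (β : List ℕ) (u : ℕ) : relabel β u % 16 = u % 16 := by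
  rw [relabel]; omega

theorem relabel_inj {β : List ℕ} {u v : ℕ} (hu : u / 16 ∈ 0 :: β)
    (h : relabel β u = relabel β v) : u = v := by
  have h1 : (0 :: β).idxOf (u / 16) = (0 :: β).idxOf (v / 16) := by
    rw [← relabel_div, ← relabel_div, h]
  have h2 : u % 16 = v % 16 := by rw [← relabel_mod β u, ← relabel_mod β v, h]
  have := (List.idxOf_inj hu).1 h1
  omega

theorem relabel_injOn {z : ℕ → ℕ} (hz : ∀ b, z b ≤ 15) {β : List ℕ} :
    Set.InjOn (relabel β) (inner z β.toFinset) := by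
  intro u hu v _ h
  refine relabel_inj ?_ h
  simpa using ((mem_inner hz).1 hu).1

theorem idxOf_cons_of_mem {β : List ℕ} (h0 : 0 ∉ β) {b : ℕ} (hb : b ∈ β) :
    (0 :: β).idxOf b = β.idxOf b + 1 := by
  rw [List.idxOf_cons_ne]
  rintro rfl
  exact h0 hb

/-- The list of local blocks with their tile numbers. -/
def localBlocks (z : ℕ → ℕ) (τ : Finset ℕ → ℕ) (β : List ℕ) : List (ℕ × ℕ) :=
  β.map fun b => (z b, τ (β.toFinset.erase b))

theorem localSize_localBlocks {z : ℕ → ℕ} (hz : ∀ b, z b ≤ 15) {τ : Finset ℕ → ℕ} {β : List ℕ}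
    (hβ : β.Nodup) (h0 : 0 ∉ β) :
    localSize (z 0) (localBlocks z τ β) = (inner z β.toFinset).card := by
  rw [card_inner hz (by simpa using h0), localSize, localBlocks, List.map_map,
    List.sum_toFinset _ hβ]
  rfl

theorem mem_zipIdx_localBlocks {z : ℕ → ℕ} {τ : Finset ℕ → ℕ} {β : List ℕ} (hβ : β.Nodup)
    (h0 : 0 ∉ β) {p : (ℕ × ℕ) × ℕ} : p ∈ (localBlocks z τ β).zipIdx 1 ↔
      ∃ b ∈ β, p = ((z b, τ (β.toFinset.erase b)), (0 :: β).idxOf b) := by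
  obtain ⟨x, j⟩ := p
  rw [List.mk_mem_zipIdx_iff_le_and_getElem?_sub]
  simp only [localBlocks, List.getElem?_map, Option.map_eq_some_iff, Prod.mk.injEq]
  constructor
  · rintro ⟨h1, b, hb, rfl⟩
    obtain ⟨hlt, rfl⟩ := List.getElem?_eq_some_iff.1 hb
    refine ⟨_, List.getElem_mem hlt, rfl, ?_⟩
    rw [idxOf_cons_of_mem h0 (List.getElem_mem hlt), hβ.idxOf_getElem]
    omega
  · rintro ⟨b, hb, rfl, rfl⟩
    rw [idxOf_cons_of_mem h0 hb]
    exact ⟨by omega, b, by simp [List.getElem?_idxOf hb], rfl⟩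

theorem blockSize_localBlocks {z : ℕ → ℕ} {τ : Finset ℕ → ℕ} {β : List ℕ} (hβ : β.Nodup)
    (h0 : 0 ∉ β) {b : ℕ} (hb : b ∈ β) :
    blockSize (localBlocks z τ β) ((0 :: β).idxOf b) = z b :=
  blockSize_eq ((mem_zipIdx_localBlocks hβ h0).2 ⟨b, hb, rfl⟩)

theorem image_relabel_block {z : ℕ} (hz : z ≤ 15) (β : List ℕ) (b : ℕ) :
    (blockCodes b z).image (relabel β) = blockCodes ((0 :: β).idxOf b) z := by
  ext u
  rw [Finset.mem_image, mem_blockCodes hz]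
  constructor
  · rintro ⟨v, hv, rfl⟩
    rw [mem_blockCodes hz] at hv
    rw [relabel_div, relabel_mod, hv.1]
    exact ⟨rfl, hv.2⟩
  · rintro ⟨h1, h2⟩
    have h3 : (16 * b + u % 16) / 16 = b := by omega
    have h4 : (16 * b + u % 16) % 16 = u % 16 := by omega
    refine ⟨16 * b + u % 16, ?_, ?_⟩
    · rw [mem_blockCodes hz, h3, h4]; exact ⟨rfl, h2⟩
    · rw [relabel, h3, h4]; omega

theorem toFinset_universeCodes {z : ℕ → ℕ} (hz : ∀ b, z b ≤ 15) {τ : Finset ℕ → ℕ} {β : List ℕ}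
    (hβ : β.Nodup) (h0 : 0 ∉ β) :
    (universeCodes (z 0) (localBlocks z τ β)).toFinset =
      (inner z β.toFinset).image (relabel β) := by
  rw [inner, Finset.biUnion_image]
  simp only [image_relabel_block (hz _)]
  ext u
  simp only [universeCodes, List.mem_toFinset, List.mem_append, List.mem_flatMap,
    Finset.mem_biUnion, mem_zipIdx_localBlocks hβ h0, Finset.mem_insert, exists_eq_or_imp,
    List.idxOf_cons_self, ← toFinset_codes]
  refine or_congr Iff.rfl ?_
  constructor
  · rintro ⟨_, ⟨b, hb, rfl⟩, hu⟩; exact ⟨b, hb, hu⟩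
  · rintro ⟨b, hb, hu⟩; exact ⟨_, ⟨b, hb, rfl⟩, hu⟩

theorem localBlocks_le {z : ℕ → ℕ} (hz : ∀ b, z b ≤ 15) (τ : Finset ℕ → ℕ) (β : List ℕ) :
    ∀ p ∈ localBlocks z τ β, p.1 ≤ 15 := by
  intro p hp
  obtain ⟨b, -, rfl⟩ := List.mem_map.1 hp
  exact hz b

theorem subset_inner {m : ℕ} {z : ℕ → ℕ} (hz : ∀ b, z b ≤ 15) {σ : Finset ℕ}
    (hσ : σ ⊆ inner z (Finset.Icc 1 m)) : σ ⊆ inner z (support σ) := by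
  intro u hu
  have := (mem_inner hz).1 (hσ hu)
  rw [mem_inner hz]
  refine ⟨?_, this.2⟩
  rw [Finset.mem_insert, mem_support]
  by_cases h : u / 16 = 0
  · exact Or.inl h
  · exact Or.inr ⟨h, u, hu, rfl⟩

theorem exists_localCol {n : ℕ} {z : ℕ → ℕ} (hz : ∀ b, z b ≤ 15) {τ : Finset ℕ → ℕ}
    {β : List ℕ} (hβ : β.Nodup) (h0 : 0 ∉ β) {σ : Finset ℕ} (hσ : σ ⊆ inner z β.toFinset)
    (hn : σ.card = n) (hs : support σ = β.toFinset) :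
    ∃ l ∈ localCols n (z 0) (localBlocks z τ β), l.toFinset = σ.image (relabel β) := by
  have hnd := nodup_universeCodes (z 0) (localBlocks z τ β) (hz 0) (localBlocks_le hz τ β)
  have hf : ((universeCodes (z 0) (localBlocks z τ β)).filter
      fun u => u ∈ σ.image (relabel β)).toFinset = σ.image (relabel β) := by
    rw [List.toFinset_filter, toFinset_universeCodes hz hβ h0]
    simp only [decide_eq_true_eq]
    rw [Finset.filter_mem_eq_inter, Finset.inter_eq_right]
    exact Finset.image_subset_image hσ
  refine ⟨_, mem_localCols.2 ⟨⟨List.filter_sublist, ?_⟩, ?_⟩, hf⟩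
  · rw [← List.toFinset_card_of_nodup (hnd.filter _), hf,
      Finset.card_image_of_injOn ((relabel_injOn hz).mono hσ), hn]
  · intro p hp
    obtain ⟨b, hb, rfl⟩ := (mem_zipIdx_localBlocks hβ h0).1 hp
    obtain ⟨-, u, hu, rfl⟩ := mem_support.1 (hs ▸ List.mem_toFinset.2 hb)
    refine ⟨relabel β u, ?_, relabel_div β u⟩
    rw [← List.mem_toFinset, hf]
    exact Finset.mem_image_of_mem _ hu

theorem exists_of_mem_localCols {n : ℕ} {z : ℕ → ℕ} (hz : ∀ b, z b ≤ 15) {τ : Finset ℕ → ℕ}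
    {β : List ℕ} (hβ : β.Nodup) (h0 : 0 ∉ β) {l : List ℕ}
    (hl : l ∈ localCols n (z 0) (localBlocks z τ β)) :
    ∃ σ ⊆ inner z β.toFinset, σ.card = n ∧ support σ = β.toFinset ∧
      l.toFinset = σ.image (relabel β) := by
  obtain ⟨⟨hsub, hlen⟩, hmeet⟩ := mem_localCols.1 hl
  have hnd := hsub.nodup
    (nodup_universeCodes (z 0) (localBlocks z τ β) (hz 0) (localBlocks_le hz τ β))
  have himg : l.toFinset = ((inner z β.toFinset).filter fun u => relabel β u ∈ l).image
      (relabel β) := by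
    have hsub' : l.toFinset ⊆ (inner z β.toFinset).image (relabel β) := by
      rw [← toFinset_universeCodes (τ := τ) hz hβ h0]
      intro u hu
      exact List.mem_toFinset.2 (hsub.subset (List.mem_toFinset.1 hu))
    ext u
    rw [Finset.mem_image]
    constructor
    · intro hu
      obtain ⟨v, hv, rfl⟩ := Finset.mem_image.1 (hsub' hu)
      exact ⟨v, Finset.mem_filter.2 ⟨hv, List.mem_toFinset.1 hu⟩, rfl⟩
    · rintro ⟨v, hv, rfl⟩
      exact List.mem_toFinset.2 (Finset.mem_filter.1 hv).2
  refine ⟨_, Finset.filter_subset _ _, ?_, ?_, himg⟩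
  · rw [← hlen, ← List.toFinset_card_of_nodup hnd, himg, Finset.card_image_of_injOn]
    exact (relabel_injOn hz).mono (Finset.filter_subset _ _)
  · ext b
    rw [mem_support, List.mem_toFinset]
    constructor
    · rintro ⟨hb, u, hu, rfl⟩
      have := ((mem_inner hz).1 (Finset.mem_filter.1 hu).1).1
      simpa [hb] using this
    · intro hb
      refine ⟨fun h => h0 (h ▸ hb), ?_⟩
      obtain ⟨u, hu, hub⟩ := hmeet _ ((mem_zipIdx_localBlocks hβ h0).2 ⟨b, hb, rfl⟩)
      rw [← List.mem_toFinset, himg] at hu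
      obtain ⟨v, hv, rfl⟩ := Finset.mem_image.1 hu
      refine ⟨v, hv, ?_⟩
      rw [relabel_div] at hub
      have := ((mem_inner hz).1 (Finset.mem_filter.1 hv).1).1
      exact (List.idxOf_inj (by simpa using this)).1 hub

/-! ### The global matrix for points -/

/-- The parameters: the roots and the coefficients of the free linear forms. -/
abbrev Param : Type := ℕ ⊕ (Finset ℕ × ℕ × ℕ × ℕ)

/-- A row of the global matrix: a tile, a linear form of the tile, and a coordinate. -/
abbrev Row : Type := (_ : Finset ℕ) × ℕ × (ℕ ⊕ ℕ) × ℕ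

/-- The linear forms of a tile, evaluated at a point. -/
noncomputable def tileForm {A : Type*} [CommRing A] (n : ℕ) (v : Param → A) (T : Finset ℕ)
    (t : ℕ) (σ : Finset ℕ) : ℕ ⊕ ℕ → A :=
  Sum.elim (fun a => pform (v ∘ Sum.inl) (v (Sum.inl a)) σ)
    (fun k => hform n (fun c => v (Sum.inr (T, t, k, c))) (v ∘ Sum.inl) σ)

/-- The index set of the linear forms of a tile. -/
def tileIndex (n m : ℕ) (z : ℕ → ℕ) (T : Finset ℕ) : Finset (ℕ ⊕ ℕ) :=
  (outer m z T).disjSum (Finset.range ((inner z T).card - n))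

noncomputable def globalEntry {A : Type*} [CommRing A] (n m : ℕ) (z : ℕ → ℕ) (v : Param → A)
    (σ : Finset ℕ) (r : Row) : A :=
  (∏ e ∈ (tileIndex n m z r.1).erase r.2.2.1, tileForm n v r.1 r.2.1 σ e) *
    symm (v ∘ Sum.inl) σ r.2.2.2

theorem map_symm {A B : Type*} [CommRing A] [CommRing B] (f : A →+* B) (θ : ℕ → A)
    (σ : Finset ℕ) (c : ℕ) : f (symm θ σ c) = symm (f ∘ θ) σ c := by
  simp only [symm, ← Polynomial.coeff_map, Polynomial.map_prod, Polynomial.map_add,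
    Polynomial.map_X, Polynomial.map_C, Function.comp]

theorem map_tileForm {A B : Type*} [CommRing A] [CommRing B] (f : A →+* B) (n : ℕ)
    (v : Param → A) (T : Finset ℕ) (t : ℕ) (σ : Finset ℕ) (e : ℕ ⊕ ℕ) :
    f (tileForm n v T t σ e) = tileForm n (f ∘ v) T t σ e := by
  cases e with
  | inl a => simp only [tileForm, Sum.elim_inl, pform, map_prod, map_sub, Function.comp]
  | inr k =>
    simp only [tileForm, Sum.elim_inr, hform, map_sum, map_mul, map_symm, Function.comp_assoc]
    rfl

theorem map_globalEntry {A B : Type*} [CommRing A] [CommRing B] (f : A →+* B) (n m : ℕ)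
    (z : ℕ → ℕ) (v : Param → A) (σ : Finset ℕ) (r : Row) :
    f (globalEntry n m z v σ r) = globalEntry n m z (f ∘ v) σ r := by
  simp only [globalEntry, map_mul, map_prod, map_tileForm, map_symm, Function.comp_assoc]

/-- The blocks visible in a row. -/
def sector (r : Row) : Finset ℕ :=
  Sum.elim (fun a => insert (a / 16) r.1) (fun _ => r.1) r.2.2.1

theorem support_subset_sector {A : Type*} [CommRing A] {n m : ℕ} {z : ℕ → ℕ}
    (hz : ∀ b, z b ≤ 15) {v : Param → A} {σ : Finset ℕ} (hσ : σ ⊆ inner z (Finset.Icc 1 m))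
    {r : Row} (h : globalEntry n m z v σ r ≠ 0) : support σ ⊆ sector r := by
  intro b hb
  obtain ⟨hb0, u, hu, rfl⟩ := mem_support.1 hb
  by_contra hbs
  refine h ?_
  obtain ⟨T, t, e, c⟩ := r
  have hT : u / 16 ∉ T := by
    intro hT
    apply hbs
    cases e with
    | inl a => exact Finset.mem_insert_of_mem hT
    | inr k => exact hT
  have hue : Sum.inl u ≠ e := by
    rintro rfl
    exact hbs (Finset.mem_insert_self _ _)
  have hu' := (mem_inner hz).1 (hσ hu)
  have hmem : (Sum.inl u : ℕ ⊕ ℕ) ∈ (tileIndex n m z T).erase e := by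
    rw [Finset.mem_erase, tileIndex, Finset.inl_mem_disjSum, mem_outer hz]
    exact ⟨hue, ⟨(Finset.mem_insert.1 hu'.1).resolve_left hb0, hT⟩, hu'.2⟩
  rw [globalEntry, Finset.prod_eq_zero hmem, zero_mul]
  exact Finset.prod_eq_zero hu (sub_self _)

/-- The specialization of the parameters that isolates a sector. -/
noncomputable def special (z : ℕ → ℕ) (β : List ℕ) : Param → ZMod 32003
  | Sum.inl u => if u ∈ inner z β.toFinset then (relabel β u : ZMod 32003) else 0
  | Sum.inr (T, t, k, c) => if T = β.toFinset then (hash 0 t k c : ZMod 32003)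
      else (hash ((0 :: β).idxOf ((β.toFinset \ T).sup id)) t 0 c : ZMod 32003)

theorem symm_special {z : ℕ → ℕ} (hz : ∀ b, z b ≤ 15) {β : List ℕ} {σ : Finset ℕ}
    (hσ : σ ⊆ inner z β.toFinset) (c : ℕ) :
    symm (special z β ∘ Sum.inl) σ c = symm Nat.cast (σ.image (relabel β)) c := by
  rw [symm, symm, Finset.prod_image fun u hu v hv h => relabel_injOn hz (hσ hu) (hσ hv) h]
  congr 1
  refine Finset.prod_congr rfl fun u hu => ?_
  simp only [Function.comp, special, if_pos (hσ hu)]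

theorem pform_special {z : ℕ → ℕ} (hz : ∀ b, z b ≤ 15) {β : List ℕ} {σ : Finset ℕ}
    (hσ : σ ⊆ inner z β.toFinset) (a : ZMod 32003) :
    pform (special z β ∘ Sum.inl) a σ = pform Nat.cast a (σ.image (relabel β)) := by
  rw [pform, pform, Finset.prod_image fun u hu v hv h => relabel_injOn hz (hσ hu) (hσ hv) h]
  refine Finset.prod_congr rfl fun u hu => ?_
  simp only [Function.comp, special, if_pos (hσ hu)]

theorem hform_special {n : ℕ} {z : ℕ → ℕ} (hz : ∀ b, z b ≤ 15) {β : List ℕ} {σ : Finset ℕ}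
    (hσ : σ ⊆ inner z β.toFinset) (h : ℕ → ZMod 32003) :
    hform n h (special z β ∘ Sum.inl) σ = hform n h Nat.cast (σ.image (relabel β)) := by
  simp only [hform, symm_special hz hσ]

/-- The common factor of the entries of a column in a sector. -/
def columnFactor (m : ℕ) (z : ℕ → ℕ) (β : List ℕ) (σ : Finset ℕ) : ZMod 32003 :=
  (∏ u ∈ σ, (relabel β u : ZMod 32003)) ^ (outer m z β.toFinset).card

theorem columnFactor_ne_zero {m : ℕ} {z : ℕ → ℕ} (hz : ∀ b, z b ≤ 15) {β : List ℕ}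
    (hβ : β.length ≤ 3) {σ : Finset ℕ} (hσ : σ ⊆ inner z β.toFinset) :
    columnFactor m z β σ ≠ 0 := by
  have : Fact (Nat.Prime 32003) := ⟨by norm_num⟩
  refine pow_ne_zero _ (Finset.prod_ne_zero_iff.2 fun u hu => ?_)
  rw [Ne, ZMod.natCast_eq_zero_iff]
  have h1 := (mem_inner hz).1 (hσ hu)
  have h2 : (0 :: β).idxOf (u / 16) ≤ (0 :: β).length := List.idxOf_le_length
  rw [List.length_cons] at h2
  intro h
  have h3 := Nat.le_of_dvd (by rw [relabel]; omega) h
  rw [relabel] at h3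
  omega

theorem prod_outer_special {n m : ℕ} {z : ℕ → ℕ} (hz : ∀ b, z b ≤ 15) {β : List ℕ}
    {σ : Finset ℕ} (hσ : σ ⊆ inner z β.toFinset) (T : Finset ℕ) (t : ℕ) :
    ∏ a ∈ outer m z β.toFinset, tileForm n (special z β) T t σ (Sum.inl a) =
      columnFactor m z β σ := by
  rw [columnFactor, ← Finset.prod_const]
  refine Finset.prod_congr rfl fun a ha => ?_
  have ha' : a ∉ inner z β.toFinset := by
    rw [mem_outer hz] at ha
    rw [mem_inner hz]
    rintro ⟨h, -⟩
    rcases Finset.mem_insert.1 h with h | h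
    · have := Finset.mem_Icc.1 ha.1.1
      omega
    · exact ha.1.2 h
  rw [tileForm, Sum.elim_inl, pform]
  refine Finset.prod_congr rfl fun u hu => ?_
  simp only [Function.comp, special, if_pos (hσ hu), if_neg ha', sub_zero]

theorem erase_disjSum_inr {α β : Type*} [DecidableEq α] [DecidableEq β] (s : Finset α)
    (t : Finset β) (k : β) : (s.disjSum t).erase (Sum.inr k) = s.disjSum (t.erase k) := by
  ext (x | x) <;> simp

theorem erase_disjSum_inl {α β : Type*} [DecidableEq α] [DecidableEq β] (s : Finset α)
    (t : Finset β) (a : α) : (s.disjSum t).erase (Sum.inl a) = (s.erase a).disjSum t := by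
  ext (x | x) <;> simp

theorem globalEntry_special_core {n m : ℕ} {z : ℕ → ℕ} (hz : ∀ b, z b ≤ 15)
    {τ : Finset ℕ → ℕ} {β : List ℕ} (hβ : β.Nodup) (h0 : 0 ∉ β) {σ : Finset ℕ}
    (hσ : σ ⊆ inner z β.toFinset) (t k c : ℕ) :
    globalEntry n m z (special z β) σ ⟨β.toFinset, t, Sum.inr k, c⟩ = columnFactor m z β σ *
      pointEntry n (localSize (z 0) (localBlocks z τ β)) (blockSize (localBlocks z τ β))
        (σ.image (relabel β)) (t, Sum.inr k, c) := by
  simp only [globalEntry, pointEntry, tileIndex, erase_disjSum_inr, Finset.prod_disjSum,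
    prod_outer_special hz hσ, localSize_localBlocks hz hβ h0, symm_special hz hσ, mul_assoc]
  congr 2
  refine Finset.prod_congr rfl fun i _ => ?_
  rw [tileForm, Sum.elim_inr, hform_special hz hσ]
  simp only [special, if_true]

theorem outer_erase {m : ℕ} {z : ℕ → ℕ} {S : Finset ℕ} {b : ℕ} (hb : b ∈ S)
    (hS : S ⊆ Finset.Icc 1 m) :
    outer m z (S.erase b) = blockCodes b (z b) ∪ outer m z S := by
  rw [outer, outer, ← Finset.biUnion_insert (t := fun b => blockCodes b (z b))]
  congr 1
  ext x
  simp only [Finset.mem_sdiff, Finset.mem_erase, Finset.mem_insert]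
  have := @hS b
  grind

theorem card_inner_erase {z : ℕ → ℕ} (hz : ∀ b, z b ≤ 15) {S : Finset ℕ} (h0 : 0 ∉ S) {b : ℕ}
    (hb : b ∈ S) : (inner z (S.erase b)).card = (inner z S).card - z b := by
  rw [card_inner hz h0, card_inner hz (by simp [h0]), ← Finset.add_sum_erase _ _ hb]
  omega

theorem sdiff_erase_sup {S : Finset ℕ} {b : ℕ} (hb : b ∈ S) : (S \ S.erase b).sup id = b := by
  rw [Finset.sdiff_erase_self hb]
  simp

theorem disjoint_block_outer {m : ℕ} {z : ℕ → ℕ} (hz : ∀ b, z b ≤ 15) {S : Finset ℕ} {b : ℕ}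
    (hb : b ∈ S) : Disjoint (blockCodes b (z b)) (outer m z S) := by
  refine Finset.disjoint_left.2 fun u hu hu' => ?_
  rw [mem_blockCodes (hz b)] at hu
  rw [mem_outer hz, hu.1] at hu'
  exact hu'.1.2 hb

theorem erase_relabel_block {z b a : ℕ} (hz : z ≤ 15) {β : List ℕ} (hb : b ∈ 0 :: β)
    (ha : a ∈ blockCodes b z) : (blockCodes ((0 :: β).idxOf b) z).erase (relabel β a) =
      ((blockCodes b z).erase a).image (relabel β) := by
  rw [← image_relabel_block hz, Finset.erase_eq, Finset.erase_eq, Finset.image_sdiff_of_injOn,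
    Finset.image_singleton]
  · intro u hu v _ h
    refine relabel_inj ?_ h
    rw [((mem_blockCodes hz).1 hu).1]
    exact hb
  · exact Finset.singleton_subset_iff.2 ha

theorem globalEntry_special_side {n m : ℕ} {z : ℕ → ℕ} (hz : ∀ b, z b ≤ 15)
    {τ : Finset ℕ → ℕ} {β : List ℕ} (hβ : β.Nodup) (h0 : 0 ∉ β)
    (hm : β.toFinset ⊆ Finset.Icc 1 m) {σ : Finset ℕ}
    (hσ : σ ⊆ inner z β.toFinset) {b a : ℕ} (hb : b ∈ β) (ha : a ∈ blockCodes b (z b))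
    (t c : ℕ) :
    globalEntry n m z (special z β) σ ⟨β.toFinset.erase b, t, Sum.inl a, c⟩ =
      columnFactor m z β σ *
      pointEntry n (localSize (z 0) (localBlocks z τ β)) (blockSize (localBlocks z τ β))
        (σ.image (relabel β)) (t, Sum.inl (relabel β a), c) := by
  have hb' : b ∈ β.toFinset := List.mem_toFinset.2 hb
  have hab : a / 16 = b := ((mem_blockCodes (hz b)).1 ha).1
  have hblock : blockCodes b (z b) ⊆ inner z β.toFinset :=
    Finset.subset_biUnion_of_mem (fun b => blockCodes b (z b)) (Finset.mem_insert_of_mem hb')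
  have hdisj := disjoint_block_outer (m := m) hz hb'
  have ha' : a ∉ outer m z β.toFinset := Finset.disjoint_left.1 hdisj ha
  have hT : β.toFinset.erase b ≠ β.toFinset := fun h => by
    rw [← h] at hb'
    exact Finset.notMem_erase _ _ hb'
  simp only [globalEntry, pointEntry, tileIndex, erase_disjSum_inl, Finset.prod_disjSum,
    localSize_localBlocks hz hβ h0, symm_special hz hσ, relabel_div, hab,
    blockSize_localBlocks hβ h0 hb, outer_erase hb' hm, Finset.erase_union_distrib,
    Finset.erase_eq_of_notMem ha']
  rw [Finset.prod_union (hdisj.mono_left (Finset.erase_subset _ _)), prod_outer_special hz hσ,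
    card_inner_erase hz (by simpa using h0) hb']
  have h1 : ∏ e ∈ (blockCodes b (z b)).erase a,
      tileForm n (special z β) (β.toFinset.erase b) t σ (Sum.inl e) =
      ∏ i ∈ (blockCodes ((0 :: β).idxOf b) (z b)).erase (relabel β a),
        pform Nat.cast (i : ZMod 32003) (σ.image (relabel β)) := by
    rw [erase_relabel_block (hz b) (by simp [hb]) ha, Finset.prod_image]
    · refine Finset.prod_congr rfl fun e he => ?_
      rw [tileForm, Sum.elim_inl, pform_special hz hσ]
      simp only [special, if_pos (hblock (Finset.erase_subset _ _ he))]
    · exact fun u hu v hv h => relabel_injOn hz (hblock (Finset.erase_subset _ _ hu))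
        (hblock (Finset.erase_subset _ _ hv)) h
  have h2 : ∀ k, tileForm n (special z β) (β.toFinset.erase b) t σ (Sum.inr k) =
      hform n (fun c => (hash ((0 :: β).idxOf b) t 0 c : ZMod 32003)) Nat.cast
        (σ.image (relabel β)) := by
    intro k
    rw [tileForm, Sum.elim_inr, hform_special hz hσ]
    simp only [special, if_neg hT, sdiff_erase_sup hb']
  rw [h1, Finset.prod_congr rfl fun k _ => h2 k, Finset.prod_const, Finset.card_range]
  ring

theorem linearIndependent_of_localCols {F G R ρ : Type*} [Field F] {L : List (List ℕ)}
    {LR : List ρ} {e : Finset ℕ → ρ → F}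
    (h : LinearIndependent F fun (i : Fin L.length) (j : Fin LR.length) => e L[i].toFinset LR[j])
    {loc : G → Finset ℕ} (hloc : Function.Injective loc)
    (hL : ∀ g, ∃ l ∈ L, l.toFinset = loc g) {c : G → F} (hc : ∀ g, c g ≠ 0) {E : G → R → F}
    (hR : ∀ r' ∈ LR, ∃ r, ∀ g, E g r = c g * e (loc g) r') : LinearIndependent F E := by
  have h1 : ∀ g, ∃ i : Fin L.length, L[i].toFinset = loc g := by
    intro g
    obtain ⟨l, hl, hlg⟩ := hL g
    obtain ⟨i, rfl⟩ := List.get_of_mem hl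
    exact ⟨i, hlg⟩
  choose i hi using h1
  have hinj : Function.Injective i := fun g g' hg => hloc (by rw [← hi, ← hi, hg])
  choose r hr using fun j : Fin LR.length => hR LR[j] (List.getElem_mem _)
  refine LinearIndependent.of_comp (LinearMap.funLeft F F r) ?_
  convert (h.comp i hinj).units_smul fun g => Units.mk0 (c g) (hc g) using 1
  ext g j
  simp only [Function.comp, LinearMap.funLeft_apply, hr, Pi.smul_apply', hi, Units.smul_mk0,
    smul_eq_mul, Pi.smul_apply]

theorem linearIndependent_of_localRows {F G R ρ : Type*} [Field F] {L : List (List ℕ)}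
    {LR : List ρ} {e : Finset ℕ → ρ → F}
    (h : LinearIndependent F fun (j : Fin LR.length) (i : Fin L.length) => e L[i].toFinset LR[j])
    {loc : R → ρ} (hloc : Function.Injective loc) (hmem : ∀ r, loc r ∈ LR) {E : R → G → F}
    (hL : ∀ l ∈ L, ∃ g, ∃ c : F, c ≠ 0 ∧ ∀ r, E r g = c * e l.toFinset (loc r)) :
    LinearIndependent F E := by
  have h1 : ∀ r, ∃ j : Fin LR.length, LR[j] = loc r := fun r => List.get_of_mem (hmem r)
  choose j hj using h1
  have hinj : Function.Injective j := fun r r' hr => hloc (by rw [← hj, ← hj, hr])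
  choose g c hc hg using fun i : Fin L.length => hL L[i] (List.getElem_mem _)
  let φ : (G → F) →ₗ[F] (Fin L.length → F) :=
    LinearMap.pi fun i => (c i)⁻¹ • LinearMap.proj (R := F) (φ := fun _ : G => F) (g i)
  have hφ : φ ∘ E = (fun (j : Fin LR.length) (i : Fin L.length) => e L[i].toFinset LR[j]) ∘ j := by
    ext r i
    simp [φ, hg, hc, ← hj]
  refine LinearIndependent.of_comp φ ?_
  rw [hφ]
  exact h.comp j hinj

/-- The rows of a tile. -/
def tileRows (n m : ℕ) (z : ℕ → ℕ) (T : Finset ℕ) : Finset ((ℕ ⊕ ℕ) × ℕ) :=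
  insert (Sum.inr ((inner z T).card - n), n) (tileIndex n m z T ×ˢ Finset.Icc 1 n)

/-- The rows of the global matrix. -/
def globalRows (n m : ℕ) (z : ℕ → ℕ) (τ : Finset ℕ → ℕ) : Finset Row :=
  (Finset.Icc 1 m).powerset.sigma fun T => Finset.range (τ T) ×ˢ tileRows n m z T

/-- The columns of the global matrix. -/
def globalCols (n m : ℕ) (z : ℕ → ℕ) : Finset (Finset ℕ) :=
  (inner z (Finset.Icc 1 m)).powersetCard n

theorem mem_globalRows {n m : ℕ} {z : ℕ → ℕ} {τ : Finset ℕ → ℕ} {T : Finset ℕ} {t : ℕ}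
    {e : ℕ ⊕ ℕ} {c : ℕ} : (⟨T, t, e, c⟩ : Row) ∈ globalRows n m z τ ↔
      T ⊆ Finset.Icc 1 m ∧ t < τ T ∧ (e, c) ∈ tileRows n m z T := by
  simp [globalRows]

theorem mem_pointRows {n o t : ℕ} {bs : List (ℕ × ℕ)} {r : ℕ × (ℕ ⊕ ℕ) × ℕ} :
    r ∈ pointRows n o t bs ↔
      (∃ t' < t, r = (t', Sum.inr (localSize o bs - n), n) ∨
        ∃ k < localSize o bs - n, ∃ c < n, r = (t', Sum.inr k, c + 1)) ∨
      ∃ p ∈ bs.zipIdx 1, ∃ t' < p.1.2, ∃ x < p.1.1, ∃ c < n,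
        r = (t', Sum.inl (16 * p.2 + (x + 1)), c + 1) := by
  simp only [pointRows, List.mem_append, List.mem_flatMap, List.mem_range, List.mem_cons,
    List.mem_map, exists_exists_and_eq_and]
  simp only [eq_comm]

theorem support_subset {m : ℕ} {z : ℕ → ℕ} (hz : ∀ b, z b ≤ 15) {σ : Finset ℕ}
    (hσ : σ ⊆ inner z (Finset.Icc 1 m)) : support σ ⊆ Finset.Icc 1 m := by
  intro b hb
  obtain ⟨hb0, u, hu, rfl⟩ := mem_support.1 hb
  exact (Finset.mem_insert.1 ((mem_inner hz).1 (hσ hu)).1).resolve_left hb0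

theorem card_support_le (σ : Finset ℕ) : (support σ).card ≤ σ.card :=
  (Finset.card_erase_le).trans Finset.card_image_le

/-- The specialized matrix reproduces the local matrix. -/
theorem exists_globalRow {n m : ℕ} {z : ℕ → ℕ} (hz : ∀ b, z b ≤ 15)
    {τ : Finset ℕ → ℕ} {β : List ℕ} (hβ : β.Nodup) (h0 : 0 ∉ β)
    (hm : β.toFinset ⊆ Finset.Icc 1 m) {r' : ℕ × (ℕ ⊕ ℕ) × ℕ}
    (hr : r' ∈ pointRows n (z 0) (τ β.toFinset) (localBlocks z τ β)) :
    ∃ r ∈ globalRows n m z τ, sector r = β.toFinset ∧ ∀ σ ⊆ inner z β.toFinset,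
      globalEntry n m z (special z β) σ r = columnFactor m z β σ *
        pointEntry n (localSize (z 0) (localBlocks z τ β)) (blockSize (localBlocks z τ β))
          (σ.image (relabel β)) r' := by
  rw [mem_pointRows, localSize_localBlocks hz hβ h0] at hr
  rcases hr with ⟨t, ht, rfl | ⟨k, hk, c, hc, rfl⟩⟩ | ⟨p, hp, t, ht, x, hx, c, hc, rfl⟩
  · refine ⟨⟨β.toFinset, t, Sum.inr _, _⟩, mem_globalRows.2 ⟨hm, ht, ?_⟩, rfl,
      fun σ hσ => globalEntry_special_core hz hβ h0 hσ _ _ _⟩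
    exact Finset.mem_insert_self _ _
  · refine ⟨⟨β.toFinset, t, Sum.inr _, _⟩, mem_globalRows.2 ⟨hm, ht, ?_⟩, rfl,
      fun σ hσ => globalEntry_special_core hz hβ h0 hσ _ _ _⟩
    refine Finset.mem_insert_of_mem (Finset.mem_product.2 ⟨?_, Finset.mem_Icc.2 (by grind)⟩)
    exact Finset.inr_mem_disjSum.2 (Finset.mem_range.2 hk)
  · obtain ⟨b, hb, rfl⟩ := (mem_zipIdx_localBlocks hβ h0).1 hp
    have hb' : b ∈ β.toFinset := List.mem_toFinset.2 hb
    have ha : 16 * b + (x + 1) ∈ blockCodes b (z b) := by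
      simp only at hx
      rw [blockCodes, Finset.mem_Icc]; omega
    have hab := ((mem_blockCodes (hz b)).1 ha).1
    have hre : relabel β (16 * b + (x + 1)) = 16 * (0 :: β).idxOf b + (x + 1) := by
      rw [relabel, hab]
      have := hz b
      simp only at hx
      omega
    refine ⟨⟨β.toFinset.erase b, t, Sum.inl (16 * b + (x + 1)), c + 1⟩, mem_globalRows.2
      ⟨(Finset.erase_subset _ _).trans hm, ht, ?_⟩, ?_, fun σ hσ => ?_⟩
    · refine Finset.mem_insert_of_mem (Finset.mem_product.2 ⟨?_, Finset.mem_Icc.2 (by grind)⟩)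
      refine Finset.inl_mem_disjSum.2 ?_
      rw [outer_erase hb' hm]
      exact Finset.mem_union_left _ ha
    · simp only [sector, Sum.elim_inl, hab, Finset.insert_erase hb']
    · rw [globalEntry_special_side hz hβ h0 hm hσ hb ha, hre]

/-- The local version of a row. -/
def localRow (β : List ℕ) (r : Row) : ℕ × (ℕ ⊕ ℕ) × ℕ :=
  (r.2.1, r.2.2.1.map (relabel β) id, r.2.2.2)

theorem localRow_spec {n m : ℕ} {z : ℕ → ℕ} (hz : ∀ b, z b ≤ 15)
    {τ : Finset ℕ → ℕ} {β : List ℕ} (hβ : β.Nodup) (h0 : 0 ∉ β)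
    (hm : β.toFinset ⊆ Finset.Icc 1 m) {r : Row} (hr : r ∈ globalRows n m z τ)
    (hs : sector r = β.toFinset) :
    localRow β r ∈ pointRows n (z 0) (τ β.toFinset) (localBlocks z τ β) ∧
    ∀ σ ⊆ inner z β.toFinset,
      globalEntry n m z (special z β) σ r = columnFactor m z β σ *
        pointEntry n (localSize (z 0) (localBlocks z τ β)) (blockSize (localBlocks z τ β))
          (σ.image (relabel β)) (localRow β r) := by
  obtain ⟨T, t, e | k, c⟩ := r
  · obtain ⟨hT, ht, hc⟩ := mem_globalRows.1 hr
    have hc := (Finset.mem_product.1 ((Finset.mem_insert.1 hc).resolve_left (by simp)))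
    have he := (mem_outer hz).1 (Finset.inl_mem_disjSum.1 hc.1)
    have hc := Finset.mem_Icc.1 hc.2
    simp only [sector, Sum.elim_inl] at hs
    have hT : T = β.toFinset.erase (e / 16) := by
      rw [← hs, Finset.erase_insert he.1.2]
    have hb : e / 16 ∈ β := List.mem_toFinset.1 (hs ▸ Finset.mem_insert_self _ _)
    subst hT
    refine ⟨mem_pointRows.2 (Or.inr ⟨_, (mem_zipIdx_localBlocks hβ h0).2 ⟨_, hb, rfl⟩, t, ht,
      e % 16 - 1, by grind, c - 1, by grind, ?_⟩), fun σ hσ => ?_⟩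
    · simp only [localRow, Sum.map_inl, relabel, Prod.mk.injEq, true_and, Sum.inl.injEq]
      omega
    · refine globalEntry_special_side hz hβ h0 hm hσ hb ?_ _ _
      exact (mem_blockCodes (hz _)).2 ⟨rfl, he.2⟩
  · obtain ⟨hT, ht, hc⟩ := mem_globalRows.1 hr
    simp only [sector, Sum.elim_inr] at hs
    subst hs
    refine ⟨mem_pointRows.2 (Or.inl ⟨t, ht, ?_⟩),
      fun σ hσ => globalEntry_special_core hz hβ h0 hσ _ _ _⟩
    rw [localSize_localBlocks hz hβ h0]
    rcases Finset.mem_insert.1 hc with hc | hc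
    · simp only [Prod.mk.injEq, Sum.inr.injEq] at hc
      left
      simp [localRow, hc]
    · right
      rw [Finset.mem_product, tileIndex, Finset.inr_mem_disjSum, Finset.mem_range,
        Finset.mem_Icc] at hc
      exact ⟨k, hc.1, c - 1, by grind, by
        simp only [localRow, Sum.map_inr, id, Prod.mk.injEq, true_and]
        have := hc.2.1
        simp only at this
        omega⟩

theorem localRow_inj {n m : ℕ} {z : ℕ → ℕ} {τ : Finset ℕ → ℕ} {β : List ℕ}
    (hz : ∀ b, z b ≤ 15) {r r' : Row} (hr : r ∈ globalRows n m z τ)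
    (hr' : r' ∈ globalRows n m z τ) (hs : sector r = β.toFinset) (hs' : sector r' = β.toFinset)
    (h : localRow β r = localRow β r') : r = r' := by
  obtain ⟨T, t, e | k, c⟩ := r <;> obtain ⟨T', t', e' | k', c'⟩ := r' <;>
    simp only [localRow, Sum.map_inl, Sum.map_inr, Prod.mk.injEq, Sum.inl.injEq, Sum.inr.injEq,
      reduceCtorEq, false_and, and_false, id, sector, Sum.elim_inl, Sum.elim_inr] at h hs hs'
  · obtain ⟨rfl, he, rfl⟩ := h
    have he' : e = e' := by
      refine relabel_inj ?_ he
      refine List.mem_cons_of_mem _ (List.mem_toFinset.1 ?_)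
      rw [← hs]
      exact Finset.mem_insert_self _ _
    subst he'
    have key : ∀ T, (⟨T, t, Sum.inl e, c⟩ : Row) ∈ globalRows n m z τ → e / 16 ∉ T := by
      intro T hT
      have hc := (mem_globalRows.1 hT).2.2
      have hc := (Finset.mem_product.1 ((Finset.mem_insert.1 hc).resolve_left (by simp)))
      exact ((mem_outer hz).1 (Finset.inl_mem_disjSum.1 hc.1)).1.2
    have : T = T' := by
      rw [← Finset.erase_insert (key T hr), hs, ← hs', Finset.erase_insert (key T' hr')]
    subst this
    rfl
  · obtain ⟨rfl, rfl, rfl⟩ := h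
    subst hs'
    subst hs
    rfl

theorem exists_linearIndependent_cols (K : Type*) [Field K] [CharZero K] {n m : ℕ} (hn : n ≤ 3)
    {z : ℕ → ℕ} (hz : ∀ b, z b ≤ 15) {τ : Finset ℕ → ℕ}
    (hcheck : ∀ S ⊆ Finset.Icc 1 m, S.card ≤ n → ∃ β : List ℕ, β.Nodup ∧ β.toFinset = S ∧
      pointFillCheck n (z 0) (τ S) (localBlocks z τ β) = true) :
    ∃ v : Param → K, LinearIndependent K
      fun (σ : globalCols n m z) (r : globalRows n m z τ) => globalEntry n m z v σ r := by
  have : Fact (Nat.Prime 32003) := ⟨by norm_num⟩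
  have hcols : ∀ σ : globalCols n m z, (σ : Finset ℕ) ⊆ inner z (Finset.Icc 1 m) ∧
      (σ : Finset ℕ).card = n := fun σ => Finset.mem_powersetCard.1 σ.2
  obtain ⟨v, hv⟩ := exists_linearIndependent_of_sectors (K := K) 32003
    (fun (σ : globalCols n m z) (r : globalRows n m z τ) =>
      globalEntry n m z (MvPolynomial.X : Param → MvPolynomial Param ℤ) σ r)
    (fun σ => support σ) (fun r => sector r)
    (fun σ r h => support_subset_sector hz (hcols σ).1 h) (by
      intro σ₀
      obtain ⟨β, hβ, hS, h⟩ := hcheck _ (support_subset hz (hcols σ₀).1)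
        ((card_support_le _).trans (hcols σ₀).2.le)
      have hm : β.toFinset ⊆ Finset.Icc 1 m := hS ▸ support_subset hz (hcols σ₀).1
      have h0 : 0 ∉ β := fun h0 => by simpa using hm (List.mem_toFinset.2 h0)
      have hlen : β.length ≤ 3 := by
        rw [← List.toFinset_card_of_nodup hβ, hS]
        exact (card_support_le _).trans ((hcols σ₀).2.le.trans hn)
      rw [← hS] at h ⊢
      have hsub : ∀ σ : {σ : globalCols n m z // support σ = β.toFinset},
          (σ : Finset ℕ) ⊆ inner z β.toFinset := fun σ =>
        (subset_inner hz (hcols σ).1).trans_eq (congrArg (inner z) σ.2)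
      refine ⟨special z β, linearIndependent_of_localCols
        (linearIndependent_of_pointFillCheck n _ _ _ (hz 0) (localBlocks_le hz τ β) h)
        (loc := fun σ => σ.1.1.image (relabel β)) ?_ ?_
        (c := fun σ => columnFactor m z β σ.1.1) ?_ ?_⟩
      · intro σ σ' hσ
        refine Subtype.ext (Subtype.ext ?_)
        exact (Finset.image_injOn_powerset_of_injOn (relabel_injOn hz))
          (Finset.mem_coe.2 (Finset.mem_powerset.2 (hsub σ)))
          (Finset.mem_coe.2 (Finset.mem_powerset.2 (hsub σ'))) hσ
      · intro σ
        exact exists_localCol hz hβ h0 (hsub σ) (hcols σ).2 σ.2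
      · intro σ
        exact columnFactor_ne_zero hz hlen (hsub σ)
      · intro r' hr'
        obtain ⟨r, hr, hrs, hre⟩ := exists_globalRow hz hβ h0 hm hr'
        refine ⟨⟨⟨r, hr⟩, hrs⟩, fun σ => ?_⟩
        rw [← hre _ (hsub σ), ← AlgHom.coe_toRingHom, map_globalEntry]
        congr 1
        ext p
        simp)
  refine ⟨v, ?_⟩
  convert hv using 3
  rw [← AlgHom.coe_toRingHom, map_globalEntry]
  congr 1
  ext p
  simp

theorem exists_linearIndependent_rows (K : Type*) [Field K] [CharZero K] {n m : ℕ} (hn : n ≤ 3)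
    {z : ℕ → ℕ} (hz : ∀ b, z b ≤ 15) {τ : Finset ℕ → ℕ} (hτ : ∀ T, τ T ≠ 0 → T.card < n)
    (hcheck : ∀ S ⊆ Finset.Icc 1 m, S.card ≤ n → ∃ β : List ℕ, β.Nodup ∧ β.toFinset = S ∧
      pointSubCheck n (z 0) (τ S) (localBlocks z τ β) = true) :
    ∃ v : Param → K, LinearIndependent K
      fun (r : globalRows n m z τ) (σ : globalCols n m z) => globalEntry n m z v σ r := by
  have : Fact (Nat.Prime 32003) := ⟨by norm_num⟩
  have hcols : ∀ σ : globalCols n m z, (σ : Finset ℕ) ⊆ inner z (Finset.Icc 1 m) ∧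
      (σ : Finset ℕ).card = n := fun σ => Finset.mem_powersetCard.1 σ.2
  have hrows : ∀ r : globalRows n m z τ, sector r ⊆ Finset.Icc 1 m ∧ (sector r).card ≤ n := by
    rintro ⟨⟨T, t, e | k, c⟩, hr⟩
    · obtain ⟨hT, ht, hc⟩ := mem_globalRows.1 hr
      have hc := (Finset.mem_product.1 ((Finset.mem_insert.1 hc).resolve_left (by simp)))
      have he := (mem_outer hz).1 (Finset.inl_mem_disjSum.1 hc.1)
      exact ⟨Finset.insert_subset he.1.1 hT,
        (Finset.card_insert_le _ _).trans (hτ T (by omega))⟩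
    · obtain ⟨hT, ht, -⟩ := mem_globalRows.1 hr
      exact ⟨hT, (hτ T (by omega)).le⟩
  obtain ⟨v, hv⟩ := exists_linearIndependent_of_sectors (K := K) 32003
    (fun (r : globalRows n m z τ) (σ : globalCols n m z) =>
      globalEntry n m z (MvPolynomial.X : Param → MvPolynomial Param ℤ) σ r)
    (fun r => OrderDual.toDual (sector r)) (fun σ => OrderDual.toDual (support σ))
    (fun r σ h => support_subset_sector hz (hcols σ).1 h) (by
      intro r₀
      obtain ⟨β, hβ, hS, h⟩ := hcheck _ (hrows r₀).1 (hrows r₀).2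
      have hm : β.toFinset ⊆ Finset.Icc 1 m := hS ▸ (hrows r₀).1
      have h0 : 0 ∉ β := fun h0 => by simpa using hm (List.mem_toFinset.2 h0)
      have hlen : β.length ≤ 3 := by
        rw [← List.toFinset_card_of_nodup hβ, hS]
        exact (hrows r₀).2.trans hn
      rw [← hS] at h ⊢
      refine ⟨special z β, linearIndependent_of_localRows
        (linearIndependent_of_pointSubCheck n _ _ _ (hz 0) (localBlocks_le hz τ β) h)
        (loc := fun r => localRow β r.1) ?_ ?_ ?_⟩
      · intro r r' hrr
        exact Subtype.ext (Subtype.ext (localRow_inj hz r.1.2 r'.1.2 r.2 r'.2 hrr))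
      · intro r
        exact (localRow_spec hz hβ h0 hm r.1.2 r.2).1
      · intro l hl
        obtain ⟨σ, hσ, hcard, hsupp, himg⟩ := exists_of_mem_localCols hz hβ h0 hl
        refine ⟨⟨⟨σ, Finset.mem_powersetCard.2 ⟨hσ.trans ?_, hcard⟩⟩, hsupp⟩,
          columnFactor m z β σ, columnFactor_ne_zero hz hlen hσ, fun r => ?_⟩
        · exact Finset.biUnion_subset_biUnion_of_subset_left _ (Finset.insert_subset_insert _ hm)
        · rw [himg, ← (localRow_spec hz hβ h0 hm r.1.2 r.2).2 σ hσ, ← AlgHom.coe_toRingHom,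
            map_globalEntry]
          congr 1
          ext p
          simp)
  refine ⟨v, ?_⟩
  convert hv using 3
  rw [← AlgHom.coe_toRingHom, map_globalEntry]
  congr 1
  ext p
  simp

/-! ### The global matrix for cubics -/

theorem exists_toFinset_of_card_eq_three {σ : Finset ℕ} (h : σ.card = 3) :
    ∃ x y z, [x, y, z].Nodup ∧ σ = [x, y, z].toFinset := by
  obtain ⟨x, y, z, h1, h2, h3, rfl⟩ := Finset.card_eq_three.1 h
  exact ⟨x, y, z, by simp [h1, h2, h3], by simp⟩

theorem cubicPair_scale {A : Type*} [CommRing A] (g : ℕ → A) {a b w a' b' w' : ℕ → A}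
    {σ : Finset ℕ} (hσ : σ.card = 3) (ha : ∀ u ∈ σ, a u = g u * a' u)
    (hb : ∀ u ∈ σ, b u = g u * b' u) (hw : ∀ u ∈ σ, w u = g u * w' u) :
    cubicPair a b w σ = (∏ u ∈ σ, g u) * cubicPair a' b' w' σ := by
  obtain ⟨x, y, z, hnd, rfl⟩ := exists_toFinset_of_card_eq_three hσ
  simp only [List.mem_toFinset, List.forall_mem_cons] at ha hb hw
  rw [cubicPair_triple _ _ _ hnd, cubicPair_triple _ _ _ hnd, List.prod_toFinset _ hnd]
  simp only [sixTerms, ha, hb, hw, List.map_cons, List.map_nil, List.prod_cons, List.prod_nil]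
  ring

theorem cubicPair_image {A : Type*} [CommRing A] {a b w : ℕ → A} {f : ℕ → ℕ} {σ : Finset ℕ}
    (hσ : σ.card = 3) (hf : Set.InjOn f σ) :
    cubicPair (fun u => a (f u)) (fun u => b (f u)) (fun u => w (f u)) σ =
      cubicPair a b w (σ.image f) := by
  obtain ⟨x, y, z, hnd, rfl⟩ := exists_toFinset_of_card_eq_three hσ
  have h1 : ([x, y, z].toFinset).image f = [f x, f y, f z].toFinset := by
    ext u; simp
  have hnd' : [f x, f y, f z].Nodup := by
    refine List.Nodup.map_on (l := [x, y, z]) (fun u hu v hv h => hf ?_ ?_ h) hnd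
    · exact Finset.mem_coe.2 (List.mem_toFinset.2 hu)
    · exact Finset.mem_coe.2 (List.mem_toFinset.2 hv)
  rw [h1, cubicPair_triple _ _ _ hnd, cubicPair_triple _ _ _ hnd']
  rfl

theorem map_cubicPair {A B : Type*} [CommRing A] [CommRing B] (f : A →+* B) (a b w : ℕ → A)
    (σ : Finset ℕ) : f (cubicPair a b w σ) = cubicPair (f ∘ a) (f ∘ b) (f ∘ w) σ := by
  simp only [cubicPair, map_sum, map_mul, Function.comp]

/-- The linear forms of a tile, restricted to the rational normal curve. -/
def cubicForm {A : Type*} [CommRing A] (m : ℕ) (z : ℕ → ℕ) (v : Param → A) (T : Finset ℕ)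
    (t l u : ℕ) : A :=
  cform (outer m z T) (v ∘ Sum.inl) (v (Sum.inr (T, t, l, 0))) ((inner z T).card - 3) u

/-- The test forms of a tile, restricted to the rational normal curve. -/
def testForm {A : Type*} [CommRing A] (m : ℕ) (z : ℕ → ℕ) (v : Param → A) (T : Finset ℕ)
    (e : ℕ ⊕ ℕ) (u : ℕ) : A :=
  Sum.elim
    (fun i => ∏ a ∈ (outer m z T).erase i, (v (Sum.inl u) - v (Sum.inl a)))
    (fun k => (∏ a ∈ outer m z T, (v (Sum.inl u) - v (Sum.inl a))) * v (Sum.inl u) ^ k) e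

def cubicGlobalEntry {A : Type*} [CommRing A] (m : ℕ) (z : ℕ → ℕ) (v : Param → A)
    (σ : Finset ℕ) (r : Row) : A :=
  cubicPair (cubicForm m z v r.1 r.2.1 r.2.2.2) (cubicForm m z v r.1 r.2.1 ((r.2.2.2 + 1) % 3))
    (testForm m z v r.1 r.2.2.1) σ

theorem map_cubicGlobalEntry {A B : Type*} [CommRing A] [CommRing B] (f : A →+* B) (m : ℕ)
    (z : ℕ → ℕ) (v : Param → A) (σ : Finset ℕ) (r : Row) :
    f (cubicGlobalEntry m z v σ r) = cubicGlobalEntry m z (f ∘ v) σ r := by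
  have h : ∀ l, f ∘ cubicForm m z v r.1 r.2.1 l = cubicForm m z (f ∘ v) r.1 r.2.1 l := by
    intro l
    ext u
    simp [cubicForm, cform]
  rw [cubicGlobalEntry, cubicGlobalEntry, map_cubicPair, h, h]
  congr 1
  ext u
  obtain ⟨T, t, e | k, l⟩ := r <;> simp [testForm]

theorem cubic_support_subset_sector {A : Type*} [CommRing A] {m : ℕ} {z : ℕ → ℕ}
    (hz : ∀ b, z b ≤ 15) {v : Param → A} {σ : Finset ℕ} (hσ : σ ⊆ inner z (Finset.Icc 1 m))
    (hcard : σ.card = 3) {r : Row} (h : cubicGlobalEntry m z v σ r ≠ 0) :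
    support σ ⊆ sector r := by
  intro b hb
  obtain ⟨hb0, u, hu, rfl⟩ := mem_support.1 hb
  by_contra hbs
  refine h ?_
  obtain ⟨T, t, e, l⟩ := r
  have hT : u / 16 ∉ T := by
    intro hT
    apply hbs
    cases e with
    | inl a => exact Finset.mem_insert_of_mem hT
    | inr k => exact hT
  have hue : Sum.inl u ≠ e := by
    rintro rfl
    exact hbs (Finset.mem_insert_self _ _)
  have hu' := (mem_inner hz).1 (hσ hu)
  have hmem : u ∈ outer m z T :=
    (mem_outer hz).2 ⟨⟨(Finset.mem_insert.1 hu'.1).resolve_left hb0, hT⟩, hu'.2⟩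
  have hform : ∀ l, cubicForm m z v T t l u = 0 := fun l => by
    rw [cubicForm, cform, Finset.prod_eq_zero hmem (sub_self _), zero_mul]
  have htest : testForm m z v T e u = 0 := by
    cases e with
    | inl i =>
      refine Finset.prod_eq_zero (Finset.mem_erase.2 ⟨?_, hmem⟩) (sub_self _)
      rintro rfl
      exact hue rfl
    | inr k =>
      simp only [testForm, Sum.elim_inr]
      rw [Finset.prod_eq_zero hmem (sub_self _), zero_mul]
  have key : ∀ a : ℕ → A, a u = 0 → ∀ x ∈ σ, a x = (if x = u then 0 else 1) * a x := by
    intro a ha x _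
    split_ifs with hx
    · rw [hx, ha, zero_mul]
    · rw [one_mul]
  have hprod : ∏ x ∈ σ, (if x = u then (0 : A) else 1) = 0 :=
    Finset.prod_eq_zero hu (if_pos rfl)
  rw [cubicGlobalEntry, cubicPair_scale (fun x => if x = u then 0 else 1) hcard
    (key _ (hform _)) (key _ (hform _)) (key _ htest), hprod, zero_mul]

theorem notMem_inner_of_mem_outer {m : ℕ} {z : ℕ → ℕ} (hz : ∀ b, z b ≤ 15) {S : Finset ℕ}
    {a : ℕ} (ha : a ∈ outer m z S) : a ∉ inner z S := by
  rw [mem_outer hz] at ha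
  rw [mem_inner hz]
  rintro ⟨h, -⟩
  rcases Finset.mem_insert.1 h with h | h
  · have := Finset.mem_Icc.1 ha.1.1
    omega
  · exact ha.1.2 h

/-- The specialization of the parameters that isolates a sector. -/
noncomputable def cubicSpecial (z : ℕ → ℕ) (β : List ℕ) : Param → ZMod 32003
  | Sum.inl u => if u ∈ inner z β.toFinset then (relabel β u : ZMod 32003) else 0
  | Sum.inr (T, t, l, c) => if T = β.toFinset then (hash 0 t l c : ZMod 32003)
      else (hash ((0 :: β).idxOf ((β.toFinset \ T).sup id)) t l c : ZMod 32003)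

theorem prod_outer_sub_special {m : ℕ} {z : ℕ → ℕ} (hz : ∀ b, z b ≤ 15) {β : List ℕ} {u : ℕ}
    (hu : u ∈ inner z β.toFinset) :
    ∏ a ∈ outer m z β.toFinset, (cubicSpecial z β (Sum.inl u) - cubicSpecial z β (Sum.inl a)) =
      (relabel β u : ZMod 32003) ^ (outer m z β.toFinset).card := by
  rw [← Finset.prod_const]
  refine Finset.prod_congr rfl fun a ha => ?_
  simp only [cubicSpecial, if_pos hu, if_neg (notMem_inner_of_mem_outer hz ha), sub_zero]

theorem prod_block_sub_special {z : ℕ → ℕ} (hz : ∀ b, z b ≤ 15) {β : List ℕ} {u : ℕ}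
    (hu : u ∈ inner z β.toFinset) {s : Finset ℕ} (hs : s ⊆ inner z β.toFinset) :
    ∏ a ∈ s, (cubicSpecial z β (Sum.inl u) - cubicSpecial z β (Sum.inl a)) =
      ∏ a ∈ s.image (relabel β), ((relabel β u : ZMod 32003) - a) := by
  rw [Finset.prod_image fun x hx y hy h => relabel_injOn hz (hs hx) (hs hy) h]
  refine Finset.prod_congr rfl fun a ha => ?_
  simp only [cubicSpecial, if_pos hu, if_pos (hs ha)]

theorem columnFactor_eq (m : ℕ) (z : ℕ → ℕ) (β : List ℕ) (σ : Finset ℕ) :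
    columnFactor m z β σ = ∏ u ∈ σ, (relabel β u : ZMod 32003) ^ (outer m z β.toFinset).card :=
  (Finset.prod_pow _ _ _).symm

theorem cubicGlobalEntry_special_core {m : ℕ} {z : ℕ → ℕ} (hz : ∀ b, z b ≤ 15)
    {τ : Finset ℕ → ℕ} {β : List ℕ} (hβ : β.Nodup) (h0 : 0 ∉ β) {σ : Finset ℕ}
    (hσ : σ ⊆ inner z β.toFinset) (hcard : σ.card = 3) (t k l : ℕ) :
    cubicGlobalEntry m z (cubicSpecial z β) σ ⟨β.toFinset, t, Sum.inr k, l⟩ =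
      columnFactor m z β σ *
      cubicEntry (localSize (z 0) (localBlocks z τ β)) (blockSize (localBlocks z τ β))
        (σ.image (relabel β)) (t, Sum.inr k, l) := by
  rw [cubicEntry, ← cubicPair_image hcard ((relabel_injOn hz).mono hσ), columnFactor_eq]
  have key : ∀ l, ∀ u ∈ σ, cubicForm m z (cubicSpecial z β) β.toFinset t l u =
      (relabel β u : ZMod 32003) ^ (outer m z β.toFinset).card *
      cform ∅ Nat.cast (hash 0 t l 0 : ZMod 32003)
        (localSize (z 0) (localBlocks z τ β) - 3) (relabel β u) := by
    intro l u hu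
    simp only [cubicForm, cform, Function.comp, prod_outer_sub_special hz (hσ hu),
      Finset.prod_empty, one_mul, localSize_localBlocks hz hβ h0]
    simp only [cubicSpecial, if_pos (hσ hu), if_true]
  refine cubicPair_scale _ hcard (key _) (key _) fun u hu => ?_
  simp only [testForm, Sum.elim_inr, prod_outer_sub_special hz (hσ hu)]
  simp only [cubicSpecial, if_pos (hσ hu)]

theorem cubicGlobalEntry_special_side {m : ℕ} {z : ℕ → ℕ} (hz : ∀ b, z b ≤ 15)
    {τ : Finset ℕ → ℕ} {β : List ℕ} (hβ : β.Nodup) (h0 : 0 ∉ β)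
    (hm : β.toFinset ⊆ Finset.Icc 1 m) {σ : Finset ℕ}
    (hσ : σ ⊆ inner z β.toFinset) (hcard : σ.card = 3) {b a : ℕ} (hb : b ∈ β)
    (ha : a ∈ blockCodes b (z b)) (t l : ℕ) :
    cubicGlobalEntry m z (cubicSpecial z β) σ ⟨β.toFinset.erase b, t, Sum.inl a, l⟩ =
      columnFactor m z β σ *
      cubicEntry (localSize (z 0) (localBlocks z τ β)) (blockSize (localBlocks z τ β))
        (σ.image (relabel β)) (t, Sum.inl (relabel β a), l) := by
  have hb' : b ∈ β.toFinset := List.mem_toFinset.2 hb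
  have hab : a / 16 = b := ((mem_blockCodes (hz b)).1 ha).1
  have hblock : blockCodes b (z b) ⊆ inner z β.toFinset :=
    Finset.subset_biUnion_of_mem (fun b => blockCodes b (z b)) (Finset.mem_insert_of_mem hb')
  have hdisj := disjoint_block_outer (m := m) hz hb'
  have ha' : a ∉ outer m z β.toFinset := Finset.disjoint_left.1 hdisj ha
  have hT : β.toFinset.erase b ≠ β.toFinset := fun h => by
    rw [← h] at hb'
    exact Finset.notMem_erase _ _ hb'
  rw [cubicEntry, ← cubicPair_image hcard ((relabel_injOn hz).mono hσ), columnFactor_eq,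
    relabel_div, hab, blockSize_localBlocks hβ h0 hb, localSize_localBlocks hz hβ h0]
  have key : ∀ l, ∀ u ∈ σ, cubicForm m z (cubicSpecial z β) (β.toFinset.erase b) t l u =
      (relabel β u : ZMod 32003) ^ (outer m z β.toFinset).card *
      cform (blockCodes ((0 :: β).idxOf b) (z b)) Nat.cast
        (hash ((0 :: β).idxOf b) t l 0 : ZMod 32003)
        ((inner z β.toFinset).card - z b - 3) (relabel β u) := by
    intro l u hu
    simp only [cubicForm, cform, Function.comp, outer_erase hb' hm,
      card_inner_erase hz (by simpa using h0) hb', Finset.prod_union hdisj,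
      prod_outer_sub_special hz (hσ hu), prod_block_sub_special hz (hσ hu) hblock,
      image_relabel_block (hz b)]
    simp only [cubicSpecial, if_pos (hσ hu), if_neg hT, sdiff_erase_sup hb']
    ring
  refine cubicPair_scale _ hcard (key _) (key _) fun u hu => ?_
  simp only [testForm, Sum.elim_inl, outer_erase hb' hm, Finset.erase_union_distrib,
    Finset.erase_eq_of_notMem ha']
  rw [Finset.prod_union (hdisj.mono_left (Finset.erase_subset _ _)),
    prod_outer_sub_special hz (hσ hu),
    prod_block_sub_special hz (hσ hu) ((Finset.erase_subset _ _).trans hblock),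
    ← erase_relabel_block (hz b) (by simp [hb]) ha, mul_comm]

/-- The rows of the global matrix for cubics. -/
def cubicGlobalRows (m : ℕ) (z : ℕ → ℕ) (τ : Finset ℕ → ℕ) : Finset Row :=
  (Finset.Icc 1 m).powerset.sigma fun T => Finset.range (τ T) ×ˢ
    ((outer m z T).disjSum (Finset.range ((inner z T).card - 2)) ×ˢ Finset.range 3)

theorem mem_cubicGlobalRows {m : ℕ} {z : ℕ → ℕ} {τ : Finset ℕ → ℕ} {T : Finset ℕ} {t : ℕ}
    {e : ℕ ⊕ ℕ} {l : ℕ} : (⟨T, t, e, l⟩ : Row) ∈ cubicGlobalRows m z τ ↔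
      T ⊆ Finset.Icc 1 m ∧ t < τ T ∧
        e ∈ (outer m z T).disjSum (Finset.range ((inner z T).card - 2)) ∧ l < 3 := by
  simp only [cubicGlobalRows, Finset.mem_sigma, Finset.mem_powerset, Finset.mem_product,
    Finset.mem_range]

theorem mem_cubicRows {o t : ℕ} {bs : List (ℕ × ℕ)} {r : ℕ × (ℕ ⊕ ℕ) × ℕ} :
    r ∈ cubicRows o t bs ↔
      (∃ t' < t, ∃ l < 3, ∃ k < localSize o bs - 2, r = (t', Sum.inr k, l)) ∨
      ∃ p ∈ bs.zipIdx 1, ∃ t' < p.1.2, ∃ l < 3, ∃ x < p.1.1,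
        r = (t', Sum.inl (16 * p.2 + (x + 1)), l) := by
  simp only [cubicRows, List.mem_append, List.mem_flatMap, List.mem_range,
    List.mem_map, exists_exists_and_eq_and]
  simp only [eq_comm]

theorem exists_cubicGlobalRow {m : ℕ} {z : ℕ → ℕ} (hz : ∀ b, z b ≤ 15)
    {τ : Finset ℕ → ℕ} {β : List ℕ} (hβ : β.Nodup) (h0 : 0 ∉ β)
    (hm : β.toFinset ⊆ Finset.Icc 1 m) {r' : ℕ × (ℕ ⊕ ℕ) × ℕ}
    (hr : r' ∈ cubicRows (z 0) (τ β.toFinset) (localBlocks z τ β)) :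
    ∃ r ∈ cubicGlobalRows m z τ, sector r = β.toFinset ∧ ∀ σ ⊆ inner z β.toFinset, σ.card = 3 →
      cubicGlobalEntry m z (cubicSpecial z β) σ r = columnFactor m z β σ *
        cubicEntry (localSize (z 0) (localBlocks z τ β)) (blockSize (localBlocks z τ β))
          (σ.image (relabel β)) r' := by
  rw [mem_cubicRows, localSize_localBlocks hz hβ h0] at hr
  rcases hr with ⟨t, ht, l, hl, k, hk, rfl⟩ | ⟨p, hp, t, ht, l, hl, x, hx, rfl⟩
  · exact ⟨⟨β.toFinset, t, Sum.inr _, _⟩, mem_cubicGlobalRows.2 ⟨hm, ht,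
      Finset.inr_mem_disjSum.2 (Finset.mem_range.2 hk), hl⟩, rfl,
      fun σ hσ hcard => cubicGlobalEntry_special_core hz hβ h0 hσ hcard _ _ _⟩
  · obtain ⟨b, hb, rfl⟩ := (mem_zipIdx_localBlocks hβ h0).1 hp
    have hb' : b ∈ β.toFinset := List.mem_toFinset.2 hb
    have ha : 16 * b + (x + 1) ∈ blockCodes b (z b) := by
      simp only at hx
      rw [blockCodes, Finset.mem_Icc]; omega
    have hab := ((mem_blockCodes (hz b)).1 ha).1
    have hre : relabel β (16 * b + (x + 1)) = 16 * (0 :: β).idxOf b + (x + 1) := by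
      rw [relabel, hab]
      have := hz b
      simp only at hx
      omega
    refine ⟨⟨β.toFinset.erase b, t, Sum.inl (16 * b + (x + 1)), l⟩, mem_cubicGlobalRows.2
      ⟨(Finset.erase_subset _ _).trans hm, ht, Finset.inl_mem_disjSum.2 ?_, hl⟩, ?_,
      fun σ hσ hcard => ?_⟩
    · rw [outer_erase hb' hm]
      exact Finset.mem_union_left _ ha
    · simp only [sector, Sum.elim_inl, hab, Finset.insert_erase hb']
    · rw [cubicGlobalEntry_special_side hz hβ h0 hm hσ hcard hb ha, hre]

theorem exists_linearIndependent_cubic_cols (K : Type*) [Field K] [CharZero K] {m : ℕ}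
    {z : ℕ → ℕ} (hz : ∀ b, z b ≤ 15) {τ : Finset ℕ → ℕ}
    (hcheck : ∀ S ⊆ Finset.Icc 1 m, S.card ≤ 3 → ∃ β : List ℕ, β.Nodup ∧ β.toFinset = S ∧
      cubicFillCheck (z 0) (τ S) (localBlocks z τ β) = true) :
    ∃ v : Param → K, LinearIndependent K
      fun (σ : globalCols 3 m z) (r : cubicGlobalRows m z τ) => cubicGlobalEntry m z v σ r := by
  have : Fact (Nat.Prime 32003) := ⟨by norm_num⟩
  have hcols : ∀ σ : globalCols 3 m z, (σ : Finset ℕ) ⊆ inner z (Finset.Icc 1 m) ∧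
      (σ : Finset ℕ).card = 3 := fun σ => Finset.mem_powersetCard.1 σ.2
  obtain ⟨v, hv⟩ := exists_linearIndependent_of_sectors (K := K) 32003
    (fun (σ : globalCols 3 m z) (r : cubicGlobalRows m z τ) =>
      cubicGlobalEntry m z (MvPolynomial.X : Param → MvPolynomial Param ℤ) σ r)
    (fun σ => support σ) (fun r => sector r)
    (fun σ r h => cubic_support_subset_sector hz (hcols σ).1 (hcols σ).2 h) (by
      intro σ₀
      obtain ⟨β, hβ, hS, h⟩ := hcheck _ (support_subset hz (hcols σ₀).1)
        ((card_support_le _).trans (hcols σ₀).2.le)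
      have hm : β.toFinset ⊆ Finset.Icc 1 m := hS ▸ support_subset hz (hcols σ₀).1
      have h0 : 0 ∉ β := fun h0 => by simpa using hm (List.mem_toFinset.2 h0)
      have hlen : β.length ≤ 3 := by
        rw [← List.toFinset_card_of_nodup hβ, hS]
        exact (card_support_le _).trans (hcols σ₀).2.le
      rw [← hS] at h ⊢
      have hsub : ∀ σ : {σ : globalCols 3 m z // support σ = β.toFinset},
          (σ : Finset ℕ) ⊆ inner z β.toFinset := fun σ =>
        (subset_inner hz (hcols σ).1).trans_eq (congrArg (inner z) σ.2)
      refine ⟨cubicSpecial z β, linearIndependent_of_localCols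
        (linearIndependent_of_cubicFillCheck _ _ _ (hz 0) (localBlocks_le hz τ β) h)
        (loc := fun σ => σ.1.1.image (relabel β)) ?_ ?_
        (c := fun σ => columnFactor m z β σ.1.1) ?_ ?_⟩
      · intro σ σ' hσ
        refine Subtype.ext (Subtype.ext ?_)
        exact (Finset.image_injOn_powerset_of_injOn (relabel_injOn hz))
          (Finset.mem_coe.2 (Finset.mem_powerset.2 (hsub σ)))
          (Finset.mem_coe.2 (Finset.mem_powerset.2 (hsub σ'))) hσ
      · intro σ
        exact exists_localCol hz hβ h0 (hsub σ) (hcols σ).2 σ.2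
      · intro σ
        exact columnFactor_ne_zero hz hlen (hsub σ)
      · intro r' hr'
        obtain ⟨r, hr, hrs, hre⟩ := exists_cubicGlobalRow hz hβ h0 hm hr'
        refine ⟨⟨⟨r, hr⟩, hrs⟩, fun σ => ?_⟩
        rw [← hre _ (hsub σ) (hcols σ).2, ← AlgHom.coe_toRingHom, map_cubicGlobalEntry]
        congr 1
        ext p
        simp)
  refine ⟨v, ?_⟩
  convert hv using 3
  rw [← AlgHom.coe_toRingHom, map_cubicGlobalEntry]
  congr 1
  ext p
  simp

/-! ### Sums of tangent spaces -/

theorem finrank_homogeneousSubmodule (K : Type*) [Field K] (n d : ℕ) :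
    Module.finrank K (homogeneousSubmodule (Fin (n + 1)) K d) = (n + d).choose d := by
  have hset : {e : Fin (n + 1) →₀ ℕ | e.degree = d} =
      ((Finset.univ : Finset (Fin (n + 1))).finsuppAntidiag d : Set (Fin (n + 1) →₀ ℕ)) := by
    ext e
    simp [Finsupp.degree_eq_sum]
  have hli : LinearIndependent K fun e : (Finset.univ : Finset (Fin (n + 1))).finsuppAntidiag d =>
      (monomial e.1 (1 : K)) := by
    have := (basisMonomials (Fin (n + 1)) K).linearIndependent.comp _
      (Subtype.val_injective (p := (· ∈ (Finset.univ : Finset (Fin (n + 1))).finsuppAntidiag d)))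
    simpa [Function.comp_def] using this
  rw [homogeneousSubmodule_eq_finsupp_supported, AddMonoidAlgebra.supported_eq_span_single, hset,
    Set.image_eq_range]
  refine (finrank_span_eq_card hli).trans ?_
  rw [Fintype.card_coe, Finset.card_finsuppAntidiag_nat_eq_choose, Finset.card_univ,
    Fintype.card_fin]
  congr 1
  omega

instance {K σ : Type*} [Field K] [Finite σ] (d : ℕ) :
    FiniteDimensional K (homogeneousSubmodule σ K d) :=
  Module.Finite.iff_fg.2 (homogeneousSubmodule_fg σ K d)

/-- The tangent space at a product of linear forms. -/
noncomputable def tangent (K : Type*) [Field K] {n d : ℕ}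
    (f : Fin d → MvPolynomial (Fin (n + 1)) K) :
    Submodule K (MvPolynomial (Fin (n + 1)) K) :=
  ⨆ j : Fin d, Submodule.map (LinearMap.mulLeft K (∏ m ∈ Finset.univ.erase j, f m))
    (homogeneousSubmodule (Fin (n + 1)) K 1)

theorem mul_mem_tangent {K : Type*} [Field K] {n d : ℕ} {f : Fin d → MvPolynomial (Fin (n + 1)) K}
    (j : Fin d) {g : MvPolynomial (Fin (n + 1)) K} (hg : g.IsHomogeneous 1) :
    (∏ m ∈ Finset.univ.erase j, f m) * g ∈ tangent K f :=
  Submodule.mem_iSup_of_mem j ⟨g, hg, rfl⟩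

theorem tangent_le {K : Type*} [Field K] {n d : ℕ} {f : Fin d → MvPolynomial (Fin (n + 1)) K}
    (hf : ∀ j, (f j).IsHomogeneous 1) : tangent K f ≤ homogeneousSubmodule (Fin (n + 1)) K d := by
  refine iSup_le fun j => ?_
  rintro _ ⟨g, hg, rfl⟩
  have h := (IsHomogeneous.prod (Finset.univ.erase j) f (fun _ => 1) fun i _ => hf i).mul hg
  rw [Finset.sum_const, Finset.card_erase_of_mem (Finset.mem_univ _), Finset.card_univ,
    Fintype.card_fin, smul_eq_mul, mul_one, Nat.sub_add_cancel (Fin.pos j)] at h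
  exact h

theorem finrank_iSup_le {K V : Type*} [Field K] [AddCommGroup V] [Module K V] {ι : Type*}
    [Fintype ι] (p : ι → Submodule K V) [∀ i, FiniteDimensional K (p i)] {k : ℕ}
    (h : ∀ i, Module.finrank K (p i) ≤ k) :
    Module.finrank K ↥(⨆ i, p i) ≤ Fintype.card ι * k := by
  classical
  have key : ∀ s : Finset ι, Module.finrank K ↥(s.sup p) ≤ s.card * k := by
    intro s
    induction s using Finset.induction_on with
    | empty => simp
    | insert a s ha ih =>
      rw [Finset.sup_insert, Finset.card_insert_of_notMem ha]
      have := Submodule.finrank_add_le_finrank_add_finrank (p a) (s.sup p)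
      have := h a
      linarith
  rw [← Finset.sup_univ_eq_iSup]
  exact key Finset.univ

theorem finrank_tangent_le_of_eq_zero {K : Type*} [Field K] {n d : ℕ}
    {f : Fin d → MvPolynomial (Fin (n + 1)) K} {j : Fin d} (hj : f j = 0) :
    Module.finrank K (tangent K f) ≤ n + 1 := by
  have : tangent K f ≤ Submodule.map (LinearMap.mulLeft K (∏ m ∈ Finset.univ.erase j, f m))
      (homogeneousSubmodule (Fin (n + 1)) K 1) := by
    refine iSup_le fun i => ?_
    by_cases hij : i = j
    · rw [hij]
    · rintro _ ⟨g, hg, rfl⟩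
      have h0 : ∏ m ∈ Finset.univ.erase i, f m = 0 :=
        Finset.prod_eq_zero (i := j) (by simp [Ne.symm hij]) hj
      rw [LinearMap.mulLeft_apply, h0, zero_mul]
      exact zero_mem _
  refine (Submodule.finrank_mono this).trans ((Submodule.finrank_map_le _ _).trans ?_)
  rw [finrank_homogeneousSubmodule, Nat.choose_one_right]

theorem finrank_tangent_le {K : Type*} [Field K] {n d : ℕ} (hd : 1 ≤ d)
    {f : Fin d → MvPolynomial (Fin (n + 1)) K} (hf : ∀ j, (f j).IsHomogeneous 1) :
    Module.finrank K (tangent K f) ≤ d * n + 1 := by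
  have h1 : Module.finrank K (homogeneousSubmodule (Fin (n + 1)) K 1) = n + 1 := by
    rw [finrank_homogeneousSubmodule, Nat.choose_one_right]
  by_cases h0 : ∃ j, f j = 0
  · obtain ⟨j, hj⟩ := h0
    have := finrank_tangent_le_of_eq_zero hj
    nlinarith
  · push Not at h0
    have hc : ∀ j, ∃ C : Submodule K (homogeneousSubmodule (Fin (n + 1)) K 1),
        IsCompl (Submodule.span K {⟨f j, hf j⟩}) C := fun j => Submodule.exists_isCompl _
    choose C hC using hc
    have hCn : ∀ j, Module.finrank K (C j) ≤ n := fun j => by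
      have := Submodule.finrank_add_eq_of_isCompl (hC j)
      rw [finrank_span_singleton (by simpa [Subtype.ext_iff] using h0 j), h1] at this
      omega
    have hle : tangent K f ≤ Submodule.span K {∏ m, f m} ⊔
        ⨆ j, ((C j).map (homogeneousSubmodule (Fin (n + 1)) K 1).subtype).map
          (LinearMap.mulLeft K (∏ m ∈ Finset.univ.erase j, f m)) := by
      refine iSup_le fun j => ?_
      rintro _ ⟨g, hg, rfl⟩
      have hg' : (⟨g, hg⟩ : homogeneousSubmodule (Fin (n + 1)) K 1) ∈
          Submodule.span K {⟨f j, hf j⟩} ⊔ C j := by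
        rw [(hC j).sup_eq_top]
        trivial
      obtain ⟨x, hx, y, hy, hxy⟩ := Submodule.mem_sup.1 hg'
      obtain ⟨a, rfl⟩ := Submodule.mem_span_singleton.1 hx
      have hg2 : g = a • f j + y := congrArg Subtype.val hxy.symm
      rw [hg2, map_add]
      refine Submodule.add_mem_sup ?_ (Submodule.mem_iSup_of_mem j ⟨y, ⟨y, hy, rfl⟩, rfl⟩)
      rw [map_smul, LinearMap.mulLeft_apply, Finset.prod_erase_mul _ _ (Finset.mem_univ j)]
      exact Submodule.smul_mem _ _ (Submodule.mem_span_singleton_self _)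
    have h2 := finrank_iSup_le (fun j =>
      ((C j).map (homogeneousSubmodule (Fin (n + 1)) K 1).subtype).map
          (LinearMap.mulLeft K (∏ m ∈ Finset.univ.erase j, f m))) (k := n) fun j =>
      (Submodule.finrank_map_le _ _).trans ((Submodule.finrank_map_le _ _).trans (hCn j))
    refine (Submodule.finrank_mono hle).trans
      ((Submodule.finrank_add_le_finrank_add_finrank _ _).trans ?_)
    have h3 := finrank_span_le_card (R := K) ({∏ m, f m} : Set (MvPolynomial (Fin (n + 1)) K))
    rw [Set.toFinset_singleton, Finset.card_singleton] at h3
    rw [Fintype.card_fin] at h2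
    omega

/-- The sum of the tangent spaces at several products of linear forms. -/
noncomputable def tangentSum (K : Type*) [Field K] {s n d : ℕ}
    (f : Fin s → Fin d → MvPolynomial (Fin (n + 1)) K) :
    Submodule K (MvPolynomial (Fin (n + 1)) K) := ⨆ i, tangent K (f i)

theorem tangentSum_le {K : Type*} [Field K] {s n d : ℕ}
    {f : Fin s → Fin d → MvPolynomial (Fin (n + 1)) K} (hf : ∀ i j, (f i j).IsHomogeneous 1) :
    tangentSum K f ≤ homogeneousSubmodule (Fin (n + 1)) K d :=
  iSup_le fun i => tangent_le (hf i)

theorem finiteDimensional_tangentSum {K : Type*} [Field K] {s n d : ℕ}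
    {f : Fin s → Fin d → MvPolynomial (Fin (n + 1)) K} (hf : ∀ i j, (f i j).IsHomogeneous 1) :
    FiniteDimensional K (tangentSum K f) :=
  Submodule.finiteDimensional_of_le (tangentSum_le hf)

theorem finrank_tangentSum_le {K : Type*} [Field K] {s n d : ℕ} (hd : 1 ≤ d)
    {f : Fin s → Fin d → MvPolynomial (Fin (n + 1)) K} (hf : ∀ i j, (f i j).IsHomogeneous 1) :
    Module.finrank K (tangentSum K f) ≤ min (s * (d * n + 1)) ((n + d).choose d) := by
  refine le_min ?_ ?_
  · have : ∀ i, FiniteDimensional K (tangent K (f i)) := fun i =>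
      Submodule.finiteDimensional_of_le (tangent_le (hf i))
    have h := finrank_iSup_le (fun i => tangent K (f i)) fun i => finrank_tangent_le hd (hf i)
    rwa [Fintype.card_fin] at h
  · rw [← finrank_homogeneousSubmodule K]
    exact Submodule.finrank_mono (tangentSum_le hf)

/-- The tangent spaces at `s` general completely reducible forms are independent. -/
def IsSub (K : Type*) [Field K] (s n d : ℕ) : Prop :=
  ∃ f : Fin s → Fin d → MvPolynomial (Fin (n + 1)) K, (∀ i j, (f i j).IsHomogeneous 1) ∧
    s * (d * n + 1) ≤ Module.finrank K (tangentSum K f)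

/-- The tangent spaces at `s` general completely reducible forms span. -/
def IsFill (K : Type*) [Field K] (s n d : ℕ) : Prop :=
  ∃ f : Fin s → Fin d → MvPolynomial (Fin (n + 1)) K, (∀ i j, (f i j).IsHomogeneous 1) ∧
    (n + d).choose d ≤ Module.finrank K (tangentSum K f)

theorem card_le_finrank_of_rows {K V R C : Type*} [Field K] [AddCommGroup V] [Module K V]
    [Fintype R] (U : Submodule K V) [FiniteDimensional K U] {w : R → V} (hw : ∀ r, w r ∈ U)
    (L : C → V →ₗ[K] K) (h : LinearIndependent K fun r σ => L σ (w r)) :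
    Fintype.card R ≤ Module.finrank K U := by
  have h1 : LinearIndependent K w := LinearIndependent.of_comp (LinearMap.pi L) h
  have h2 : LinearIndependent K fun r => (⟨w r, hw r⟩ : U) :=
    LinearIndependent.of_comp U.subtype h1
  exact h2.fintype_card_le_finrank

theorem card_le_finrank_of_cols {K V R C : Type*} [Field K] [AddCommGroup V] [Module K V]
    [Fintype C] (U : Submodule K V) [FiniteDimensional K U] {w : R → V} (hw : ∀ r, w r ∈ U)
    (L : C → V →ₗ[K] K) (h : LinearIndependent K fun σ r => L σ (w r)) :
    Fintype.card C ≤ Module.finrank K U := by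
  let φ : Module.Dual K U →ₗ[K] (R → K) := LinearMap.pi fun r =>
    Module.Dual.eval K U ⟨w r, hw r⟩
  have h2 : LinearIndependent K fun σ => (L σ ∘ₗ U.subtype : Module.Dual K U) :=
    LinearIndependent.of_comp φ h
  rw [← Subspace.dual_finrank_eq]
  exact h2.fintype_card_le_finrank

/-- Reindexing a family of products of linear forms. -/
theorem exists_tangentSum {K ι κ : Type*} [Field K] [Fintype ι] [DecidableEq κ] {s n d : ℕ}
    (hs : Fintype.card ι = s) (I : ι → Finset κ) (hI : ∀ i, (I i).card = d)
    (F : ι → κ → MvPolynomial (Fin (n + 1)) K)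
    (hF : ∀ i e, (F i e).IsHomogeneous 1) :
    ∃ f : Fin s → Fin d → MvPolynomial (Fin (n + 1)) K,
      (∀ i j, (f i j).IsHomogeneous 1) ∧ ∀ i, ∀ e ∈ I i, ∀ g : MvPolynomial (Fin (n + 1)) K,
        g.IsHomogeneous 1 → (∏ k ∈ (I i).erase e, F i k) * g ∈ tangentSum K f := by
  let E := Fintype.equivFinOfCardEq hs
  refine ⟨fun i j => F (E.symm i) ((I (E.symm i)).equivFinOfCardEq (hI _) |>.symm j),
    fun i j => hF _ _, fun i e he g hg => ?_⟩
  obtain ⟨i, rfl⟩ := E.symm.surjective i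
  refine Submodule.mem_iSup_of_mem i ?_
  convert mul_mem_tangent (((I (E.symm i)).equivFinOfCardEq (hI _)) ⟨e, he⟩) hg using 2
  refine Finset.prod_nbij' (fun k => if hk : k ∈ I (E.symm i) then
      (I (E.symm i)).equivFinOfCardEq (hI _) ⟨k, hk⟩ else
      (I (E.symm i)).equivFinOfCardEq (hI _) ⟨e, he⟩)
    (fun j => ((I (E.symm i)).equivFinOfCardEq (hI _)).symm j) ?_ ?_ ?_ ?_ ?_
  · intro k hk
    rw [Finset.mem_erase] at hk
    simp [hk.1, hk.2]
  · intro j hj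
    rw [Finset.mem_erase] at hj ⊢
    refine ⟨fun h => hj.1 ?_, Subtype.coe_prop _⟩
    rw [← Equiv.symm_apply_eq]
    exact Subtype.ext h
  · intro k hk
    rw [Finset.mem_erase] at hk
    simp [hk.2]
  · intro j _
    simp
  · intro k hk
    rw [Finset.mem_erase] at hk
    simp [hk.2]

/-! ### From the global matrix to tangent spaces -/

theorem card_outer {m : ℕ} {z : ℕ → ℕ} (hz : ∀ b, z b ≤ 15) (T : Finset ℕ) :
    (outer m z T).card = ∑ b ∈ Finset.Icc 1 m \ T, z b := by
  rw [outer, Finset.card_biUnion]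
  · simp [blockCodes]
  · intro b _ b' _ hbb
    refine Finset.disjoint_left.2 fun u hu hu' => ?_
    rw [mem_blockCodes (hz _)] at hu hu'
    exact hbb (hu.1.symm.trans hu'.1)

theorem card_outer_add_card_inner {m : ℕ} {z : ℕ → ℕ} (hz : ∀ b, z b ≤ 15) {T : Finset ℕ}
    (hT : T ⊆ Finset.Icc 1 m) :
    (outer m z T).card + (inner z T).card = z 0 + ∑ b ∈ Finset.Icc 1 m, z b := by
  have h0 : 0 ∉ T := fun h => by simpa using hT h
  rw [card_outer hz, card_inner hz h0, ← Finset.sum_sdiff hT]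
  ring

theorem card_globalCols {n m : ℕ} {z : ℕ → ℕ} (hz : ∀ b, z b ≤ 15) :
    (globalCols n m z).card = (z 0 + ∑ b ∈ Finset.Icc 1 m, z b).choose n := by
  rw [globalCols, Finset.card_powersetCard, card_inner hz (by simp)]

theorem natDegree_prod_X_add_C {A : Type*} [CommRing A] [Nontrivial A] (θ : ℕ → A)
    (σ : Finset ℕ) : (∏ k ∈ σ, (Polynomial.X + Polynomial.C (θ k))).natDegree = σ.card := by
  rw [Polynomial.natDegree_prod_of_monic _ _ fun k _ => Polynomial.monic_X_add_C _]
  simp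

theorem symm_card_eq_one {A : Type*} [CommRing A] [Nontrivial A] (θ : ℕ → A)
    (σ : Finset ℕ) : symm θ σ σ.card = 1 := by
  have h := (Polynomial.monic_prod_of_monic σ (fun k => Polynomial.X + Polynomial.C (θ k))
    fun k _ => Polynomial.monic_X_add_C _).coeff_natDegree
  rwa [natDegree_prod_X_add_C] at h

theorem sum_symm_eq_pform {A : Type*} [CommRing A] [Nontrivial A] (θ : ℕ → A)
    (σ : Finset ℕ) (a : A) :
    ∑ c ∈ Finset.range (σ.card + 1), (-a) ^ c * symm θ σ c = pform θ a σ := by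
  have h := Polynomial.eval_eq_sum_range' (p := ∏ k ∈ σ, (Polynomial.X + Polynomial.C (θ k)))
    (n := σ.card + 1) (by rw [natDegree_prod_X_add_C]; omega) (-a)
  rw [Polynomial.eval_prod] at h
  simp only [Polynomial.eval_add, Polynomial.eval_X, Polynomial.eval_C] at h
  rw [pform]
  refine Eq.trans ?_ (h.symm.trans ?_)
  · exact Finset.sum_congr rfl fun c _ => mul_comm _ _
  · exact Finset.prod_congr rfl fun k _ => by ring

/-- A linear form with given coefficients. -/
noncomputable def linearForm {K : Type*} [Field K] {n : ℕ} (a : ℕ → K) :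
    MvPolynomial (Fin (n + 1)) K := ∑ c : Fin (n + 1), C (a c) * X c

theorem isHomogeneous_linearForm {K : Type*} [Field K] {n : ℕ} (a : ℕ → K) :
    (linearForm a : MvPolynomial (Fin (n + 1)) K).IsHomogeneous 1 :=
  IsHomogeneous.sum _ _ _ fun c _ => by
    simpa using (isHomogeneous_C (Fin (n + 1)) (a c)).mul (isHomogeneous_X K c)

theorem aeval_linearForm {K : Type*} [Field K] {n : ℕ} (a x : ℕ → K) :
    aeval (fun c : Fin (n + 1) => x c) (linearForm a : MvPolynomial (Fin (n + 1)) K) =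
      ∑ c ∈ Finset.range (n + 1), a c * x c := by
  rw [linearForm, map_sum, Finset.sum_range]
  simp

/-- The linear forms of a tile. -/
noncomputable def tilePoly {K : Type*} [Field K] (n : ℕ) (v : Param → K) (T : Finset ℕ) (t : ℕ) :
    ℕ ⊕ ℕ → MvPolynomial (Fin (n + 1)) K :=
  Sum.elim (fun a => linearForm fun c => (-v (Sum.inl a)) ^ c)
    (fun k => linearForm fun c => v (Sum.inr (T, t, k, c)))

theorem isHomogeneous_tilePoly {K : Type*} [Field K] (n : ℕ) (v : Param → K) (T : Finset ℕ)
    (t : ℕ) (e : ℕ ⊕ ℕ) : (tilePoly n v T t e).IsHomogeneous 1 := by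
  cases e with
  | inl a => exact isHomogeneous_linearForm fun c => (-v (Sum.inl a)) ^ c
  | inr k => exact isHomogeneous_linearForm fun c => v (Sum.inr (T, t, k, c))

theorem aeval_tilePoly {K : Type*} [Field K] {n : ℕ} (v : Param → K) (T : Finset ℕ) (t : ℕ)
    {σ : Finset ℕ} (hσ : σ.card = n) (e : ℕ ⊕ ℕ) :
    aeval (fun c : Fin (n + 1) => symm (v ∘ Sum.inl) σ c) (tilePoly n v T t e) =
      tileForm n v T t σ e := by
  cases e with
  | inl a =>
    subst hσ
    rw [tilePoly, Sum.elim_inl, aeval_linearForm, sum_symm_eq_pform]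
    rfl
  | inr k =>
    rw [tilePoly, Sum.elim_inr, aeval_linearForm]
    rfl

/-- The tiles of a design. -/
def tiles (m : ℕ) (τ : Finset ℕ → ℕ) : Finset ((_ : Finset ℕ) × ℕ) :=
  (Finset.Icc 1 m).powerset.sigma fun T => Finset.range (τ T)

theorem card_tiles (m : ℕ) (τ : Finset ℕ → ℕ) :
    Fintype.card (tiles m τ) = ∑ T ∈ (Finset.Icc 1 m).powerset, τ T := by
  rw [Fintype.card_coe, tiles, Finset.card_sigma]
  simp

theorem mem_tiles {m : ℕ} {τ : Finset ℕ → ℕ} {T : Finset ℕ} {t : ℕ} :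
    (⟨T, t⟩ : (_ : Finset ℕ) × ℕ) ∈ tiles m τ ↔ T ⊆ Finset.Icc 1 m ∧ t < τ T := by
  simp [tiles]

theorem card_tileIndex {n m d : ℕ} {z : ℕ → ℕ} (hz : ∀ b, z b ≤ 15)
    (hN : z 0 + ∑ b ∈ Finset.Icc 1 m, z b = n + d) {T : Finset ℕ} (hT : T ⊆ Finset.Icc 1 m)
    (hn : n ≤ (inner z T).card) : (tileIndex n m z T).card = d := by
  have := card_outer_add_card_inner hz hT
  rw [tileIndex, Finset.card_disjSum, Finset.card_range]
  omega

theorem card_globalRows {n m d : ℕ} {z : ℕ → ℕ} (hz : ∀ b, z b ≤ 15) {τ : Finset ℕ → ℕ}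
    (hN : z 0 + ∑ b ∈ Finset.Icc 1 m, z b = n + d)
    (hτ : ∀ T ⊆ Finset.Icc 1 m, τ T ≠ 0 → n ≤ (inner z T).card) :
    (globalRows n m z τ).card = (∑ T ∈ (Finset.Icc 1 m).powerset, τ T) * (d * n + 1) := by
  rw [globalRows, Finset.card_sigma, Finset.sum_mul]
  refine Finset.sum_congr rfl fun T hT => ?_
  rw [Finset.mem_powerset] at hT
  by_cases h : τ T = 0
  · simp [h]
  · rw [Finset.card_product, Finset.card_range, tileRows, Finset.card_insert_of_notMem,
      Finset.card_product, card_tileIndex hz hN hT (hτ T hT h), Nat.card_Icc]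
    · simp
    · simp [tileIndex]

/-- The forms whose values make up the global matrix. -/
theorem exists_tangentSum_of_design {K : Type*} [Field K] {n m d : ℕ} {z : ℕ → ℕ}
    (hz : ∀ b, z b ≤ 15) (hd : 1 ≤ d) {τ : Finset ℕ → ℕ}
    (hN : z 0 + ∑ b ∈ Finset.Icc 1 m, z b = n + d)
    (hτ : ∀ T ⊆ Finset.Icc 1 m, τ T ≠ 0 → n ≤ (inner z T).card) (v : Param → K) :
    ∃ f : Fin (∑ T ∈ (Finset.Icc 1 m).powerset, τ T) → Fin d → MvPolynomial (Fin (n + 1)) K,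
      (∀ i j, (f i j).IsHomogeneous 1) ∧ ∃ w : globalRows n m z τ → MvPolynomial (Fin (n + 1)) K,
        (∀ r, w r ∈ tangentSum K f) ∧ ∀ r, ∀ σ : globalCols n m z,
          aeval (fun c : Fin (n + 1) => symm (v ∘ Sum.inl) σ c) (w r) =
            globalEntry n m z v σ r := by
  have hI : ∀ p : tiles m τ, (tileIndex n m z p.1.1).card = d := fun ⟨⟨T, t⟩, hp⟩ => by
    rw [mem_tiles] at hp
    exact card_tileIndex hz hN hp.1 (hτ T hp.1 (by omega))
  obtain ⟨f, hf, hmem⟩ := exists_tangentSum (card_tiles m τ)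
    (fun p : tiles m τ => tileIndex n m z p.1.1) hI
    (fun p => tilePoly n v p.1.1 p.1.2) (fun p => isHomogeneous_tilePoly n v _ _)
  refine ⟨f, hf, fun r => (∏ e ∈ (tileIndex n m z r.1.1).erase r.1.2.2.1,
    tilePoly n v r.1.1 r.1.2.1 e) * if r.1.2.2.1 ∈ tileIndex n m z r.1.1 then
      X (Fin.ofNat (n + 1) r.1.2.2.2) else 1, ?_, ?_⟩
  · rintro ⟨⟨T, t, e, c⟩, hr⟩
    obtain ⟨hT, ht, -⟩ := mem_globalRows.1 hr
    have hp : (⟨T, t⟩ : (_ : Finset ℕ) × ℕ) ∈ tiles m τ := mem_tiles.2 ⟨hT, ht⟩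
    simp only
    split_ifs with he
    · exact hmem ⟨_, hp⟩ e he _ (isHomogeneous_X _ _)
    · rw [Finset.erase_eq_of_notMem he, mul_one]
      obtain ⟨e', he'⟩ := Finset.card_pos.1 ((hI ⟨_, hp⟩).symm ▸ hd)
      rw [← Finset.prod_erase_mul _ _ he']
      exact hmem ⟨_, hp⟩ e' he' _ (isHomogeneous_tilePoly n v _ _ _)
  · rintro ⟨⟨T, t, e, c⟩, hr⟩ σ
    have hσ : (σ : Finset ℕ).card = n := (Finset.mem_powersetCard.1 σ.2).2
    obtain ⟨hT, ht, hec⟩ := mem_globalRows.1 hr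
    rw [globalEntry, map_mul, map_prod]
    simp only [aeval_tilePoly v T t hσ]
    congr 1
    rcases Finset.mem_insert.1 hec with h | h
    · obtain ⟨rfl, rfl⟩ := Prod.mk.inj h
      rw [if_neg (by simp [tileIndex]), map_one]
      exact ((congrArg _ hσ).symm.trans (symm_card_eq_one (v ∘ Sum.inl) σ.1)).symm
    · rw [Finset.mem_product, Finset.mem_Icc] at h
      simp only at h
      rw [if_pos h.1, aeval_X, Fin.val_ofNat, Nat.mod_eq_of_lt (by omega)]

theorem isFill_of_design (K : Type*) [Field K] [CharZero K] {n m d : ℕ} (hn : n ≤ 3) {z : ℕ → ℕ}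
    (hz : ∀ b, z b ≤ 15) (hd : 1 ≤ d) {τ : Finset ℕ → ℕ}
    (hN : z 0 + ∑ b ∈ Finset.Icc 1 m, z b = n + d)
    (hτ : ∀ T ⊆ Finset.Icc 1 m, τ T ≠ 0 → n ≤ (inner z T).card)
    (hcheck : ∀ S ⊆ Finset.Icc 1 m, S.card ≤ n → ∃ β : List ℕ, β.Nodup ∧ β.toFinset = S ∧
      pointFillCheck n (z 0) (τ S) (localBlocks z τ β) = true) :
    IsFill K (∑ T ∈ (Finset.Icc 1 m).powerset, τ T) n d := by
  obtain ⟨v, hv⟩ := exists_linearIndependent_cols K hn hz hcheck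
  obtain ⟨f, hf, w, hw, hwe⟩ := exists_tangentSum_of_design hz hd hN hτ v
  refine ⟨f, hf, ?_⟩
  have := finiteDimensional_tangentSum hf
  have h := card_le_finrank_of_cols (tangentSum K f) hw
    (fun σ : globalCols n m z =>
      (aeval (R := K) fun c : Fin (n + 1) => symm (v ∘ Sum.inl) σ c).toLinearMap)
    (by simpa only [AlgHom.toLinearMap_apply, hwe] using hv)
  rwa [Fintype.card_coe, card_globalCols hz, hN, Nat.choose_symm_add] at h

theorem isSub_of_design (K : Type*) [Field K] [CharZero K] {n m d : ℕ} (hn : n ≤ 3) {z : ℕ → ℕ}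
    (hz : ∀ b, z b ≤ 15) (hd : 1 ≤ d) {τ : Finset ℕ → ℕ}
    (hN : z 0 + ∑ b ∈ Finset.Icc 1 m, z b = n + d)
    (hτ : ∀ T ⊆ Finset.Icc 1 m, τ T ≠ 0 → n ≤ (inner z T).card)
    (hτn : ∀ T, τ T ≠ 0 → T.card < n)
    (hcheck : ∀ S ⊆ Finset.Icc 1 m, S.card ≤ n → ∃ β : List ℕ, β.Nodup ∧ β.toFinset = S ∧
      pointSubCheck n (z 0) (τ S) (localBlocks z τ β) = true) :
    IsSub K (∑ T ∈ (Finset.Icc 1 m).powerset, τ T) n d := by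
  obtain ⟨v, hv⟩ := exists_linearIndependent_rows K hn hz hτn hcheck
  obtain ⟨f, hf, w, hw, hwe⟩ := exists_tangentSum_of_design hz hd hN hτ v
  refine ⟨f, hf, ?_⟩
  have := finiteDimensional_tangentSum hf
  have h := card_le_finrank_of_rows (tangentSum K f) hw
    (fun σ : globalCols n m z =>
      (aeval (R := K) fun c : Fin (n + 1) => symm (v ∘ Sum.inl) σ c).toLinearMap)
    (by simpa only [AlgHom.toLinearMap_apply, hwe] using hv)
  rwa [Fintype.card_coe, card_globalRows hz hN hτ] at h

/-! ### From the global matrix for cubics to tangent spaces -/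

/-- The linear form whose restriction to the rational normal curve is a given polynomial. -/
noncomputable def curveForm {K : Type*} [Field K] {n : ℕ} (p : Polynomial K) :
    MvPolynomial (Fin (n + 1)) K := linearForm p.coeff

/-- Evaluation at a sum of points of the rational normal curve. -/
noncomputable def curveEval {K : Type*} [Field K] (n : ℕ) (θ : ℕ → K) (s : Finset ℕ) :
    MvPolynomial (Fin (n + 1)) K →ₐ[K] K := aeval fun c : Fin (n + 1) => ∑ u ∈ s, θ u ^ (c : ℕ)

theorem curveEval_curveForm {K : Type*} [Field K] {n : ℕ} (θ : ℕ → K) (s : Finset ℕ)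
    {p : Polynomial K} (hp : p.natDegree ≤ n) :
    curveEval n θ s (curveForm p) = ∑ u ∈ s, p.eval (θ u) := by
  rw [curveEval, curveForm, aeval_linearForm p.coeff fun c => ∑ u ∈ s, θ u ^ c]
  simp only [Finset.mul_sum]
  rw [Finset.sum_comm]
  exact Finset.sum_congr rfl fun u _ =>
    (Polynomial.eval_eq_sum_range' (Nat.lt_succ_of_le hp) (θ u)).symm

/-- The polarization of a cubic at three points of the rational normal curve. -/
noncomputable def polarization {K : Type*} [Field K] (n : ℕ) (θ : ℕ → K) (σ : Finset ℕ) :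
    MvPolynomial (Fin (n + 1)) K →ₗ[K] K :=
  (curveEval n θ σ).toLinearMap - ∑ x ∈ σ, (curveEval n θ (σ.erase x)).toLinearMap +
    ∑ x ∈ σ, (curveEval n θ {x}).toLinearMap

theorem polarization_mul {K : Type*} [Field K] {n : ℕ} (θ : ℕ → K) {σ : Finset ℕ}
    (hσ : σ.card = 3) {p q r : Polynomial K} (hp : p.natDegree ≤ n) (hq : q.natDegree ≤ n)
    (hr : r.natDegree ≤ n) :
    polarization n θ σ (curveForm p * curveForm q * curveForm r) =
      cubicPair (fun u => p.eval (θ u)) (fun u => q.eval (θ u)) (fun u => r.eval (θ u)) σ := by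
  simp only [polarization, LinearMap.add_apply, LinearMap.sub_apply, LinearMap.sum_apply,
    AlgHom.toLinearMap_apply, map_mul, curveEval_curveForm θ _ hp, curveEval_curveForm θ _ hq,
    curveEval_curveForm θ _ hr]
  have key : ∀ a : ℕ → K, ∀ x ∈ σ, ∑ u ∈ σ.erase x, a u = ∑ u ∈ σ, a u - a x := fun a x hx =>
    eq_sub_of_add_eq (Finset.sum_erase_add _ _ hx)
  have hsum : ∑ x ∈ σ, (∑ u ∈ σ.erase x, p.eval (θ u)) * (∑ u ∈ σ.erase x, q.eval (θ u)) *
        (∑ u ∈ σ.erase x, r.eval (θ u)) =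
      ∑ x ∈ σ, (∑ u ∈ σ, p.eval (θ u) - p.eval (θ x)) * (∑ u ∈ σ, q.eval (θ u) - q.eval (θ x)) *
        (∑ u ∈ σ, r.eval (θ u) - r.eval (θ x)) :=
    Finset.sum_congr rfl fun x hx => by
      rw [key (fun u => p.eval (θ u)) x hx, key (fun u => q.eval (θ u)) x hx,
        key (fun u => r.eval (θ u)) x hx]
  rw [hsum]
  obtain ⟨x, y, z, hnd, rfl⟩ := exists_toFinset_of_card_eq_three hσ
  rw [cubicPair_triple _ _ _ hnd]
  simp only [List.sum_toFinset _ hnd, List.map_cons, List.map_nil, List.sum_cons, List.sum_nil,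
    Finset.sum_singleton, sixTerms]
  ring

/-- The polynomials restricting the linear forms of a tile. -/
noncomputable def cubicPoly {K : Type*} [Field K] (m : ℕ) (z : ℕ → ℕ) (v : Param → K)
    (T : Finset ℕ) (t l : ℕ) : Polynomial K :=
  (∏ a ∈ outer m z T, (Polynomial.X - Polynomial.C (v (Sum.inl a)))) *
    (Polynomial.X - Polynomial.C (v (Sum.inr (T, t, l, 0)))) ^ ((inner z T).card - 3)

/-- The polynomials restricting the test forms of a tile. -/
noncomputable def testPoly {K : Type*} [Field K] (m : ℕ) (z : ℕ → ℕ) (v : Param → K)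
    (T : Finset ℕ) : ℕ ⊕ ℕ → Polynomial K :=
  Sum.elim
    (fun i => ∏ a ∈ (outer m z T).erase i, (Polynomial.X - Polynomial.C (v (Sum.inl a))))
    (fun k => (∏ a ∈ outer m z T, (Polynomial.X - Polynomial.C (v (Sum.inl a)))) *
      Polynomial.X ^ k)

theorem eval_cubicPoly {K : Type*} [Field K] (m : ℕ) (z : ℕ → ℕ) (v : Param → K)
    (T : Finset ℕ) (t l : ℕ) :
    (fun u => (cubicPoly m z v T t l).eval (v (Sum.inl u))) = cubicForm m z v T t l := by
  ext u
  simp [cubicPoly, cubicForm, cform, Polynomial.eval_prod]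

theorem eval_testPoly {K : Type*} [Field K] (m : ℕ) (z : ℕ → ℕ) (v : Param → K)
    (T : Finset ℕ) (e : ℕ ⊕ ℕ) :
    (fun u => (testPoly m z v T e).eval (v (Sum.inl u))) = testForm m z v T e := by
  ext u
  cases e <;> simp [testPoly, testForm, Polynomial.eval_prod]

theorem natDegree_prod_X_sub_C {K ι : Type*} [Field K] (s : Finset ι) (a : ι → K) :
    (∏ i ∈ s, (Polynomial.X - Polynomial.C (a i))).natDegree = s.card := by
  rw [Polynomial.natDegree_prod_of_monic _ _ fun k _ => Polynomial.monic_X_sub_C _]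
  simp

theorem natDegree_cubicPoly_le {K : Type*} [Field K] {n m : ℕ} {z : ℕ → ℕ} {T : Finset ℕ}
    (hN : (outer m z T).card + (inner z T).card = n + 3) (h3 : 3 ≤ (inner z T).card)
    (v : Param → K) (t l : ℕ) : (cubicPoly m z v T t l).natDegree ≤ n := by
  refine Polynomial.natDegree_mul_le.trans ?_
  rw [natDegree_prod_X_sub_C, Polynomial.natDegree_pow, Polynomial.natDegree_X_sub_C]
  omega

theorem natDegree_testPoly_le {K : Type*} [Field K] {n m : ℕ} {z : ℕ → ℕ} {T : Finset ℕ}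
    (hN : (outer m z T).card + (inner z T).card = n + 3) (h3 : 3 ≤ (inner z T).card)
    (v : Param → K) {e : ℕ ⊕ ℕ}
    (he : e ∈ (outer m z T).disjSum (Finset.range ((inner z T).card - 2))) :
    (testPoly m z v T e).natDegree ≤ n := by
  cases e with
  | inl i =>
    rw [testPoly, Sum.elim_inl, natDegree_prod_X_sub_C]
    have := Finset.card_erase_le (s := outer m z T) (a := i)
    omega
  | inr k =>
    rw [Finset.inr_mem_disjSum, Finset.mem_range] at he
    refine Polynomial.natDegree_mul_le.trans ?_
    rw [natDegree_prod_X_sub_C, Polynomial.natDegree_X_pow]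
    omega

theorem isFill_of_cubic_design (K : Type*) [Field K] [CharZero K] {n m : ℕ} {z : ℕ → ℕ}
    (hz : ∀ b, z b ≤ 15) {τ : Finset ℕ → ℕ}
    (hN : z 0 + ∑ b ∈ Finset.Icc 1 m, z b = n + 3)
    (hτ : ∀ T ⊆ Finset.Icc 1 m, τ T ≠ 0 → 3 ≤ (inner z T).card)
    (hcheck : ∀ S ⊆ Finset.Icc 1 m, S.card ≤ 3 → ∃ β : List ℕ, β.Nodup ∧ β.toFinset = S ∧
      cubicFillCheck (z 0) (τ S) (localBlocks z τ β) = true) :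
    IsFill K (∑ T ∈ (Finset.Icc 1 m).powerset, τ T) n 3 := by
  obtain ⟨v, hv⟩ := exists_linearIndependent_cubic_cols K hz hcheck
  obtain ⟨f, hf, hmem⟩ := exists_tangentSum (n := n) (card_tiles m τ) (fun _ => Finset.range 3)
    (fun _ => Finset.card_range 3) (fun p l => curveForm (cubicPoly m z v p.1.1 p.1.2 l))
    (fun p l => isHomogeneous_linearForm _)
  refine ⟨f, hf, ?_⟩
  have := finiteDimensional_tangentSum hf
  have h := card_le_finrank_of_cols (tangentSum K f)
    (w := fun r : cubicGlobalRows m z τ => curveForm (cubicPoly m z v r.1.1 r.1.2.1 r.1.2.2.2) *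
      curveForm (cubicPoly m z v r.1.1 r.1.2.1 ((r.1.2.2.2 + 1) % 3)) *
      curveForm (testPoly m z v r.1.1 r.1.2.2.1)) ?_
    (fun σ : globalCols 3 m z => polarization n (v ∘ Sum.inl) σ) ?_
  · rwa [Fintype.card_coe, card_globalCols hz, hN] at h
  · rintro ⟨⟨T, t, e, l⟩, hr⟩
    obtain ⟨hT, ht, -, hl⟩ := mem_cubicGlobalRows.1 hr
    have hl' : (l + 2) % 3 ∈ Finset.range 3 := Finset.mem_range.2 (Nat.mod_lt _ (by norm_num))
    have herase : (Finset.range 3).erase ((l + 2) % 3) = {l, (l + 1) % 3} := by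
      interval_cases l <;> decide
    have hprod := hmem ⟨⟨T, t⟩, mem_tiles.2 ⟨hT, ht⟩⟩ _ hl' (curveForm (testPoly m z v T e))
      (isHomogeneous_linearForm _)
    rwa [herase, Finset.prod_pair (by omega)] at hprod
  · convert hv using 3 with σ r
    obtain ⟨⟨T, t, e, l⟩, hr⟩ := r
    obtain ⟨hT, ht, he, hl⟩ := mem_cubicGlobalRows.1 hr
    have h3 := hτ T hT (by omega)
    have hN' := (card_outer_add_card_inner hz hT).trans hN
    rw [polarization_mul _ (Finset.mem_powersetCard.1 σ.2).2
      (natDegree_cubicPoly_le hN' h3 v _ _) (natDegree_cubicPoly_le hN' h3 v _ _)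
      (natDegree_testPoly_le hN' h3 v he)]
    simp only [Function.comp, eval_cubicPoly, eval_testPoly]
    rfl

/-! ### Block patterns -/

/-- Block sizes: block `0` has size `o`, block `1` has size `p`, all others have size `q`. -/
def patternSize (o p q b : ℕ) : ℕ := if b = 0 then o else if b = 1 then p else q

/-- Tile counts depending only on the number of blocks and on whether block `1` is involved. -/
def tileCount (A B : List ℕ) (T : Finset ℕ) : ℕ :=
  if 1 ∈ T then B.getD T.card 0 else A.getD T.card 0

/-- The local conditions making `patternSize` and `tileCount` into a design. -/
structure IsPattern (n o p q : ℕ) (A B : List ℕ) (chk : ℕ → List (ℕ × ℕ) → Bool) : Prop where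
  size_le : n ≤ 3 ∧ o ≤ 15 ∧ p ≤ 15 ∧ q ≤ 15
  length_le : A.length ≤ n ∧ B.length ≤ n
  large : ∀ k < n, A.getD k 0 ≠ 0 → n ≤ o + q * k
  large_special : ∀ k < n, B.getD (k + 1) 0 ≠ 0 → n ≤ o + p + q * k
  check : ∀ k ≤ n, chk (A.getD k 0) (List.replicate k (q, A.getD (k - 1) 0)) = true
  check_special : ∀ k < n,
    chk (B.getD (k + 1) 0) ((p, A.getD k 0) :: List.replicate k (q, B.getD k 0)) = true

/-- A pattern without special block. -/
theorem IsPattern.uniform {n o q : ℕ} {A : List ℕ} {chk : ℕ → List (ℕ × ℕ) → Bool}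
    (hn : n ≤ 3) (ho : o ≤ 15) (hq : q ≤ 15) (hA : A.length ≤ n)
    (large : ∀ k ≤ n, A.getD k 0 ≠ 0 → n ≤ o + q * k)
    (check : ∀ k ≤ n, chk (A.getD k 0) (List.replicate k (q, A.getD (k - 1) 0)) = true) :
    IsPattern n o q q A A chk where
  size_le := ⟨hn, ho, hq, hq⟩
  length_le := ⟨hA, hA⟩
  large k hk := large k hk.le
  large_special k hk h := by
    have := large (k + 1) hk h
    rw [mul_add] at this
    omega
  check := check
  check_special k hk := by simpa [List.replicate_succ] using check (k + 1) hk

theorem sum_patternSize_succ (o p q M : ℕ) :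
    patternSize o p q 0 + ∑ b ∈ Finset.Icc 1 (M + 1), patternSize o p q b = o + p + q * M := by
  induction M with
  | zero => simp [patternSize]
  | succ M ih =>
    rw [Finset.sum_Icc_succ_top (by omega), ← add_assoc, ih]
    simp [patternSize, mul_add, add_assoc]

theorem sum_patternSize_uniform (o q m : ℕ) :
    patternSize o q q 0 + ∑ b ∈ Finset.Icc 1 m, patternSize o q q b = o + q * m := by
  cases m with
  | zero => simp [patternSize]
  | succ M => rw [sum_patternSize_succ, mul_add]; omega

theorem getD_eq_zero {A : List ℕ} {k : ℕ} (h : A.length ≤ k) : A.getD k 0 = 0 := by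
  simp [List.getD, List.getElem?_eq_none h]

theorem sum_powerset_getD {A : List ℕ} (hA : A.length ≤ 3) (s : Finset ℕ) :
    ∑ T ∈ s.powerset, A.getD T.card 0 =
      A.getD 0 0 + s.card * A.getD 1 0 + s.card.choose 2 * A.getD 2 0 := by
  rw [Finset.sum_powerset_apply_card (fun k => A.getD k 0)]
  simp only [smul_eq_mul]
  have hsub : ∑ k ∈ Finset.range (s.card + 1), s.card.choose k * A.getD k 0 =
      ∑ k ∈ Finset.range (s.card + 3), s.card.choose k * A.getD k 0 := by
    refine Finset.sum_subset (Finset.range_subset_range.2 (by omega)) fun k _ hk => ?_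
    rw [Finset.mem_range, not_lt] at hk
    rw [Nat.choose_eq_zero_of_lt hk, zero_mul]
  rw [hsub, ← Finset.sum_subset (Finset.range_subset_range.2 (show 3 ≤ s.card + 3 by omega))
    fun k _ hk => ?_]
  · simp [Finset.sum_range_succ]
  · rw [Finset.mem_range, not_lt] at hk
    rw [getD_eq_zero (hA.trans hk), mul_zero]

theorem sum_tileCount_uniform {A : List ℕ} (hA : A.length ≤ 3) (m : ℕ) :
    ∑ T ∈ (Finset.Icc 1 m).powerset, tileCount A A T =
      A.getD 0 0 + m * A.getD 1 0 + m.choose 2 * A.getD 2 0 := by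
  simpa [tileCount] using sum_powerset_getD hA (Finset.Icc 1 m)

theorem sum_tileCount_succ {A B : List ℕ} (hA : A.length ≤ 3) (hB : B.length ≤ 3) (M : ℕ) :
    ∑ T ∈ (Finset.Icc 1 (M + 1)).powerset, tileCount A B T =
      A.getD 0 0 + B.getD 1 0 + M * (A.getD 1 0 + B.getD 2 0) + M.choose 2 * A.getD 2 0 := by
  have hIcc : Finset.Icc 1 (M + 1) = insert 1 (Finset.Icc 2 (M + 1)) := by
    ext; simp only [Finset.mem_Icc, Finset.mem_insert]; omega
  have hmem : 1 ∉ Finset.Icc 2 (M + 1) := by simp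
  have hcard : (Finset.Icc 2 (M + 1)).card = M := by simp
  have h1 : ∀ T ∈ (Finset.Icc 2 (M + 1)).powerset, 1 ∉ T := fun T hT h =>
    hmem (Finset.mem_powerset.1 hT h)
  have htail : ∀ k, B.getD (k + 1) 0 = B.tail.getD k 0 := fun k => by cases B <;> simp
  rw [hIcc, Finset.sum_powerset_insert hmem,
    Finset.sum_congr rfl fun T hT => show tileCount A B T = A.getD T.card 0 by
      rw [tileCount, if_neg (h1 T hT)],
    Finset.sum_congr rfl fun T hT => show tileCount A B (insert 1 T) = B.tail.getD T.card 0 by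
      rw [tileCount, if_pos (Finset.mem_insert_self _ _),
        Finset.card_insert_of_notMem (h1 T hT), htail],
    sum_powerset_getD hA, sum_powerset_getD (by simp; omega), hcard, ← htail, ← htail,
    getD_eq_zero (show B.tail.length ≤ 2 by simp; omega)]
  ring

namespace IsPattern
variable {n o p q : ℕ} {A B : List ℕ} {chk : ℕ → List (ℕ × ℕ) → Bool}

theorem patternSize_le (h : IsPattern n o p q A B chk) (b : ℕ) : patternSize o p q b ≤ 15 := by
  have := h.size_le
  unfold patternSize
  split_ifs <;> omega

theorem card_lt (h : IsPattern n o p q A B chk) (T : Finset ℕ) (hT : tileCount A B T ≠ 0) :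
    T.card < n := by
  by_contra! hlt
  refine hT ?_
  rw [tileCount, getD_eq_zero (h.length_le.1.trans hlt), getD_eq_zero (h.length_le.2.trans hlt),
    ite_self]

theorem le_card_inner (h : IsPattern n o p q A B chk) {m : ℕ} (T : Finset ℕ)
    (hT : T ⊆ Finset.Icc 1 m) (hτ : tileCount A B T ≠ 0) :
    n ≤ (inner (patternSize o p q) T).card := by
  have h0 : 0 ∉ T := fun h0 => by simpa using hT h0
  have hlt := h.card_lt T hτ
  have hrest : ∀ U : Finset ℕ, 0 ∉ U → 1 ∉ U → ∑ b ∈ U, patternSize o p q b = q * U.card :=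
    fun U h0 h1 => by
      rw [Finset.sum_congr rfl fun b hb => show patternSize o p q b = q by
        simp [patternSize, ne_of_mem_of_not_mem hb h0, ne_of_mem_of_not_mem hb h1],
        Finset.sum_const, smul_eq_mul, mul_comm]
  rw [card_inner h.patternSize_le h0, show patternSize o p q 0 = o from rfl]
  by_cases h1 : 1 ∈ T
  · have hcard := Finset.card_erase_add_one h1
    rw [tileCount, if_pos h1, ← hcard] at hτ
    rw [← Finset.add_sum_erase _ _ h1, hrest _ (fun h => h0 (Finset.mem_of_mem_erase h))
      (Finset.notMem_erase _ _), ← add_assoc]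
    exact h.large_special _ (by omega) hτ
  · rw [tileCount, if_neg h1] at hτ
    rw [hrest T h0 h1]
    exact h.large _ hlt hτ

theorem exists_list (h : IsPattern n o p q A B chk) {m : ℕ} (S : Finset ℕ)
    (hS : S ⊆ Finset.Icc 1 m) (hcard : S.card ≤ n) :
    ∃ β : List ℕ, β.Nodup ∧ β.toFinset = S ∧
      chk (tileCount A B S) (localBlocks (patternSize o p q) (tileCount A B) β) = true := by
  have h0 : 0 ∉ S := fun h0 => by simpa using hS h0
  have hsize : ∀ b ∈ S, b ≠ 1 → patternSize o p q b = q := fun b hb h1 => by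
    simp [patternSize, ne_of_mem_of_not_mem hb h0, h1]
  by_cases h1 : 1 ∈ S
  · have hcard' := Finset.card_erase_add_one h1
    have hset : (1 :: (S.erase 1).toList).toFinset = S := by
      rw [List.toFinset_cons, Finset.toList_toFinset, Finset.insert_erase h1]
    refine ⟨1 :: (S.erase 1).toList, List.nodup_cons.2 ⟨by simp, Finset.nodup_toList _⟩, hset, ?_⟩
    have := h.check_special (S.erase 1).card (by omega)
    convert this using 2
    · rw [tileCount, if_pos h1, hcard']
    · rw [localBlocks, hset, List.map_cons]
      congr 1
      · simp [patternSize, tileCount]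
      · rw [List.eq_replicate_iff]
        refine ⟨by simp, fun x hx => ?_⟩
        obtain ⟨b, hb, rfl⟩ := List.mem_map.1 hx
        rw [Finset.mem_toList, Finset.mem_erase] at hb
        rw [hsize b hb.2 hb.1, tileCount, if_pos (Finset.mem_erase.2 ⟨hb.1.symm, h1⟩),
          Finset.card_erase_of_mem hb.2, Finset.card_erase_of_mem h1]
  · refine ⟨S.toList, Finset.nodup_toList _, Finset.toList_toFinset _, ?_⟩
    convert h.check S.card hcard using 2
    · rw [tileCount, if_neg h1]
    · rw [localBlocks, Finset.toList_toFinset, List.eq_replicate_iff]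
      refine ⟨by simp, fun x hx => ?_⟩
      obtain ⟨b, hb, rfl⟩ := List.mem_map.1 hx
      rw [Finset.mem_toList] at hb
      rw [hsize b hb fun e => h1 (e ▸ hb), tileCount,
        if_neg fun e => h1 (Finset.mem_of_mem_erase e), Finset.card_erase_of_mem hb]

end IsPattern

theorem isFill_of_pattern (K : Type*) [Field K] [CharZero K] {n d o p q M : ℕ} {A B : List ℕ}
    (h : IsPattern n o p q A B (pointFillCheck n o)) (hd : 1 ≤ d) (hN : o + p + q * M = n + d) :
    IsFill K (A.getD 0 0 + B.getD 1 0 + M * (A.getD 1 0 + B.getD 2 0) +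
      M.choose 2 * A.getD 2 0) n d := by
  rw [← sum_tileCount_succ (h.length_le.1.trans h.size_le.1) (h.length_le.2.trans h.size_le.1)]
  exact isFill_of_design K h.size_le.1 h.patternSize_le hd ((sum_patternSize_succ o p q M).trans hN)
    h.le_card_inner h.exists_list

theorem isFill_of_uniform_pattern (K : Type*) [Field K] [CharZero K] {n d o q m : ℕ} {A : List ℕ}
    (h : IsPattern n o q q A A (pointFillCheck n o)) (hd : 1 ≤ d) (hN : o + q * m = n + d) :
    IsFill K (A.getD 0 0 + m * A.getD 1 0 + m.choose 2 * A.getD 2 0) n d := by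
  rw [← sum_tileCount_uniform (h.length_le.1.trans h.size_le.1)]
  exact isFill_of_design K h.size_le.1 h.patternSize_le hd
    ((sum_patternSize_uniform o q m).trans hN)
    h.le_card_inner h.exists_list

theorem isSub_of_pattern (K : Type*) [Field K] [CharZero K] {n d o p q M : ℕ} {A B : List ℕ}
    (h : IsPattern n o p q A B (pointSubCheck n o)) (hd : 1 ≤ d) (hN : o + p + q * M = n + d) :
    IsSub K (A.getD 0 0 + B.getD 1 0 + M * (A.getD 1 0 + B.getD 2 0) +
      M.choose 2 * A.getD 2 0) n d := by
  rw [← sum_tileCount_succ (h.length_le.1.trans h.size_le.1) (h.length_le.2.trans h.size_le.1)]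
  exact isSub_of_design K h.size_le.1 h.patternSize_le hd ((sum_patternSize_succ o p q M).trans hN)
    h.le_card_inner h.card_lt h.exists_list

theorem isSub_of_uniform_pattern (K : Type*) [Field K] [CharZero K] {n d o q m : ℕ} {A : List ℕ}
    (h : IsPattern n o q q A A (pointSubCheck n o)) (hd : 1 ≤ d) (hN : o + q * m = n + d) :
    IsSub K (A.getD 0 0 + m * A.getD 1 0 + m.choose 2 * A.getD 2 0) n d := by
  rw [← sum_tileCount_uniform (h.length_le.1.trans h.size_le.1)]
  exact isSub_of_design K h.size_le.1 h.patternSize_le hd ((sum_patternSize_uniform o q m).trans hN)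
    h.le_card_inner h.card_lt h.exists_list

theorem isFill_of_cubic_pattern (K : Type*) [Field K] [CharZero K] {n o p q M : ℕ}
    {A B : List ℕ} (h : IsPattern 3 o p q A B (cubicFillCheck o)) (hN : o + p + q * M = n + 3) :
    IsFill K (A.getD 0 0 + B.getD 1 0 + M * (A.getD 1 0 + B.getD 2 0) +
      M.choose 2 * A.getD 2 0) n 3 := by
  rw [← sum_tileCount_succ h.length_le.1 h.length_le.2]
  exact isFill_of_cubic_design K h.patternSize_le ((sum_patternSize_succ o p q M).trans hN)
    h.le_card_inner h.exists_list

theorem isFill_of_uniform_cubic_pattern (K : Type*) [Field K] [CharZero K] {n o q m : ℕ}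
    {A : List ℕ} (h : IsPattern 3 o q q A A (cubicFillCheck o)) (hN : o + q * m = n + 3) :
    IsFill K (A.getD 0 0 + m * A.getD 1 0 + m.choose 2 * A.getD 2 0) n 3 := by
  rw [← sum_tileCount_uniform h.length_le.1]
  exact isFill_of_cubic_design K h.patternSize_le ((sum_patternSize_uniform o q m).trans hN)
    h.le_card_inner h.exists_list

/-! ### The patterns used -/

theorem forall_le_one {P : ℕ → Prop} (h0 : P 0) (h1 : P 1) : ∀ k ≤ 1, P k := by
  intro k hk
  interval_cases k <;> assumption

theorem forall_le_two {P : ℕ → Prop} (h0 : P 0) (h1 : P 1) (h2 : P 2) : ∀ k ≤ 2, P k := by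
  intro k hk
  interval_cases k <;> assumption

theorem forall_le_three {P : ℕ → Prop} (h0 : P 0) (h1 : P 1) (h2 : P 2) (h3 : P 3) :
    ∀ k ≤ 3, P k := by
  intro k hk
  interval_cases k <;> assumption

theorem forall_lt_three {P : ℕ → Prop} (h0 : P 0) (h1 : P 1) (h2 : P 2) : ∀ k < 3, P k := by
  intro k hk
  interval_cases k <;> assumption

set_option maxRecDepth 100000

theorem lineFill : IsPattern 1 1 1 1 [1] [1] (pointFillCheck 1 1) :=
  .uniform (by decide) (by decide) (by decide) (by decide) (by decide) (forall_le_one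
    (show pointFillCheck 1 1 1 [] = true by decide +kernel)
    (show pointFillCheck 1 1 0 [(1, 1)] = true by decide +kernel))

theorem planeSub_zero : IsPattern 2 0 4 4 [0, 1] [0, 1] (pointSubCheck 2 0) :=
  .uniform (by decide) (by decide) (by decide) (by decide) (by decide) (forall_le_two
    (show pointSubCheck 2 0 0 [] = true by decide +kernel)
    (show pointSubCheck 2 0 1 [(4, 0)] = true by decide +kernel)
    (show pointSubCheck 2 0 0 [(4, 1), (4, 1)] = true by decide +kernel))

theorem planeSub_one : IsPattern 2 1 4 4 [0, 1] [0, 1] (pointSubCheck 2 1) :=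
  .uniform (by decide) (by decide) (by decide) (by decide) (by decide) (forall_le_two
    (show pointSubCheck 2 1 0 [] = true by decide +kernel)
    (show pointSubCheck 2 1 1 [(4, 0)] = true by decide +kernel)
    (show pointSubCheck 2 1 0 [(4, 1), (4, 1)] = true by decide +kernel))

theorem planeSub_two : IsPattern 2 2 4 4 [0, 1] [0, 1] (pointSubCheck 2 2) :=
  .uniform (by decide) (by decide) (by decide) (by decide) (by decide) (forall_le_two
    (show pointSubCheck 2 2 0 [] = true by decide +kernel)
    (show pointSubCheck 2 2 1 [(4, 0)] = true by decide +kernel)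
    (show pointSubCheck 2 2 0 [(4, 1), (4, 1)] = true by decide +kernel))

theorem planeSub_three : IsPattern 2 3 4 4 [0, 1] [0, 1] (pointSubCheck 2 3) :=
  .uniform (by decide) (by decide) (by decide) (by decide) (by decide) (forall_le_two
    (show pointSubCheck 2 3 0 [] = true by decide +kernel)
    (show pointSubCheck 2 3 1 [(4, 0)] = true by decide +kernel)
    (show pointSubCheck 2 3 0 [(4, 1), (4, 1)] = true by decide +kernel))

theorem planeFill_two : IsPattern 2 2 4 4 [1, 1] [1, 1] (pointFillCheck 2 2) :=
  .uniform (by decide) (by decide) (by decide) (by decide) (by decide) (forall_le_two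
    (show pointFillCheck 2 2 1 [] = true by decide +kernel)
    (show pointFillCheck 2 2 1 [(4, 1)] = true by decide +kernel)
    (show pointFillCheck 2 2 0 [(4, 1), (4, 1)] = true by decide +kernel))

theorem planeFill_three : IsPattern 2 3 4 4 [1, 1] [1, 1] (pointFillCheck 2 3) :=
  .uniform (by decide) (by decide) (by decide) (by decide) (by decide) (forall_le_two
    (show pointFillCheck 2 3 1 [] = true by decide +kernel)
    (show pointFillCheck 2 3 1 [(4, 1)] = true by decide +kernel)
    (show pointFillCheck 2 3 0 [(4, 1), (4, 1)] = true by decide +kernel))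

theorem planeFill_four : IsPattern 2 4 4 4 [2, 1] [2, 1] (pointFillCheck 2 4) :=
  .uniform (by decide) (by decide) (by decide) (by decide) (by decide) (forall_le_two
    (show pointFillCheck 2 4 2 [] = true by decide +kernel)
    (show pointFillCheck 2 4 1 [(4, 2)] = true by decide +kernel)
    (show pointFillCheck 2 4 0 [(4, 1), (4, 1)] = true by decide +kernel))

theorem planeFill_five : IsPattern 2 5 4 4 [2, 1] [2, 1] (pointFillCheck 2 5) :=
  .uniform (by decide) (by decide) (by decide) (by decide) (by decide) (forall_le_two
    (show pointFillCheck 2 5 2 [] = true by decide +kernel)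
    (show pointFillCheck 2 5 1 [(4, 2)] = true by decide +kernel)
    (show pointFillCheck 2 5 0 [(4, 1), (4, 1)] = true by decide +kernel))

theorem spaceFill_threes : IsPattern 3 1 3 3 [0, 1, 1] [0, 1, 1] (pointFillCheck 3 1) :=
  .uniform (by decide) (by decide) (by decide) (by decide) (by decide) (forall_le_three
    (show pointFillCheck 3 1 0 [] = true by decide +kernel)
    (show pointFillCheck 3 1 1 [(3, 0)] = true by decide +kernel)
    (show pointFillCheck 3 1 1 [(3, 1), (3, 1)] = true by decide +kernel)
    (show pointFillCheck 3 1 0 [(3, 1), (3, 1), (3, 1)] = true by decide +kernel))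

theorem spaceFill_sixes : IsPattern 3 0 6 6 [0, 2, 4] [0, 2, 4] (pointFillCheck 3 0) :=
  .uniform (by decide) (by decide) (by decide) (by decide) (by decide) (forall_le_three
    (show pointFillCheck 3 0 0 [] = true by decide +kernel)
    (show pointFillCheck 3 0 2 [(6, 0)] = true by decide +kernel)
    (show pointFillCheck 3 0 4 [(6, 2), (6, 2)] = true by decide +kernel)
    (show pointFillCheck 3 0 0 [(6, 4), (6, 4), (6, 4)] = true by decide +kernel))

theorem spaceFill_sixes_two : IsPattern 3 0 2 6 [0, 2, 4] [0, 0, 2] (pointFillCheck 3 0) where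
  size_le := by decide
  length_le := by decide
  large := by decide
  large_special := by decide
  check := spaceFill_sixes.check
  check_special := forall_lt_three
    (show pointFillCheck 3 0 0 [(2, 0)] = true by decide +kernel)
    (show pointFillCheck 3 0 2 [(2, 2), (6, 0)] = true by decide +kernel)
    (show pointFillCheck 3 0 0 [(2, 4), (6, 2), (6, 2)] = true by decide +kernel)

theorem spaceFill_sixes_three : IsPattern 3 0 3 6 [0, 2, 4] [0, 1, 2] (pointFillCheck 3 0) where
  size_le := by decide
  length_le := by decide
  large := by decide
  large_special := by decide
  check := spaceFill_sixes.check
  check_special := forall_lt_three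
    (show pointFillCheck 3 0 1 [(3, 0)] = true by decide +kernel)
    (show pointFillCheck 3 0 2 [(3, 2), (6, 1)] = true by decide +kernel)
    (show pointFillCheck 3 0 0 [(3, 4), (6, 2), (6, 2)] = true by decide +kernel)

theorem spaceFill_sixes_five : IsPattern 3 0 5 6 [0, 2, 4] [0, 2, 4] (pointFillCheck 3 0) where
  size_le := by decide
  length_le := by decide
  large := by decide
  large_special := by decide
  check := spaceFill_sixes.check
  check_special := forall_lt_three
    (show pointFillCheck 3 0 2 [(5, 0)] = true by decide +kernel)
    (show pointFillCheck 3 0 4 [(5, 2), (6, 2)] = true by decide +kernel)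
    (show pointFillCheck 3 0 0 [(5, 4), (6, 4), (6, 4)] = true by decide +kernel)

theorem spaceSub_threes_two : IsPattern 3 2 3 3 [0, 1, 1] [0, 1, 1] (pointSubCheck 3 2) :=
  .uniform (by decide) (by decide) (by decide) (by decide) (by decide) (forall_le_three
    (show pointSubCheck 3 2 0 [] = true by decide +kernel)
    (show pointSubCheck 3 2 1 [(3, 0)] = true by decide +kernel)
    (show pointSubCheck 3 2 1 [(3, 1), (3, 1)] = true by decide +kernel)
    (show pointSubCheck 3 2 0 [(3, 1), (3, 1), (3, 1)] = true by decide +kernel))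

theorem spaceSub_threes_three : IsPattern 3 3 3 3 [1, 1, 1] [1, 1, 1] (pointSubCheck 3 3) :=
  .uniform (by decide) (by decide) (by decide) (by decide) (by decide) (forall_le_three
    (show pointSubCheck 3 3 1 [] = true by decide +kernel)
    (show pointSubCheck 3 3 1 [(3, 1)] = true by decide +kernel)
    (show pointSubCheck 3 3 1 [(3, 1), (3, 1)] = true by decide +kernel)
    (show pointSubCheck 3 3 0 [(3, 1), (3, 1), (3, 1)] = true by decide +kernel))

theorem spaceSub_sixes : IsPattern 3 1 6 6 [0, 2, 4] [0, 2, 4] (pointSubCheck 3 1) :=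
  .uniform (by decide) (by decide) (by decide) (by decide) (by decide) (forall_le_three
    (show pointSubCheck 3 1 0 [] = true by decide +kernel)
    (show pointSubCheck 3 1 2 [(6, 0)] = true by decide +kernel)
    (show pointSubCheck 3 1 4 [(6, 2), (6, 2)] = true by decide +kernel)
    (show pointSubCheck 3 1 0 [(6, 4), (6, 4), (6, 4)] = true by decide +kernel))

theorem spaceSub_sixes_three : IsPattern 3 1 3 6 [0, 2, 4] [0, 0, 2] (pointSubCheck 3 1) where
  size_le := by decide
  length_le := by decide
  large := by decide
  large_special := by decide
  check := spaceSub_sixes.check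
  check_special := forall_lt_three
    (show pointSubCheck 3 1 0 [(3, 0)] = true by decide +kernel)
    (show pointSubCheck 3 1 2 [(3, 2), (6, 0)] = true by decide +kernel)
    (show pointSubCheck 3 1 0 [(3, 4), (6, 2), (6, 2)] = true by decide +kernel)

theorem cubicFill_threes : IsPattern 3 1 3 3 [0, 1, 1] [0, 1, 1] (cubicFillCheck 1) :=
  .uniform (by decide) (by decide) (by decide) (by decide) (by decide) (forall_le_three
    (show cubicFillCheck 1 0 [] = true by decide +kernel)
    (show cubicFillCheck 1 1 [(3, 0)] = true by decide +kernel)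
    (show cubicFillCheck 1 1 [(3, 1), (3, 1)] = true by decide +kernel)
    (show cubicFillCheck 1 0 [(3, 1), (3, 1), (3, 1)] = true by decide +kernel))

theorem cubicFill_sixes : IsPattern 3 0 6 6 [0, 2, 4] [0, 2, 4] (cubicFillCheck 0) :=
  .uniform (by decide) (by decide) (by decide) (by decide) (by decide) (forall_le_three
    (show cubicFillCheck 0 0 [] = true by decide +kernel)
    (show cubicFillCheck 0 2 [(6, 0)] = true by decide +kernel)
    (show cubicFillCheck 0 4 [(6, 2), (6, 2)] = true by decide +kernel)
    (show cubicFillCheck 0 0 [(6, 4), (6, 4), (6, 4)] = true by decide +kernel))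

theorem cubicFill_sixes_two : IsPattern 3 0 2 6 [0, 2, 4] [0, 0, 2] (cubicFillCheck 0) where
  size_le := by decide
  length_le := by decide
  large := by decide
  large_special := by decide
  check := cubicFill_sixes.check
  check_special := forall_lt_three
    (show cubicFillCheck 0 0 [(2, 0)] = true by decide +kernel)
    (show cubicFillCheck 0 2 [(2, 2), (6, 0)] = true by decide +kernel)
    (show cubicFillCheck 0 0 [(2, 4), (6, 2), (6, 2)] = true by decide +kernel)

theorem cubicFill_sixes_five : IsPattern 3 0 5 6 [0, 2, 4] [0, 2, 4] (cubicFillCheck 0) where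
  size_le := by decide
  length_le := by decide
  large := by decide
  large_special := by decide
  check := cubicFill_sixes.check
  check_special := forall_lt_three
    (show cubicFillCheck 0 2 [(5, 0)] = true by decide +kernel)
    (show cubicFillCheck 0 4 [(5, 2), (6, 2)] = true by decide +kernel)
    (show cubicFillCheck 0 0 [(5, 4), (6, 4), (6, 4)] = true by decide +kernel)

theorem cubicFill_sixes_nine : IsPattern 3 0 9 6 [0, 2, 4] [0, 5, 6] (cubicFillCheck 0) where
  size_le := by decide
  length_le := by decide
  large := by decide
  large_special := by decide
  check := cubicFill_sixes.check
  check_special := forall_lt_three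
    (show cubicFillCheck 0 5 [(9, 0)] = true by decide +kernel)
    (show cubicFillCheck 0 6 [(9, 2), (6, 5)] = true by decide +kernel)
    (show cubicFillCheck 0 0 [(9, 4), (6, 6), (6, 6)] = true by decide +kernel)

/-! ### Monotonicity and degenerate cases -/

theorem IsFill.mono {K : Type*} [Field K] {s s' n d : ℕ} (h : IsFill K s n d) (hs : s ≤ s') :
    IsFill K s' n d := by
  obtain ⟨f, hf, h⟩ := h
  have hf' : ∀ (i : Fin s') (j : Fin d),
      ((if hi : (i : ℕ) < s then f ⟨i, hi⟩ else fun _ => 0) j).IsHomogeneous 1 := fun i j => by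
    split_ifs
    · exact hf _ _
    · exact isHomogeneous_zero _ _ _
  refine ⟨_, hf', h.trans ?_⟩
  have := finiteDimensional_tangentSum hf'
  refine Submodule.finrank_mono (iSup_le fun i => ?_)
  refine le_trans ?_ (le_iSup _ (Fin.castLE hs i))
  simp

theorem IsSub.anti {K : Type*} [Field K] {s s' n d : ℕ} (hd : 1 ≤ d) (h : IsSub K s' n d)
    (hs : s ≤ s') : IsSub K s n d := by
  obtain ⟨r, rfl⟩ := Nat.exists_eq_add_of_le hs
  obtain ⟨f, hf, h⟩ := h
  refine ⟨fun i => f (Fin.castAdd r i), fun i => hf _, ?_⟩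
  have h1 := finiteDimensional_tangentSum (f := fun i => f (Fin.castAdd r i)) fun i => hf _
  have h2 := finiteDimensional_tangentSum (f := fun i => f (Fin.natAdd s i)) fun i => hf _
  have hle : tangentSum K f ≤ tangentSum K (fun i => f (Fin.castAdd r i)) ⊔
      tangentSum K (fun i => f (Fin.natAdd s i)) := by
    refine iSup_le fun i => ?_
    refine Fin.addCases (fun i => ?_) (fun i => ?_) i
    · exact le_sup_of_le_left (le_iSup (fun i => tangent K (f (Fin.castAdd r i))) i)
    · exact le_sup_of_le_right (le_iSup (fun i => tangent K (f (Fin.natAdd s i))) i)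
  have h3 := (Submodule.finrank_mono hle).trans (Submodule.finrank_add_le_finrank_add_finrank _ _)
  have h4 := (finrank_tangentSum_le hd (f := fun i => f (Fin.natAdd s i)) fun i => hf _).trans
    (min_le_left _ _)
  rw [add_mul] at h
  omega

theorem isFill_of_degree_one (K : Type*) [Field K] (n : ℕ) : IsFill K 1 n 1 := by
  have hf : ∀ (i : Fin 1) (j : Fin 1), (0 : MvPolynomial (Fin (n + 1)) K).IsHomogeneous 1 :=
    fun _ _ => isHomogeneous_zero _ _ _
  refine ⟨_, hf, ?_⟩
  have := finiteDimensional_tangentSum hf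
  rw [← finrank_homogeneousSubmodule K]
  refine Submodule.finrank_mono fun g hg => Submodule.mem_iSup_of_mem 0 ?_
  simpa using mul_mem_tangent (f := fun _ : Fin 1 => (0 : MvPolynomial (Fin (n + 1)) K)) 0 hg

theorem isFill_of_degree_two (K : Type*) [Field K] {s n : ℕ} (hn : n < 2 * s) :
    IsFill K s n 2 := by
  have hf : ∀ (i : Fin s) (j : Fin 2),
      (if h : 2 * (i : ℕ) + j < n + 1 then X ⟨2 * i + j, h⟩ else 0 :
        MvPolynomial (Fin (n + 1)) K).IsHomogeneous 1 := fun i j => by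
    split_ifs
    · exact isHomogeneous_X _ _
    · exact isHomogeneous_zero _ _ _
  refine ⟨_, hf, ?_⟩
  have := finiteDimensional_tangentSum hf
  have hX : ∀ (k : Fin (n + 1)) {g : MvPolynomial (Fin (n + 1)) K}, g.IsHomogeneous 1 →
      X k * g ∈ tangentSum K fun (i : Fin s) (j : Fin 2) =>
        (if h : 2 * (i : ℕ) + j < n + 1 then X ⟨2 * i + j, h⟩ else 0 :
          MvPolynomial (Fin (n + 1)) K) := by
    intro k g hg
    refine Submodule.mem_iSup_of_mem ⟨k / 2, by omega⟩ ?_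
    rcases Nat.mod_two_eq_zero_or_one k with hk | hk
    · convert mul_mem_tangent (1 : Fin 2) hg using 2
      rw [show Finset.univ.erase (1 : Fin 2) = {0} by decide, Finset.prod_singleton]
      beta_reduce
      rw [dif_pos]
      · congr 1
        ext
        simp
        omega
      · simp
        omega
    · convert mul_mem_tangent (0 : Fin 2) hg using 2
      rw [show Finset.univ.erase (0 : Fin 2) = {1} by decide, Finset.prod_singleton]
      beta_reduce
      rw [dif_pos]
      · congr 1
        ext
        simp
        omega
      · simp
        omega
  rw [← finrank_homogeneousSubmodule K]
  refine Submodule.finrank_mono fun g hg => ?_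
  rw [g.as_sum]
  refine Submodule.sum_mem _ fun e he => ?_
  have hdeg := hg (mem_support_iff.1 he)
  obtain ⟨k, hk⟩ : ∃ k, e k ≠ 0 := by
    by_contra! h0
    rw [show e = 0 from Finsupp.ext h0] at hdeg
    simp at hdeg
  have hadd : Finsupp.single k 1 + (e - Finsupp.single k 1) = e :=
    add_tsub_cancel_of_le (Finsupp.single_le_iff.2 (Nat.one_le_iff_ne_zero.2 hk))
  have hmon : monomial e (coeff e g) = X k * monomial (e - Finsupp.single k 1) (coeff e g) := by
    rw [X, monomial_mul, one_mul, hadd]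
  rw [hmon]
  refine hX k (isHomogeneous_monomial _ ?_)
  rw [← hadd] at hdeg
  simp [Finsupp.weight_apply, Finsupp.sum_add_index', Finsupp.degree_eq_weight_one] at hdeg ⊢
  omega

/-! ### Adding a variable -/

theorem eq_zero_of_forall_linear {K : Type*} [Field K] {n : ℕ} (hn : 1 ≤ n) {c : K}
    {f : MvPolynomial (Fin (n + 1)) K}
    (h : ∀ g : MvPolynomial (Fin (n + 1)) K, g.IsHomogeneous 1 → ∃ a : K, c • g = a • f) :
    c = 0 := by
  by_contra hc
  obtain ⟨a, ha⟩ := h (X 0) (isHomogeneous_X _ _)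
  obtain ⟨b, hb⟩ := h (X (Fin.last n)) (isHomogeneous_X _ _)
  have h0 : (0 : Fin (n + 1)) ≠ Fin.last n := by
    rw [Ne, Fin.ext_iff]
    simp
    omega
  have hlin : b • (c • (X 0 : MvPolynomial (Fin (n + 1)) K)) = a • (c • X (Fin.last n)) := by
    rw [ha, hb, smul_comm]
  have hb0 := congrArg (coeff (Finsupp.single 0 1)) hlin
  simp [coeff_X, Finsupp.single_left_inj, h0.symm, hc] at hb0
  rw [hb0, zero_smul, smul_eq_zero] at hb
  exact hb.elim hc (X_ne_zero _)

theorem ne_zero_of_isSub {K : Type*} [Field K] {s n d : ℕ} (hn : 1 ≤ n) (hd : 2 ≤ d)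
    {f : Fin s → Fin d → MvPolynomial (Fin (n + 1)) K} (hf : ∀ i j, (f i j).IsHomogeneous 1)
    (h : s * (d * n + 1) ≤ Module.finrank K (tangentSum K f)) (i : Fin s) (j : Fin d) :
    f i j ≠ 0 := by
  classical
  intro h0
  have hfin : ∀ i, FiniteDimensional K (tangent K (f i)) := fun i =>
    Submodule.finiteDimensional_of_le (tangent_le (hf i))
  have hle : tangentSum K f ≤ tangent K (f i) ⊔ ⨆ k : {k // k ≠ i}, tangent K (f k) := by
    refine iSup_le fun k => ?_
    by_cases hk : k = i
    · exact hk ▸ le_sup_left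
    · exact le_sup_of_le_right (le_iSup (fun k : {k // k ≠ i} => tangent K (f k)) ⟨k, hk⟩)
  have h1 := (Submodule.finrank_mono hle).trans (Submodule.finrank_add_le_finrank_add_finrank _ _)
  have h2 := finrank_iSup_le (fun k : {k // k ≠ i} => tangent K (f k)) fun k =>
    finrank_tangent_le (by omega) (hf k)
  have h3 := finrank_tangent_le_of_eq_zero h0
  rw [Fintype.card_subtype_compl, Fintype.card_subtype_eq, Fintype.card_fin] at h2
  obtain ⟨r, rfl⟩ : ∃ r, s = r + 1 := ⟨s - 1, by have := i.2; omega⟩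
  rw [Nat.add_sub_cancel] at h2
  rw [add_mul] at h
  have : 2 * n ≤ d * n := Nat.mul_le_mul_right n hd
  omega

theorem linearIndependent_prod_erase {K : Type*} [Field K] {s n d : ℕ} (hn : 1 ≤ n) (hd : 2 ≤ d)
    {f : Fin s → Fin d → MvPolynomial (Fin (n + 1)) K} (hf : ∀ i j, (f i j).IsHomogeneous 1)
    (h : s * (d * n + 1) ≤ Module.finrank K (tangentSum K f)) :
    LinearIndependent K fun p : Fin s × Fin d => ∏ m ∈ Finset.univ.erase p.2, f p.1 m := by
  let P : Fin s × Fin d → MvPolynomial (Fin (n + 1)) K :=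
    fun p => ∏ m ∈ Finset.univ.erase p.2, f p.1 m
  let Φ : (Fin s × Fin d → homogeneousSubmodule (Fin (n + 1)) K 1) →ₗ[K]
      MvPolynomial (Fin (n + 1)) K :=
    ∑ p, (LinearMap.mulLeft K (P p)) ∘ₗ Submodule.subtype _ ∘ₗ LinearMap.proj p
  have hΦ : ∀ g, Φ g = ∑ p, P p * (g p : MvPolynomial (Fin (n + 1)) K) := fun g => by
    simp [Φ, LinearMap.sum_apply]
  have hrange : tangentSum K f ≤ LinearMap.range Φ := by
    refine iSup_le fun i => iSup_le fun j => ?_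
    rintro _ ⟨g, hg, rfl⟩
    refine ⟨Pi.single (i, j) ⟨g, hg⟩, ?_⟩
    rw [hΦ, Finset.sum_eq_single (i, j)]
    · simp [P]
    · intro p _ hp
      simp [Pi.single_eq_of_ne hp]
    · simp
  have hker : Module.finrank K (LinearMap.ker Φ) + s ≤ s * d := by
    have h1 := LinearMap.finrank_range_add_finrank_ker Φ
    rw [Module.finrank_pi_fintype, Finset.sum_const, finrank_homogeneousSubmodule,
      Nat.choose_one_right, Finset.card_univ, Fintype.card_prod, Fintype.card_fin,
      Fintype.card_fin, smul_eq_mul] at h1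
    have h2 := h.trans (Submodule.finrank_mono hrange)
    nlinarith
  let S : (Fin s × Fin d → K) →ₗ[K] (Fin s → K) :=
    LinearMap.pi fun i => ∑ j, LinearMap.proj (i, j)
  have hS : ∀ a i, S a i = ∑ j, a (i, j) := fun a i => by simp [S, LinearMap.sum_apply]
  have hZ : s * d ≤ Module.finrank K (LinearMap.ker S) + s := by
    have h1 := LinearMap.finrank_range_add_finrank_ker S
    have h2 := Submodule.finrank_le (LinearMap.range S)
    rw [Module.finrank_fintype_fun_eq_card, Fintype.card_prod, Fintype.card_fin,
      Fintype.card_fin] at h1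
    rw [Module.finrank_fintype_fun_eq_card, Fintype.card_fin] at h2
    omega
  let E : (Fin s × Fin d → K) →ₗ[K] (Fin s × Fin d → homogeneousSubmodule (Fin (n + 1)) K 1) :=
    LinearMap.pi fun p => LinearMap.smulRight (LinearMap.proj p) ⟨f p.1 p.2, hf _ _⟩
  have hE : ∀ a p, (E a p : MvPolynomial (Fin (n + 1)) K) = a p • f p.1 p.2 := fun a p => rfl
  have hne := ne_zero_of_isSub hn hd hf h
  have hinj : Function.Injective E := by
    intro a b hab
    ext p
    have hp : (E a p : MvPolynomial (Fin (n + 1)) K) = E b p := by rw [hab]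
    rw [hE, hE] at hp
    exact smul_left_injective K (hne p.1 p.2) hp
  have hle : (LinearMap.ker S).map E ≤ LinearMap.ker Φ := by
    rintro _ ⟨a, ha, rfl⟩
    rw [LinearMap.mem_ker, hΦ, Fintype.sum_prod_type]
    refine Finset.sum_eq_zero fun i _ => ?_
    have hprod : ∀ j, P (i, j) * (E a (i, j) : MvPolynomial (Fin (n + 1)) K) =
        a (i, j) • ∏ m, f i m := fun j => by
      rw [hE, mul_smul_comm, Finset.prod_erase_mul _ _ (Finset.mem_univ j)]
    simp only [hprod]
    rw [← Finset.sum_smul, ← hS, LinearMap.mem_ker.1 ha, Pi.zero_apply, zero_smul]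
  have heq : (LinearMap.ker S).map E = LinearMap.ker Φ := by
    refine Submodule.eq_of_le_of_finrank_le hle ?_
    rw [← (Submodule.equivMapOfInjective E hinj (LinearMap.ker S)).finrank_eq]
    omega
  rw [Fintype.linearIndependent_iff]
  intro c hc p
  refine eq_zero_of_forall_linear hn (f := f p.1 p.2) fun g hg => ?_
  have hmem : (fun p => c p • ⟨g, hg⟩ : Fin s × Fin d → homogeneousSubmodule (Fin (n + 1)) K 1) ∈
      LinearMap.ker Φ := by
    rw [LinearMap.mem_ker, hΦ]
    have : ∀ p, P p * (c p • (⟨g, hg⟩ : homogeneousSubmodule (Fin (n + 1)) K 1) :) =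
        (c p • P p) * g := fun p => by simp
    simp only [this]
    rw [← Finset.sum_mul, hc, zero_mul]
  rw [← heq] at hmem
  obtain ⟨a, -, ha⟩ := hmem
  exact ⟨a p, by rw [← hE, ha]; rfl⟩

theorem IsSub.succ {K : Type*} [Field K] {s n d : ℕ} (hn : 1 ≤ n) (hd : 2 ≤ d)
    (h : IsSub K s n d) : IsSub K s (n + 1) d := by
  obtain ⟨f, hf, h⟩ := h
  let ρ : MvPolynomial (Fin (n + 1)) K →ₐ[K] MvPolynomial (Fin (n + 1 + 1)) K :=
    rename Fin.castSucc
  have hf' : ∀ i j, (ρ (f i j)).IsHomogeneous 1 := fun i j => (hf i j).rename_isHomogeneous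
  refine ⟨fun i j => ρ (f i j), hf', ?_⟩
  have hli := linearIndependent_prod_erase hn hd hf h
  set P : Fin s × Fin d → MvPolynomial (Fin (n + 1)) K :=
    fun p => ∏ m ∈ Finset.univ.erase p.2, f p.1 m with hP
  have := finiteDimensional_tangentSum hf
  have := finiteDimensional_tangentSum hf'
  let J : tangentSum K f × (Fin s × Fin d → K) →ₗ[K] MvPolynomial (Fin (n + 1 + 1)) K :=
    LinearMap.coprod (ρ.toLinearMap ∘ₗ Submodule.subtype _)
      (LinearMap.mulLeft K (X (Fin.last (n + 1))) ∘ₗ ρ.toLinearMap ∘ₗ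
        Fintype.linearCombination K P)
  have hJ : ∀ u c, J (u, c) = ρ u + X (Fin.last (n + 1)) * ρ (∑ p, c p • P p) := fun u c => rfl
  have hmem : ∀ (p : Fin s × Fin d) {g}, g.IsHomogeneous 1 →
      ρ (P p) * g ∈ tangentSum K fun i j => ρ (f i j) := fun p g hg => by
    rw [hP, map_prod]
    exact Submodule.mem_iSup_of_mem p.1 (mul_mem_tangent p.2 hg)
  have hle : LinearMap.range J ≤ tangentSum K fun i j => ρ (f i j) := by
    rintro _ ⟨⟨u, c⟩, rfl⟩
    rw [hJ]
    refine Submodule.add_mem _ ?_ ?_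
    · have hu : tangentSum K f ≤ (tangentSum K fun i j => ρ (f i j)).comap ρ.toLinearMap := by
        refine iSup_le fun i => iSup_le fun j => ?_
        rintro _ ⟨g, hg, rfl⟩
        rw [Submodule.mem_comap, LinearMap.mulLeft_apply, AlgHom.toLinearMap_apply, map_mul]
        exact hmem (i, j) hg.rename_isHomogeneous
      exact hu u.2
    · rw [map_sum, Finset.mul_sum]
      refine Submodule.sum_mem _ fun p _ => ?_
      rw [map_smul, mul_smul_comm, mul_comm]
      exact Submodule.smul_mem _ _ (hmem p (isHomogeneous_X _ _))
  have hinj : Function.Injective J := by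
    rw [← LinearMap.ker_eq_bot, LinearMap.ker_eq_bot']
    rintro ⟨u, c⟩ h0
    rw [hJ] at h0
    let ε : MvPolynomial (Fin (n + 1 + 1)) K →ₐ[K] MvPolynomial (Fin (n + 1)) K :=
      aeval (Fin.snoc X 0)
    have hερ : ∀ q, ε (ρ q) = q := fun q => by
      simp only [ε, ρ, aeval_rename]
      rw [show Fin.snoc X 0 ∘ Fin.castSucc = (X : Fin (n + 1) → MvPolynomial (Fin (n + 1)) K) by
        ext1 i; simp [Function.comp], aeval_X_left, AlgHom.id_apply]
    have hu : (u : MvPolynomial (Fin (n + 1)) K) = 0 := by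
      have := congrArg ε h0
      rwa [map_add, map_mul, hερ, map_zero, show ε (X (Fin.last (n + 1))) = 0 by simp [ε],
        zero_mul, add_zero] at this
    rw [hu, map_zero, zero_add, mul_eq_zero, or_iff_right (X_ne_zero _)] at h0
    have hc : ∑ p, c p • P p = 0 := by rw [← hερ (∑ p, c p • P p), h0, map_zero]
    exact Prod.ext (Subtype.ext hu) (funext (Fintype.linearIndependent_iff.1 hli c hc))
  have h1 := Submodule.finrank_mono hle
  rw [LinearMap.finrank_range_of_inj hinj, Module.finrank_prod,
    Module.finrank_fintype_fun_eq_card, Fintype.card_prod, Fintype.card_fin,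
    Fintype.card_fin] at h1
  nlinarith

theorem IsSub.mono {K : Type*} [Field K] {s n n' d : ℕ} (hn : 1 ≤ n) (hd : 2 ≤ d)
    (h : IsSub K s n d) (hnn : n ≤ n') : IsSub K s n' d := by
  induction n', hnn using Nat.le_induction with
  | base => exact h
  | succ k hk ih => exact ih.succ (hn.trans hk) hd

/-! ### Lines, planes, space and cubics -/

theorem isFill_line (K : Type*) [Field K] [CharZero K] {d : ℕ} (hd : 1 ≤ d) : IsFill K 1 1 d := by
  simpa using isFill_of_uniform_pattern K lineFill hd (m := d) (by omega)

theorem isSub_plane (K : Type*) [Field K] [CharZero K] {s d : ℕ} (hd : 1 ≤ d)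
    (hs : s ≤ (d + 2) / 4) : IsSub K s 2 d := by
  have hr : (d + 2) % 4 < 4 := Nat.mod_lt _ (by norm_num)
  have hN := Nat.mod_add_div (d + 2) 4
  refine IsSub.anti hd ?_ hs
  generalize (d + 2) / 4 = k at *
  generalize (d + 2) % 4 = e at *
  interval_cases e
  · simpa using isSub_of_uniform_pattern K planeSub_zero hd (m := k) (by omega)
  · simpa using isSub_of_uniform_pattern K planeSub_one hd (m := k) (by omega)
  · simpa using isSub_of_uniform_pattern K planeSub_two hd (m := k) (by omega)
  · simpa using isSub_of_uniform_pattern K planeSub_three hd (m := k) (by omega)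

theorem isFill_plane (K : Type*) [Field K] [CharZero K] {s d : ℕ} (hd : 1 ≤ d)
    (hs : (d + 2) / 4 < s) : IsFill K s 2 d := by
  obtain ⟨k, hk⟩ : ∃ k, d = 4 * k ∨ d = 4 * k + 1 ∨ d = 4 * k + 2 ∨ d = 4 * k + 3 :=
    ⟨d / 4, by omega⟩
  rcases hk with rfl | rfl | rfl | rfl
  · exact (isFill_of_uniform_pattern K planeFill_two hd (m := k) (by omega)).mono (by simp; omega)
  · exact (isFill_of_uniform_pattern K planeFill_three hd (m := k) (by omega)).mono (by simp; omega)
  · exact (isFill_of_uniform_pattern K planeFill_four hd (m := k) (by omega)).mono (by simp; omega)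
  · exact (isFill_of_uniform_pattern K planeFill_five hd (m := k) (by omega)).mono (by simp; omega)

theorem exists_eq_six_mul_add (d : ℕ) : ∃ k, d = 6 * k ∨ d = 6 * k + 1 ∨ d = 6 * k + 2 ∨
    d = 6 * k + 3 ∨ d = 6 * k + 4 ∨ d = 6 * k + 5 :=
  ⟨d / 6, by omega⟩

theorem le_of_cast_le {a s : ℕ} {q : ℚ} (ha : (a : ℚ) ≤ q) (hs : q ≤ s) : a ≤ s := by
  exact_mod_cast ha.trans hs

theorem isSub_space (K : Type*) [Field K] [CharZero K] {s d : ℕ} (hd : 1 ≤ d)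
    (hs : (s : ℚ) ≤ s1 d) : IsSub K s 3 d := by
  obtain ⟨k, hk⟩ := exists_eq_six_mul_add d
  rcases hk with rfl | rfl | rfl | rfl | rfl | rfl
  · refine (isSub_of_uniform_pattern K spaceSub_threes_three hd (m := 2 * k) (by omega)).anti hd
      (le_of_cast_le hs ?_)
    simp [s1, Nat.cast_choose_two]
    linarith
  · refine (isSub_of_pattern K spaceSub_sixes_three hd (M := k) (by omega)).anti hd
      (le_of_cast_le hs ?_)
    simp [s1, Nat.cast_choose_two, Nat.add_mod]
    linarith
  · refine (isSub_of_uniform_pattern K spaceSub_threes_two hd (m := 2 * k + 1) (by omega)).anti hd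
      (le_of_cast_le hs ?_)
    simp [s1, Nat.cast_choose_two, Nat.add_mod]
    linarith
  · refine (isSub_of_uniform_pattern K spaceSub_threes_three hd (m := 2 * k + 1) (by omega)).anti hd
      (le_of_cast_le hs ?_)
    simp [s1, Nat.cast_choose_two, Nat.add_mod]
    linarith
  · refine (isSub_of_uniform_pattern K spaceSub_sixes hd (m := k + 1) (by omega)).anti hd
      (le_of_cast_le hs ?_)
    simp [s1, Nat.cast_choose_two, Nat.add_mod]
    linarith
  · refine (isSub_of_uniform_pattern K spaceSub_threes_two hd (m := 2 * k + 2) (by omega)).anti hd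
      (le_of_cast_le hs ?_)
    simp [s1, Nat.cast_choose_two, Nat.add_mod]
    linarith

theorem isFill_space (K : Type*) [Field K] [CharZero K] {s d : ℕ} (hd : 1 ≤ d)
    (hs : s2 d ≤ s) : IsFill K s 3 d := by
  obtain ⟨k, hk⟩ := exists_eq_six_mul_add d
  rcases hk with rfl | rfl | rfl | rfl | rfl | rfl
  · refine (isFill_of_pattern K spaceFill_sixes_three hd (M := k) (by omega)).mono
      (le_of_cast_le ?_ hs)
    simp [s2, Nat.cast_choose_two]
    linarith
  · refine (isFill_of_uniform_pattern K spaceFill_threes hd (m := 2 * k + 1) (by omega)).mono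
      (le_of_cast_le ?_ hs)
    simp [s2, Nat.cast_choose_two, Nat.add_mod]
    linarith
  · refine (isFill_of_pattern K spaceFill_sixes_five hd (M := k) (by omega)).mono
      (le_of_cast_le ?_ hs)
    simp [s2, Nat.cast_choose_two, Nat.add_mod]
    linarith
  · refine (isFill_of_uniform_pattern K spaceFill_sixes hd (m := k + 1) (by omega)).mono
      (le_of_cast_le ?_ hs)
    simp [s2, Nat.cast_choose_two, Nat.add_mod]
    linarith
  · refine (isFill_of_uniform_pattern K spaceFill_threes hd (m := 2 * k + 2) (by omega)).mono
      (le_of_cast_le ?_ hs)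
    simp [s2, Nat.cast_choose_two, Nat.add_mod]
    linarith
  · refine (isFill_of_pattern K spaceFill_sixes_two hd (M := k + 1) (by omega)).mono
      (le_of_cast_le ?_ hs)
    simp [s2, Nat.cast_choose_two, Nat.add_mod]
    linarith

theorem isFill_cubic (K : Type*) [Field K] [CharZero K] {s n : ℕ} (hn : 1 ≤ n)
    (hs : s2 n ≤ s) : IsFill K s n 3 := by
  obtain ⟨k, hk⟩ := exists_eq_six_mul_add n
  rcases hk with rfl | rfl | rfl | rfl | rfl | rfl
  · obtain ⟨k, rfl⟩ : ∃ l, k = l + 1 := ⟨k - 1, by omega⟩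
    refine (isFill_of_cubic_pattern K cubicFill_sixes_nine (M := k) (by omega)).mono
      (le_of_cast_le ?_ hs)
    simp [s2, Nat.cast_choose_two]
    linarith
  · refine (isFill_of_uniform_cubic_pattern K cubicFill_threes (m := 2 * k + 1) (by omega)).mono
      (le_of_cast_le ?_ hs)
    simp [s2, Nat.cast_choose_two, Nat.add_mod]
    linarith
  · refine (isFill_of_cubic_pattern K cubicFill_sixes_five (M := k) (by omega)).mono
      (le_of_cast_le ?_ hs)
    simp [s2, Nat.cast_choose_two, Nat.add_mod]
    linarith
  · refine (isFill_of_uniform_cubic_pattern K cubicFill_sixes (m := k + 1) (by omega)).mono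
      (le_of_cast_le ?_ hs)
    simp [s2, Nat.cast_choose_two, Nat.add_mod]
    linarith
  · refine (isFill_of_uniform_cubic_pattern K cubicFill_threes (m := 2 * k + 2) (by omega)).mono
      (le_of_cast_le ?_ hs)
    simp [s2, Nat.cast_choose_two, Nat.add_mod]
    linarith
  · refine (isFill_of_cubic_pattern K cubicFill_sixes_two (M := k + 1) (by omega)).mono
      (le_of_cast_le ?_ hs)
    simp [s2, Nat.cast_choose_two, Nat.add_mod]
    linarith

/-! ### The reduction -/

theorem IsFill.nd {K : Type*} [Field K] {s n d : ℕ} (hd : 1 ≤ d) (h : IsFill K s n d) :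
    ND K s n d := by
  obtain ⟨f, hf, h⟩ := h
  exact ⟨f, hf, (finrank_tangentSum_le hd hf).antisymm ((min_le_right _ _).trans h)⟩

theorem IsSub.nd {K : Type*} [Field K] {s n d : ℕ} (hd : 1 ≤ d) (h : IsSub K s n d) :
    ND K s n d := by
  obtain ⟨f, hf, h⟩ := h
  exact ⟨f, hf, (finrank_tangentSum_le hd hf).antisymm ((min_le_left _ _).trans h)⟩

theorem isSub_of_nd {K : Type*} [Field K] {s n d : ℕ} (h : ND K s n d)
    (hle : s * (d * n + 1) ≤ (n + d).choose d) : IsSub K s n d := by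
  obtain ⟨f, hf, h⟩ := h
  exact ⟨f, hf, (h.trans (min_eq_left hle)).ge⟩

theorem nd_plane (K : Type*) [Field K] [CharZero K] {s d : ℕ} (hd : 1 ≤ d) : ND K s 2 d := by
  rcases le_or_gt s ((d + 2) / 4) with h | h
  · exact (isSub_plane K hd h).nd hd
  · exact (isFill_plane K hd h).nd hd

theorem exists_le_choose {d : ℕ} (s : ℕ) (hd : 2 ≤ d) :
    ∃ m, s * (d * m + 1) ≤ (m + d).choose d := by
  refine ⟨d.factorial * (s * (d + 1)), ?_⟩
  generalize hm : d.factorial * (s * (d + 1)) = m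
  have h1 : (m + 1) ^ d ≤ d.factorial * (m + d).choose d := by
    rw [← Nat.ascFactorial_eq_factorial_mul_choose]
    exact Nat.pow_succ_le_ascFactorial (m + 1) d
  have h2 : (m + 1) ^ 2 ≤ (m + 1) ^ d := Nat.pow_le_pow_right (by omega) hd
  have h3 : d.factorial * (s * (d * m + 1)) ≤ (m + 1) ^ 2 := by
    calc d.factorial * (s * (d * m + 1)) ≤ d.factorial * (s * ((d + 1) * (m + 1))) := by
          gcongr
          nlinarith
      _ = m * (m + 1) := by rw [← hm]; ring
      _ ≤ (m + 1) ^ 2 := by nlinarith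
  exact Nat.le_of_mul_le_mul_left (h3.trans (h2.trans h1)) d.factorial_pos

theorem le_choose_two_of_le {s d N : ℕ} (hs : 1 ≤ s) (hN : N ≤ 2)
    (h : s * (d * N + 1) ≤ (N + d).choose d) : s * (d * 2 + 1) ≤ (2 + d).choose d := by
  rw [← Nat.choose_symm_add] at h ⊢
  have h2 : 2 * (2 + d).choose 2 = (d + 2) * (d + 1) := by
    rw [Nat.choose_two_right, show 2 + d - 1 = d + 1 by omega, add_comm 2 d]
    exact Nat.mul_div_cancel' (by simpa [mul_comm] using (Nat.even_mul_succ_self (d + 1)).two_dvd)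
  have h1 : s = 1 → s * (d * 2 + 1) ≤ (2 + d).choose 2 := by
    rintro rfl
    have := Nat.le_mul_self d
    nlinarith
  interval_cases N
  · exact h1 (by simp at h; omega)
  · refine h1 ?_
    simp at h
    nlinarith
  · exact h

theorem sq_le_s1 (d : ℕ) : (d : ℚ) ^ 2 / 18 - 5 / 18 ≤ s1 d := by
  have : (0 : ℚ) ≤ d := d.cast_nonneg
  unfold s1
  split_ifs <;> linarith

theorem sq_le_s2 (d : ℕ) : (d : ℚ) ^ 2 / 18 - 5 / 18 ≤ s2 d := by
  have : (0 : ℚ) ≤ d := d.cast_nonneg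
  unfold s2
  split_ifs <;> linarith

theorem le_of_sq_le {s d : ℕ} (h : (d : ℚ) ^ 2 / 18 - 5 / 18 ≤ s) : d ≤ 18 * s + 5 := by
  have h' : d ^ 2 ≤ 18 * s + 5 := by
    have : (d : ℚ) ^ 2 ≤ 18 * s + 5 := by linarith
    exact_mod_cast this
  nlinarith

theorem le_sSup_s1 {s d : ℕ} (h : s1 d < s) : d ≤ sSup {e : ℕ | s1 e < s} :=
  le_csSup ⟨18 * s + 5, fun e (he : s1 e < s) => le_of_sq_le ((sq_le_s1 e).trans he.le)⟩ h

theorem le_sSup_s2 {s d : ℕ} (h : s2 d ≤ s) : d ≤ sSup {e : ℕ | s2 e ≤ s} :=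
  le_csSup ⟨18 * s + 5, fun e (he : s2 e ≤ s) => le_of_sq_le ((sq_le_s2 e).trans he)⟩ h

theorem s2_le_of_lt_sInf {s d : ℕ} (h : d < sInf {e : ℕ | (s : ℚ) < s2 e}) : s2 d ≤ s :=
  not_lt.1 (Nat.notMem_of_lt_sInf h)

end Chow

open Chow in
/-- Proposition 4.3 of the paper: If `ND(n,d)` holds in the three listed
finite ranges of cases, then `ND(n,d)` holds for all positive `n`, `d` except possibly when
`d = 2` and `n ≥ 2s`. -/
theorem stmt15 (K : Type*) [Field K] [IsAlgClosed K] [CharZero K]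
    (s : ℕ) (hs : 1 ≤ s)
    (hcases : ∀ n d : ℕ,
      ((d = 3 ∧ sInf {m : ℕ | (s : ℚ) < s2 m} ≤ n ∧
          n ≤ sInf {m : ℕ | s * (3 * m + 1) ≤ (m + 3).choose 3}) ∨
        (4 ≤ d ∧ d ≤ sSup {e : ℕ | s2 e ≤ (s : ℚ)} ∧ 4 ≤ n ∧
          n ≤ sInf {m : ℕ | s * (d * m + 1) ≤ (m + d).choose d}) ∨
        (sInf {e : ℕ | (s : ℚ) < s2 e} ≤ d ∧ d ≤ sSup {e : ℕ | s1 e < (s : ℚ)} ∧ 3 ≤ n ∧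
          n ≤ sInf {m : ℕ | s * (d * m + 1) ≤ (m + d).choose d})) →
      ND K s n d) :
    ∀ n d : ℕ, 1 ≤ n → 1 ≤ d → ¬(d = 2 ∧ 2 * s ≤ n) → ND K s n d := by
  intro n d hn hd hnd
  rcases (show d = 1 ∨ d = 2 ∨ 3 ≤ d by omega) with rfl | rfl | hd3
  · exact ((isFill_of_degree_one K n).mono hs).nd le_rfl
  · exact (isFill_of_degree_two K (by omega)).nd hd
  rcases (show n = 1 ∨ n = 2 ∨ 3 ≤ n by omega) with rfl | rfl | hn3
  · exact ((isFill_line K hd).mono hs).nd hd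
  · exact nd_plane K hd
  have hsmall : ∀ n, 3 ≤ n → n ≤ sInf {m : ℕ | s * (d * m + 1) ≤ (m + d).choose d} →
      ND K s n d := by
    intro n hn3 hle
    rcases hd3.eq_or_lt with rfl | hd4
    · rcases le_or_gt (sInf {m : ℕ | (s : ℚ) < s2 m}) n with h | h
      · exact hcases n 3 (.inl ⟨rfl, h, hle⟩)
      · exact (isFill_cubic K (by omega) (s2_le_of_lt_sInf h)).nd hd
    rcases le_or_gt (sInf {m : ℕ | (s : ℚ) < s2 m}) d with h | h
    · rcases lt_or_ge (s1 d) s with h1 | h1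
      · exact hcases n d (.inr (.inr ⟨h, le_sSup_s1 h1, hn3, hle⟩))
      · exact ((isSub_space K hd h1).mono (by norm_num) (by omega) hn3).nd hd
    · have h2 := s2_le_of_lt_sInf h
      rcases hn3.eq_or_lt with rfl | hn4
      · exact (isFill_space K hd h2).nd hd
      · exact hcases n d (.inr (.inl ⟨hd4, le_sSup_s2 h2, hn4, hle⟩))
  have hmem := Nat.sInf_mem (s := {m : ℕ | s * (d * m + 1) ≤ (m + d).choose d})
    (exists_le_choose s (by omega))
  generalize hN : sInf {m : ℕ | s * (d * m + 1) ≤ (m + d).choose d} = N at hmem hsmall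
  rcases le_or_gt n N with h | h
  · exact hsmall n hn3 h
  rcases le_or_gt N 2 with hN2 | hN3
  · exact ((isSub_of_nd (nd_plane K hd) (le_choose_two_of_le hs hN2 hmem)).mono (by norm_num)
      (by omega) (by omega)).nd hd
  · exact ((isSub_of_nd (hsmall N hN3 le_rfl) hmem).mono (by omega) (by omega) h.le).nd hd
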